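/- arXiv:1302.4295 — 2 statements merged into one kernel-verified Lean document; each statement's English description precedes it below -/
import Mathlib

section
/- There exists a constant c > 0 such that for all integers n ≥ 2, 1 ≤ k ≤ n and 1 ≤ d ≤ C(n−1,k−1) satisfying that n·d is divisible by k and min(n·d/k, C(n,k) − n·d/k) ≥ n^c, the number of d-regular, k-uniform hypergraphs on n vertices equals [ 1 / ( (2π·p·(1−p))^(n/2) · p^(n·d/k) · (1−p)^(C(n,k)−n·d/k) ) ] · ( k/C(n−1,k−1) )^(1/2) · ( 1/C(n−2,k−1) )^((n−1)/2) · (1+δ), where p := n·d/(k·C(n,k)) and |δ| ≤ n^c/√(min(n·d/k, C(n,k)−n·d/k)). -/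
/-- A simple `k`-uniform hypergraph on `n` vertices (a family of distinct `k`-element
subsets of `[n]`) is `d`-regular if each vertex belongs to exactly `d` edges. -/
def IsRegularHypergraph (n k d : ℕ) (T : Finset (Finset (Fin n))) : Prop :=
  (∀ b ∈ T, b.card = k) ∧
    ∀ i : Fin n, (T.filter fun b => i ∈ b).card = d


section

open Finset MeasureTheory

set_option linter.unusedSectionVars false

variable {V : Type*} [Fintype V] [DecidableEq V]

/-- The number of `k`-sets containing a given vertex. -/
lemma card_powersetCard_filter_mem {k : ℕ} (hk : 1 ≤ k) (i : V) :
    #{b ∈ powersetCard k (univ : Finset V) | i ∈ b} = (Fintype.card V - 1).choose (k - 1) := by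
  have h := card_filter_powersetCard_subset {i} (univ : Finset V) k (by simp) (by simpa)
  simpa using h

/-- The number of `k`-sets containing two given vertices. -/
lemma card_powersetCard_filter_mem_mem {k : ℕ} (hk : 2 ≤ k) {i j : V} (hij : i ≠ j) :
    #{b ∈ powersetCard k (univ : Finset V) | i ∈ b ∧ j ∈ b}
      = (Fintype.card V - 2).choose (k - 2) := by
  have h := card_filter_powersetCard_subset {i, j} (univ : Finset V) k (by simp)
    (by simpa [card_pair hij])
  simpa [card_pair hij, insert_subset_iff] using h

lemma choose_pred_eq_add {n k : ℕ} (hk : 2 ≤ k) (hn : 2 ≤ n) :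
    (n - 1).choose (k - 1) = (n - 2).choose (k - 2) + (n - 2).choose (k - 1) := by
  obtain ⟨k, rfl⟩ := Nat.exists_eq_add_of_le' hk
  obtain ⟨n, rfl⟩ := Nat.exists_eq_add_of_le' hn
  exact Nat.choose_succ_succ n k

lemma choose_pred_add_mul {n k : ℕ} (hk : 2 ≤ k) (hn : 2 ≤ n) :
    (n - 2).choose (k - 1) + n * (n - 2).choose (k - 2) = k * (n - 1).choose (k - 1) := by
  have h := choose_pred_eq_add hk hn
  obtain ⟨k, rfl⟩ := Nat.exists_eq_add_of_le' hk
  obtain ⟨n, rfl⟩ := Nat.exists_eq_add_of_le' hn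
  have h2 := Nat.add_one_mul_choose_eq n k
  simp only [Nat.add_sub_cancel, show n + 2 - 1 = n + 1 by omega,
    show k + 2 - 1 = k + 1 by omega] at *
  linarith

lemma sum_sq_sum_powersetCard {k : ℕ} (hk : 2 ≤ k) (hn : 2 ≤ Fintype.card V) (η : V → ℝ) :
    ∑ b ∈ powersetCard k (univ : Finset V), (∑ i ∈ b, η i) ^ 2
      = ((Fintype.card V - 2).choose (k - 1) : ℝ) * ∑ i, η i ^ 2
        + ((Fintype.card V - 2).choose (k - 2) : ℝ) * (∑ i, η i) ^ 2 := by
  have hsum (b : Finset V) : (∑ i ∈ b, η i) ^ 2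
      = ∑ i, ∑ j, if i ∈ b ∧ j ∈ b then η i * η j else 0 := by
    rw [sq, sum_mul_sum]
    simp [ite_and, sum_ite_mem]
  rw [sum_congr rfl fun b _ ↦ hsum b, sum_comm]
  simp_rw [sum_comm (s := powersetCard k univ), ← sum_filter, sum_const, nsmul_eq_mul]
  rw [sq (∑ i, η i), sum_mul_sum, mul_sum, mul_sum, ← sum_add_distrib]
  refine sum_congr rfl fun i _ ↦ ?_
  rw [mul_sum, ← add_sum_erase _ _ (mem_univ i), ← add_sum_erase _ _ (mem_univ i)]
  simp only [and_self]
  rw [card_powersetCard_filter_mem (by omega), choose_pred_eq_add hk hn, ← add_assoc]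
  congr 1
  · push_cast; ring
  · refine sum_congr rfl fun j hj ↦ ?_
    rw [card_powersetCard_filter_mem_mem hk (ne_of_mem_erase hj).symm]

/-- A change of variables sending the sums over hyperedges to the forms `phase`. -/
noncomputable def recenter (o : V) (k : ℕ) (y : V → ℝ) (i : V) : ℝ :=
  (if i = o then 0 else y i) + y o / k

/-- The phase of the hyperedge `b`: the root coordinate `y o` is seen by every hyperedge. -/
noncomputable def phase (o : V) (b : Finset V) (y : V → ℝ) : ℝ := y o + ∑ i ∈ b.erase o, y i

lemma phase_eq_sum_recenter (o : V) {k : ℕ} (hk : k ≠ 0) {b : Finset V}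
    (hb : b ∈ powersetCard k (univ : Finset V)) (y : V → ℝ) :
    phase o b y = ∑ i ∈ b, recenter o k y i := by
  have hk' : (k : ℝ) ≠ 0 := by exact_mod_cast hk
  rw [mem_powersetCard_univ] at hb
  simp only [phase, recenter, sum_add_distrib, sum_const, hb, nsmul_eq_mul]
  rw [mul_div_cancel₀ _ hk', add_comm, sum_ite, filter_ne', sum_const_zero, zero_add]

/-- The sum of the squared phases over all hyperedges. -/
noncomputable def phaseEnergy (o : V) (k : ℕ) (y : V → ℝ) : ℝ :=
  ∑ b ∈ powersetCard k (univ : Finset V), phase o b y ^ 2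

lemma phaseEnergy_eq (o : V) {k : ℕ} (hk : 2 ≤ k) (hn : 2 ≤ Fintype.card V) (y : V → ℝ) :
    phaseEnergy o k y = ((Fintype.card V - 2).choose (k - 1) : ℝ) * ∑ i, recenter o k y i ^ 2
        + ((Fintype.card V - 2).choose (k - 2) : ℝ) * (∑ i, recenter o k y i) ^ 2 := by
  rw [← sum_sq_sum_powersetCard hk hn]
  exact sum_congr rfl fun b hb ↦ by rw [phase_eq_sum_recenter o (by omega) hb]

lemma phase_sq_le (o : V) {k : ℕ} (hk : 2 ≤ k) (hn : 2 ≤ Fintype.card V) {b : Finset V}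
    (hb : b ∈ powersetCard k (univ : Finset V)) (y : V → ℝ) :
    ((Fintype.card V - 2).choose (k - 1) : ℝ) * phase o b y ^ 2
      ≤ Fintype.card V * phaseEnergy o k y := by
  rw [phaseEnergy_eq o hk hn, phase_eq_sum_recenter o (by omega) hb]
  have h1 : (∑ i ∈ b, recenter o k y i) ^ 2 ≤ Fintype.card V * ∑ i, recenter o k y i ^ 2 :=
    sq_sum_le_card_mul_sum_sq.trans <| mul_le_mul (by exact_mod_cast card_le_univ b)
      (sum_le_univ_sum_of_nonneg fun i ↦ sq_nonneg _) (sum_nonneg fun i _ ↦ sq_nonneg _)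
      (by positivity)
  have h2 : (0 : ℝ) ≤ (Fintype.card V - 2).choose (k - 1) := by positivity
  have h3 : (0 : ℝ) ≤ Fintype.card V * (((Fintype.card V - 2).choose (k - 2) : ℝ)
    * (∑ i, recenter o k y i) ^ 2) := by positivity
  nlinarith [mul_le_mul_of_nonneg_left h1 h2]

/-- The matrix of the linear map turning `phaseEnergy` into a multiple of the sum of squares. -/
noncomputable def energyMatrix (o : V) (k : ℕ) (t : ℝ) : Matrix V V ℝ :=
  (1 + Matrix.vecMulVec (fun _ ↦ t) (fun _ ↦ 1)) *
    (1 + Matrix.vecMulVec (fun i ↦ (k : ℝ)⁻¹ - if i = o then 1 else 0) (Pi.single o 1))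

lemma det_energyMatrix (o : V) (k : ℕ) (t : ℝ) :
    (energyMatrix o k t).det = (1 + Fintype.card V * t) * (k : ℝ)⁻¹ := by
  simp [energyMatrix, Matrix.det_mul, Matrix.vecMulVec_eq Unit,
    Matrix.det_one_add_replicateCol_mul_replicateRow, dotProduct, Pi.single_apply]

lemma energyMatrix_mulVec (o : V) (k : ℕ) (t : ℝ) (y : V → ℝ) (i : V) :
    (energyMatrix o k t).mulVec y i = recenter o k y i + t * ∑ j, recenter o k y j := by
  have h : (1 + Matrix.vecMulVec (fun i ↦ (k : ℝ)⁻¹ - if i = o then 1 else 0)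
      (Pi.single o (1 : ℝ))).mulVec y = recenter o k y := by
    ext i
    rw [Matrix.add_mulVec, Matrix.one_mulVec, Matrix.vecMulVec_mulVec]
    by_cases hi : i = o
    · subst hi; simp [recenter]; ring
    · simp [recenter, hi]; ring
  rw [energyMatrix, ← Matrix.mulVec_mulVec, h, Matrix.add_mulVec, Matrix.one_mulVec,
    Matrix.vecMulVec_mulVec]
  simp [dotProduct, mul_comm]

lemma exists_phaseEnergy_eq_mulVec (o : V) {k : ℕ} (hk : 2 ≤ k) (hn : 2 ≤ Fintype.card V)
    (hα : 0 < (Fintype.card V - 2).choose (k - 1)) :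
    ∃ t : ℝ, 1 + Fintype.card V * t = √(k * ((Fintype.card V - 1).choose (k - 1) : ℝ)
        / (Fintype.card V - 2).choose (k - 1)) ∧
      ∀ y : V → ℝ, phaseEnergy o k y = ((Fintype.card V - 2).choose (k - 1) : ℝ)
        * ∑ i, (energyMatrix o k t).mulVec y i ^ 2 := by
  have hn0 : (Fintype.card V : ℝ) ≠ 0 := by positivity
  have hα0 : (0 : ℝ) < (Fintype.card V - 2).choose (k - 1) := by exact_mod_cast hα
  set r := √(k * ((Fintype.card V - 1).choose (k - 1) : ℝ)
        / (Fintype.card V - 2).choose (k - 1)) with hr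
  refine ⟨(r - 1) / Fintype.card V, by field_simp; ring, fun y ↦ ?_⟩
  have hr2 : r ^ 2 * (Fintype.card V - 2).choose (k - 1)
      = (Fintype.card V - 2).choose (k - 1)
        + Fintype.card V * (Fintype.card V - 2).choose (k - 2) := by
    rw [hr, Real.sq_sqrt (by positivity), div_mul_cancel₀ _ hα0.ne']
    exact_mod_cast (choose_pred_add_mul hk hn).symm
  have hβ : ((Fintype.card V - 2).choose (k - 2) : ℝ)
      = (r ^ 2 - 1) / Fintype.card V * (Fintype.card V - 2).choose (k - 1) := by
    field_simp
    linarith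
  rw [phaseEnergy_eq o hk hn, hβ]
  simp_rw [energyMatrix_mulVec, add_sq, sum_add_distrib, ← sum_mul, ← mul_sum, sum_const,
    card_univ, nsmul_eq_mul]
  field_simp
  ring

lemma integral_exp_neg_phaseEnergy (o : V) {k : ℕ} (hk : 2 ≤ k) (hn : 2 ≤ Fintype.card V)
    (hα : 0 < (Fintype.card V - 2).choose (k - 1)) {l : ℝ} (hl : 0 < l) :
    Integrable (fun y : V → ℝ ↦ Real.exp (-l * phaseEnergy o k y)) ∧
      ∫ y : V → ℝ, Real.exp (-l * phaseEnergy o k y)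
        = k / √(k * ((Fintype.card V - 1).choose (k - 1) : ℝ)
            / (Fintype.card V - 2).choose (k - 1))
          * √(Real.pi / (l * (Fintype.card V - 2).choose (k - 1))) ^ Fintype.card V := by
  obtain ⟨t, ht, hE⟩ := exists_phaseEnergy_eq_mulVec o hk hn hα
  have hα0 : (0 : ℝ) < (Fintype.card V - 2).choose (k - 1) := by exact_mod_cast hα
  have hD : 0 < (Fintype.card V - 1).choose (k - 1) := by
    rw [choose_pred_eq_add hk hn]; omega
  have hk0 : (0 : ℝ) < k := by positivity
  have hr : 0 < √(k * ((Fintype.card V - 1).choose (k - 1) : ℝ)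
            / (Fintype.card V - 2).choose (k - 1)) := by positivity
  set r := √(k * ((Fintype.card V - 1).choose (k - 1) : ℝ)
            / (Fintype.card V - 2).choose (k - 1))
  set a := ((Fintype.card V - 2).choose (k - 1) : ℝ)
  set g : (V → ℝ) → ℝ := fun z ↦ ∏ i, Real.exp (-(l * a) * z i ^ 2) with hg
  have hgi : Integrable g :=
    Integrable.fintype_prod fun _ ↦ integrable_exp_neg_mul_sq (by positivity)
  have hgI : ∫ z, g z = √(Real.pi / (l * a)) ^ Fintype.card V := by
    rw [hg, integral_fintype_prod_volume_eq_pow (fun x : ℝ ↦ Real.exp (-(l * a) * x ^ 2)),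
      integral_gaussian]
  have hdet : (energyMatrix o k t).det = r / k := by
    rw [det_energyMatrix, ht, div_eq_mul_inv]
  have hdet0 : (energyMatrix o k t).det ≠ 0 := by rw [hdet]; positivity
  have hmap := Real.map_matrix_volume_pi_eq_smul_volume_pi hdet0
  have hcomp : (fun y : V → ℝ ↦ Real.exp (-l * phaseEnergy o k y))
      = fun y ↦ g (Matrix.toLin' (energyMatrix o k t) y) := by
    ext y
    simp only [hg, hE, Matrix.toLin'_apply, ← Real.exp_sum, ← mul_sum]
    ring_nf
  have hmeas : AEMeasurable (Matrix.toLin' (energyMatrix o k t)) (volume : Measure (V → ℝ)) :=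
    (LinearMap.continuous_of_finiteDimensional _).aemeasurable
  have hgi' : Integrable g (Measure.map (Matrix.toLin' (energyMatrix o k t)) volume) := by
    rw [hmap]; exact hgi.smul_measure ENNReal.ofReal_ne_top
  rw [hcomp]
  refine ⟨hgi'.comp_aemeasurable hmeas, ?_⟩
  rw [← integral_map hmeas hgi'.aestronglyMeasurable, hmap, integral_smul_measure, hgI, hdet,
    ENNReal.toReal_ofReal (abs_nonneg _), inv_div, abs_of_pos (by positivity), smul_eq_mul]

/-- The characteristic function of a centred Bernoulli variable of mean `p`. -/
noncomputable def bernoulliChar (p u : ℝ) : ℂ :=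
  p * Complex.exp (((1 - p) * u : ℝ) * Complex.I)
    + (1 - p : ℝ) * Complex.exp ((-p * u : ℝ) * Complex.I)

lemma continuous_bernoulliChar (p : ℝ) : Continuous (bernoulliChar p) := by
  unfold bernoulliChar; fun_prop

lemma continuous_phase (o : V) (b : Finset V) : Continuous (phase o b) := by
  unfold phase; fun_prop

/-- The characteristic function of the centred random degree sequence, in the coordinates given by
the phases. -/
noncomputable def degreeChar (o : V) (k : ℕ) (p : ℝ) (y : V → ℝ) : ℂ :=
  ∏ b ∈ powersetCard k (univ : Finset V), bernoulliChar p (2 * Real.pi * phase o b y)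

lemma continuous_degreeChar (o : V) (k : ℕ) (p : ℝ) : Continuous (degreeChar o k p) := by
  unfold degreeChar
  exact continuous_finsetProd _ fun b _ ↦ (continuous_bernoulliChar p).comp
    ((continuous_phase o b).const_mul _)

/-- The frequency of the root coordinate is the number of hyperedges, and the frequency of any
other coordinate is the degree of that vertex. -/
lemma sum_phase (o : V) (T : Finset (Finset V)) (y : V → ℝ) :
    ∑ b ∈ T, phase o b y
      = ∑ i, ((if i = o then #T else #{b ∈ T | i ∈ b} : ℕ) : ℝ) * y i := by
  rw [← add_sum_erase _ _ (mem_univ o)]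
  simp only [phase, sum_add_distrib, sum_const, nsmul_eq_mul, if_true]
  congr 1
  have h (b : Finset V) : ∑ i ∈ b.erase o, y i = ∑ i ∈ univ.erase o, if i ∈ b then y i else 0 := by
    rw [← sum_filter]
    congr 1
    ext i
    simp
  simp_rw [h]
  rw [sum_comm]
  refine sum_congr rfl fun i hi ↦ ?_
  rw [if_neg (ne_of_mem_erase hi), ← sum_filter, sum_const, nsmul_eq_mul]

/-- The half-open unit cube centred at the origin. -/
def centredCube (V : Type*) : Set (V → ℝ) :=
  Set.univ.pi fun _ ↦ Set.Ioc (-(1 / 2)) (1 / 2)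

lemma measurableSet_centredCube : MeasurableSet (centredCube V) :=
  MeasurableSet.univ_pi fun _ ↦ measurableSet_Ioc

lemma volume_centredCube : volume (centredCube V) = 1 := by
  simp only [centredCube, volume_pi_pi, Real.volume_Ioc]
  norm_num

lemma integral_exp_two_pi_int (m : ℤ) :
    ∫ x in Set.Ioc (-(1 / 2) : ℝ) (1 / 2), Complex.exp (2 * Real.pi * Complex.I * m * x)
      = if m = 0 then 1 else 0 := by
  rw [← intervalIntegral.integral_of_le (by norm_num)]
  split_ifs with h
  · simp [h]; norm_num
  · have hc : (2 * Real.pi * Complex.I * m : ℂ) ≠ 0 := by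
      have : (Real.pi : ℂ) ≠ 0 := by exact_mod_cast Real.pi_ne_zero
      have : (m : ℂ) ≠ 0 := by exact_mod_cast h
      simp_all
    rw [integral_exp_mul_complex hc]
    have : (2 * Real.pi * Complex.I * m * ((1 / 2 : ℝ) : ℂ) : ℂ)
        = 2 * Real.pi * Complex.I * m * ((-(1 / 2) : ℝ) : ℂ) + m * (2 * Real.pi * Complex.I) := by
      push_cast; ring
    rw [this, Complex.exp_add, Complex.exp_int_mul_two_pi_mul_I]
    simp

lemma setIntegral_centredCube_exp (m : V → ℤ) :
    ∫ y in centredCube V, Complex.exp (2 * Real.pi * Complex.I * ((∑ i, m i * y i : ℝ) : ℂ))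
      = if m = 0 then 1 else 0 := by
  have h1 : (fun y : V → ℝ ↦ Complex.exp (2 * Real.pi * Complex.I * ((∑ i, m i * y i : ℝ) : ℂ)))
      = fun y ↦ ∏ i, Complex.exp (2 * Real.pi * Complex.I * m i * y i) := by
    ext y
    rw [← Complex.exp_sum]
    push_cast
    rw [mul_sum]
    simp only [mul_assoc]
  rw [h1, centredCube, volume_pi, Measure.restrict_pi_pi,
    integral_fintype_prod_eq_prod (fun i (x : ℝ) ↦ Complex.exp (2 * Real.pi * Complex.I * m i * x))]
  simp_rw [integral_exp_two_pi_int]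
  split_ifs with h
  · simp [h]
  · obtain ⟨i, hi⟩ := Function.ne_iff.mp h
    exact prod_eq_zero (mem_univ i) (if_neg hi)

lemma sum_card_filter_mem {k : ℕ} {T : Finset (Finset V)} (hT : ∀ b ∈ T, #b = k) :
    ∑ i, #{b ∈ T | i ∈ b} = k * #T := by
  have h := sum_card_bipartiteAbove_eq_sum_card_bipartiteBelow (fun (i : V) (b : Finset V) ↦ i ∈ b)
    (s := univ) (t := T)
  simp only [bipartiteAbove, bipartiteBelow, filter_univ_mem] at h
  rw [h, sum_congr rfl hT, sum_const, smul_eq_mul, mul_comm]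

lemma card_and_degree_iff (o : V) {k N d : ℕ} (hk : k ≠ 0) (hN : k * N = Fintype.card V * d)
    {T : Finset (Finset V)} (hT : ∀ b ∈ T, #b = k) :
    (∀ i, (if i = o then #T else #{b ∈ T | i ∈ b}) = if i = o then N else d)
      ↔ ∀ i, #{b ∈ T | i ∈ b} = d := by
  have hs := sum_card_filter_mem hT
  constructor
  · intro h i
    by_cases hi : i = o
    · have ho := h o
      simp only [if_true] at ho
      rw [ho, hN, ← add_sum_erase _ _ (mem_univ o), sum_congr rfl (g := fun _ ↦ d), sum_const,
        card_erase_of_mem (mem_univ o), card_univ, smul_eq_mul] at hs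
      · obtain ⟨m, hm⟩ : ∃ m, Fintype.card V = m + 1 :=
          Nat.exists_eq_succ_of_ne_zero (Fintype.card_pos_iff.mpr ⟨o⟩).ne'
        rw [hm, Nat.add_sub_cancel, add_mul, one_mul, add_comm] at hs
        rw [hi]
        exact Nat.add_left_cancel hs
      · intro j hj
        simpa [ne_of_mem_erase hj] using h j
    · simpa [hi] using h i
  · intro h i
    by_cases hi : i = o
    · simp only [hi, if_true]
      simp only [h, sum_const, card_univ, smul_eq_mul, ← hN] at hs
      exact (Nat.eq_of_mul_eq_mul_left (Nat.pos_of_ne_zero hk) hs).symm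
    · simpa [hi] using h i

/-- Fourier inversion: the probability that a binomial random hypergraph is regular. -/
lemma integral_degreeChar (o : V) {k N d : ℕ} {p : ℝ} (hk : 1 ≤ k)
    (hN : k * N = Fintype.card V * d)
    (hpN : p * (Fintype.card V).choose k = N)
    (hpd : p * (Fintype.card V - 1).choose (k - 1) = d) :
    ∫ y in centredCube V, degreeChar o k p y
      = ((#{T ∈ (powersetCard k (univ : Finset V)).powerset | ∀ i, #{b ∈ T | i ∈ b} = d} : ℝ)
          * (p ^ N * (1 - p) ^ ((Fintype.card V).choose k - N)) : ℝ) := by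
  set E := powersetCard k (univ : Finset V) with hE
  have hEc : #E = (Fintype.card V).choose k := by simp [hE]
  have hexp (y : V → ℝ) : degreeChar o k p y = ∑ T ∈ E.powerset,
      ((p ^ #T * (1 - p) ^ (#E - #T) : ℝ) : ℂ) * Complex.exp (2 * Real.pi * Complex.I *
        ((∑ i, ((((if i = o then #T else #{b ∈ T | i ∈ b} : ℕ) : ℤ)
          - ((if i = o then N else d : ℕ) : ℤ) : ℤ) : ℝ) * y i : ℝ) : ℂ)) := by
    rw [degreeChar]
    simp_rw [bernoulliChar]
    rw [prod_add]
    refine sum_congr rfl fun T hT ↦ ?_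
    rw [mem_powerset] at hT
    rw [prod_mul_distrib, prod_mul_distrib, prod_const, prod_const, card_sdiff_of_subset hT,
      ← Complex.exp_sum, ← Complex.exp_sum, mul_mul_mul_comm, ← Complex.exp_add]
    have h1 : ∑ i, ((((if i = o then #T else #{b ∈ T | i ∈ b} : ℕ) : ℤ)
          - ((if i = o then N else d : ℕ) : ℤ) : ℤ) : ℝ) * y i
        = ∑ b ∈ T, phase o b y - p * ∑ b ∈ E, phase o b y := by
      rw [sum_phase, sum_phase, mul_sum, ← sum_sub_distrib]
      refine sum_congr rfl fun i _ ↦ ?_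
      have : ((if i = o then N else d : ℕ) : ℝ)
          = p * ((if i = o then #E else #{b ∈ E | i ∈ b} : ℕ) : ℝ) := by
        split_ifs
        · rw [hEc, hpN]
        · rw [card_powersetCard_filter_mem hk, hpd]
      push_cast [Int.cast_sub] at this ⊢
      rw [this]
      ring
    rw [h1, ← sum_sdiff hT]
    have h2 (c : ℝ) (S : Finset (Finset V)) :
        ∑ b ∈ S, ((c * (2 * Real.pi * phase o b y) : ℝ) : ℂ) * Complex.I
          = ((c * (2 * Real.pi) * ∑ b ∈ S, phase o b y : ℝ) : ℂ) * Complex.I := by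
      rw [← sum_mul, ← Complex.ofReal_sum, mul_sum]
      simp only [mul_assoc]
    rw [h2, h2]
    push_cast
    congr 2
    ring
  simp_rw [hexp]
  rw [integral_finsetSum]
  · simp_rw [integral_const_mul, setIntegral_centredCube_exp]
    rw [sum_congr rfl (g := fun T ↦ if ∀ i, #{b ∈ T | i ∈ b} = d then
      ((p ^ N * (1 - p) ^ ((Fintype.card V).choose k - N) : ℝ) : ℂ) else 0)]
    · rw [← sum_filter, sum_const, nsmul_eq_mul]
      push_cast
      rfl
    · intro T hT
      have hT' : ∀ b ∈ T, #b = k := fun b hb ↦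
        mem_powersetCard_univ.mp (mem_powerset.mp hT hb)
      have hiff := card_and_degree_iff o (by omega) hN hT'
      have hz : ((fun i ↦ (((if i = o then #T else #{b ∈ T | i ∈ b} : ℕ) : ℤ)
          - ((if i = o then N else d : ℕ) : ℤ) : ℤ)) = 0) ↔ ∀ i, #{b ∈ T | i ∈ b} = d := by
        rw [← hiff, funext_iff]
        simp only [Pi.zero_apply, sub_eq_zero, Nat.cast_inj]
      by_cases h : ∀ i, #{b ∈ T | i ∈ b} = d
      · have hc : #T = N := by simpa using hiff.mpr h o
        rw [if_pos h, if_pos (hz.mpr h), hc, hEc, mul_one]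
      · rw [if_neg h, if_neg (hz.not.mpr h), mul_zero]
  · intro T _
    refine (Integrable.const_mul ?_ _)
    have : IsFiniteMeasure (volume.restrict (centredCube V)) :=
      ⟨by rw [Measure.restrict_apply_univ, volume_centredCube]; exact ENNReal.one_lt_top⟩
    refine Integrable.of_bound (C := 1) (Continuous.aestronglyMeasurable (by fun_prop)) ?_
    refine ae_of_all _ fun y ↦ ?_
    rw [show ∀ x : ℝ, 2 * Real.pi * Complex.I * (x : ℂ) = ((2 * Real.pi * x : ℝ) : ℂ) * Complex.I
      by intro x; push_cast; ring, Complex.norm_exp_ofReal_mul_I]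

lemma norm_bernoulliChar_le (p u : ℝ) :
    ‖bernoulliChar p u‖ ≤ Real.exp (-2 * (p * (1 - p)) * Real.sin (u / 2) ^ 2) := by
  have hsq : ‖bernoulliChar p u‖ ^ 2 = 1 - 4 * (p * (1 - p)) * Real.sin (u / 2) ^ 2 := by
    rw [← Complex.normSq_eq_norm_sq, bernoulliChar, Complex.normSq_apply]
    simp only [Complex.add_re, Complex.add_im, Complex.re_ofReal_mul, Complex.im_ofReal_mul,
      Complex.exp_ofReal_mul_I_re, Complex.exp_ofReal_mul_I_im]
    have h1 : Real.cos u = 1 - 2 * Real.sin (u / 2) ^ 2 := by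
      have := Real.cos_two_mul (u / 2)
      rw [mul_div_cancel₀ u (two_ne_zero' ℝ)] at this
      rw [this, Real.cos_sq']; ring
    have h2 : Real.cos u = Real.cos ((1 - p) * u) * Real.cos (-p * u)
        + Real.sin ((1 - p) * u) * Real.sin (-p * u) := by
      rw [← Real.cos_sub]; congr 1; ring
    linear_combination p ^ 2 * Real.sin_sq_add_cos_sq ((1 - p) * u)
      + (1 - p) ^ 2 * Real.sin_sq_add_cos_sq (-p * u) - 2 * p * (1 - p) * h2
      + 2 * p * (1 - p) * h1
  refine le_of_sq_le_sq ?_ (Real.exp_pos _).le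
  rw [hsq, ← Real.exp_nat_mul]
  refine le_trans ?_ (Real.add_one_le_exp _)
  push_cast
  linarith

lemma norm_exp_ofReal_mul_I_sub_le {x : ℝ} (hx : |x| ≤ 1) :
    ‖Complex.exp (x * Complex.I) - (1 + x * Complex.I - (x ^ 2 / 2 : ℝ))‖ ≤ |x| ^ 3 := by
  have h := Complex.exp_bound (x := x * Complex.I) (by simpa using hx) (n := 3) (by norm_num)
  have hn : ‖(x : ℂ) * Complex.I‖ = |x| := by simp
  rw [hn] at h
  have he : ∑ m ∈ range 3, ((x : ℂ) * Complex.I) ^ m / (m.factorial : ℂ)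
      = 1 + x * Complex.I - (x ^ 2 / 2 : ℝ) := by
    simp [sum_range_succ, mul_pow, Nat.factorial]
    ring
  rw [he] at h
  refine h.trans ?_
  have : 0 ≤ |x| ^ 3 := by positivity
  norm_num [Nat.factorial]
  linarith

lemma norm_bernoulliChar_sub_le {p : ℝ} (hp0 : 0 ≤ p) (hp1 : p ≤ 1) {u : ℝ} (hu : |u| ≤ 1) :
    ‖bernoulliChar p u - (Real.exp (-(p * (1 - p) * u ^ 2 / 2)) : ℝ)‖
      ≤ 2 * (p * (1 - p)) * |u| ^ 3 := by
  have hq : 0 ≤ 1 - p := by linarith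
  have hu0 := abs_nonneg u
  set a := (1 - p) * u with ha
  set b := -p * u with hb
  have haa : |a| = (1 - p) * |u| := by rw [ha, abs_mul, abs_of_nonneg hq]
  have hba : |b| = p * |u| := by rw [hb, abs_mul, abs_neg, abs_of_nonneg hp0]
  have h1 := norm_exp_ofReal_mul_I_sub_le (x := a) (by rw [haa]; nlinarith)
  have h2 := norm_exp_ofReal_mul_I_sub_le (x := b) (by rw [hba]; nlinarith)
  set w := p * (1 - p) * u ^ 2 / 2 with hw
  have hqle : p * (1 - p) ≤ 1 := by nlinarith
  have hq0 : 0 ≤ p * (1 - p) := by positivity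
  have hu2 : u ^ 2 = |u| ^ 2 := (sq_abs u).symm
  have hw0 : 0 ≤ w := by positivity
  have hw1 : w ≤ 1 := by rw [hw, hu2]; nlinarith [mul_nonneg hu0 hu0]
  have h3 : ‖((Real.exp (-w) - (1 - w) : ℝ) : ℂ)‖ ≤ p * (1 - p) * |u| ^ 3 := by
    have h := Real.abs_exp_sub_one_sub_id_le (x := -w)
      (by rw [abs_neg, abs_of_nonneg hw0]; exact hw1)
    rw [Complex.norm_real, Real.norm_eq_abs,
      show Real.exp (-w) - (1 - w) = Real.exp (-w) - 1 - -w by ring]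
    refine h.trans ?_
    rw [neg_sq, hw, hu2]
    have e : (p * (1 - p) * |u| ^ 2 / 2) ^ 2
        = (p * (1 - p) * |u| ^ 3) * (p * (1 - p) * |u| / 4) := by
      ring
    rw [e]
    exact mul_le_of_le_one_right (by positivity) (by nlinarith)
  have key : bernoulliChar p u - (Real.exp (-w) : ℝ)
      = p * (Complex.exp (a * Complex.I) - (1 + a * Complex.I - (a ^ 2 / 2 : ℝ)))
        + (1 - p : ℝ) * (Complex.exp (b * Complex.I) - (1 + b * Complex.I - (b ^ 2 / 2 : ℝ)))
        - ((Real.exp (-w) - (1 - w) : ℝ) : ℂ) := by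
    simp only [bernoulliChar, ha, hb, hw]
    push_cast
    ring
  rw [key]
  refine (norm_sub_le _ _).trans ?_
  have h4 : ‖(p : ℂ) * (Complex.exp (a * Complex.I) - (1 + a * Complex.I - (a ^ 2 / 2 : ℝ)))‖
      ≤ p * ((1 - p) * |u|) ^ 3 := by
    rw [norm_mul, Complex.norm_real, Real.norm_eq_abs, abs_of_nonneg hp0, ← haa]
    exact mul_le_mul_of_nonneg_left h1 hp0
  have h5 : ‖((1 - p : ℝ) : ℂ)
      * (Complex.exp (b * Complex.I) - (1 + b * Complex.I - (b ^ 2 / 2 : ℝ)))‖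
      ≤ (1 - p) * (p * |u|) ^ 3 := by
    rw [norm_mul, Complex.norm_real, Real.norm_eq_abs, abs_of_nonneg hq, ← hba]
    exact mul_le_mul_of_nonneg_left h2 hq
  have h6 : p * ((1 - p) * |u|) ^ 3 + (1 - p) * (p * |u|) ^ 3 ≤ p * (1 - p) * |u| ^ 3 := by
    have e : p * ((1 - p) * |u|) ^ 3 + (1 - p) * (p * |u|) ^ 3
      = (p * (1 - p) * |u| ^ 3) * ((1 - p) ^ 2 + p ^ 2) := by ring
    rw [e]
    exact mul_le_of_le_one_right (by positivity) (by nlinarith)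
  linarith [norm_add_le
    ((p : ℂ) * (Complex.exp (a * Complex.I) - (1 + a * Complex.I - (a ^ 2 / 2 : ℝ))))
    (((1 - p : ℝ) : ℂ) * (Complex.exp (b * Complex.I) - (1 + b * Complex.I - (b ^ 2 / 2 : ℝ))))]

lemma sq_mul_le_sin_sq {v : ℝ} (hv : |v| ≤ 1) : v ^ 2 * (1 - v ^ 2 / 3) ≤ Real.sin v ^ 2 := by
  have h (x : ℝ) (hx : 0 < x) (hx1 : x ≤ 1) : x ^ 2 * (1 - x ^ 2 / 3) ≤ Real.sin x ^ 2 := by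
    have h1 := Real.sin_gt_sub_cube hx
    have h2 : 0 ≤ x - x ^ 3 / 6 := by nlinarith [pow_le_one₀ hx.le hx1 (n := 2), pow_pos hx 2]
    have h3 := pow_le_pow_left₀ h2 h1.le 2
    nlinarith [pow_pos hx 6]
  rcases lt_trichotomy v 0 with h0 | h0 | h0
  · have := h (-v) (by linarith) (by rwa [abs_of_neg h0] at hv)
    simpa using this
  · simp [h0]
  · exact h v h0 (by rwa [abs_of_pos h0] at hv)

lemma norm_prod_sub_prod_le {ι : Type*} (s : Finset ι) {f g : ι → ℂ} {h e : ι → ℝ}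
    (hf : ∀ i ∈ s, ‖f i‖ ≤ h i) (hg : ∀ i ∈ s, ‖g i‖ ≤ h i)
    (hfg : ∀ i ∈ s, ‖f i - g i‖ ≤ e i * h i) :
    ‖∏ i ∈ s, f i - ∏ i ∈ s, g i‖ ≤ (∑ i ∈ s, e i) * ∏ i ∈ s, h i := by
  induction s using Finset.cons_induction with
  | empty => simp
  | cons a s ha ih =>
    simp only [prod_cons, sum_cons]
    have hfa := hf a (mem_cons_self a s)
    have hga := hg a (mem_cons_self a s)
    have hfga := hfg a (mem_cons_self a s)
    have ih' := ih (fun i hi ↦ hf i (mem_cons_of_mem hi)) (fun i hi ↦ hg i (mem_cons_of_mem hi))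
      (fun i hi ↦ hfg i (mem_cons_of_mem hi))
    have hgp : ‖∏ i ∈ s, g i‖ ≤ ∏ i ∈ s, h i := by
      rw [norm_prod]
      exact prod_le_prod (fun _ _ ↦ norm_nonneg _) fun i hi ↦ hg i (mem_cons_of_mem hi)
    have e1 : f a * ∏ i ∈ s, f i - g a * ∏ i ∈ s, g i
        = f a * (∏ i ∈ s, f i - ∏ i ∈ s, g i) + (f a - g a) * ∏ i ∈ s, g i := by ring
    rw [e1]
    refine (norm_add_le _ _).trans ?_
    rw [norm_mul, norm_mul]
    have m1 := mul_le_mul hfa ih' (norm_nonneg _) ((norm_nonneg _).trans hfa)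
    have m2 := mul_le_mul hfga hgp (norm_nonneg _) ((norm_nonneg _).trans hfga)
    linarith

lemma sqrt_mul_self_le_exp {z : ℝ} (hz : 0 ≤ z) : √z * z ≤ Real.exp z ∧ √z ≤ Real.exp z := by
  have h1 := Real.quadratic_le_exp_of_nonneg hz
  have h2 : √z ≤ (1 + z) / 2 := by
    rw [Real.sqrt_le_left (by positivity)]
    nlinarith [sq_nonneg (z - 1)]
  constructor <;> nlinarith

lemma sqrt_mul_mul_exp_le {n w : ℝ} (hn : 1 ≤ n) (hw : 0 ≤ w) :
    √(n * w) * w * Real.exp (-(w / 2) * (1 - 1 / (12 * n ^ 2)))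
      ≤ 8 * n ^ 2 * Real.exp (-(w / 2) * (1 - 1 / n)) := by
  obtain ⟨z, hz, rfl⟩ : ∃ z, 0 ≤ z ∧ w = 4 * n * z :=
    ⟨w / (4 * n), by positivity, by field_simp⟩
  have hs : √(n * (4 * n * z)) = 2 * n * √z := by
    rw [show n * (4 * n * z) = (2 * n) ^ 2 * z by ring, Real.sqrt_mul (by positivity),
      Real.sqrt_sq (by positivity)]
  have he : Real.exp z * Real.exp (-(4 * n * z / 2) * (1 - 1 / (12 * n ^ 2)))
      ≤ Real.exp (-(4 * n * z / 2) * (1 - 1 / n)) := by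
    rw [← Real.exp_add, Real.exp_le_exp]
    have : 4 * n * z / 2 * (1 / (12 * n ^ 2)) ≤ z := by
      rw [show 4 * n * z / 2 * (1 / (12 * n ^ 2)) = z * (1 / (6 * n)) by field_simp; ring]
      exact mul_le_of_le_one_right hz (by rw [div_le_one (by positivity)]; linarith)
    have h2 : 4 * n * z / 2 * (1 / n) = 2 * z := by field_simp; ring
    linarith
  calc _ = 8 * n ^ 2 * ((√z * z) * Real.exp (-(4 * n * z / 2) * (1 - 1 / (12 * n ^ 2)))) := by
        rw [hs]; ring
    _ ≤ 8 * n ^ 2 * (Real.exp z * Real.exp (-(4 * n * z / 2) * (1 - 1 / (12 * n ^ 2)))) := by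
        gcongr; exact (sqrt_mul_self_le_exp hz).1
    _ ≤ _ := by gcongr

lemma sqrt_mul_exp_le {n w : ℝ} (hn : 1 ≤ n) (hw : 0 ≤ w) :
    √(n ^ 3 * w) * Real.exp (-(w / 2)) ≤ 2 * n ^ 2 * Real.exp (-(w / 2) * (1 - 1 / n)) := by
  obtain ⟨z, hz, rfl⟩ : ∃ z, 0 ≤ z ∧ w = 4 * n * z :=
    ⟨w / (4 * n), by positivity, by field_simp⟩
  have hs : √(n ^ 3 * (4 * n * z)) = 2 * n ^ 2 * √z := by
    rw [show n ^ 3 * (4 * n * z) = (2 * n ^ 2) ^ 2 * z by ring, Real.sqrt_mul (by positivity),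
      Real.sqrt_sq (by positivity)]
  have he : Real.exp z * Real.exp (-(4 * n * z / 2))
      ≤ Real.exp (-(4 * n * z / 2) * (1 - 1 / n)) := by
    rw [← Real.exp_add, Real.exp_le_exp]
    have h2 : 4 * n * z / 2 * (1 / n) = 2 * z := by field_simp; ring
    linarith
  calc _ = 2 * n ^ 2 * (√z * Real.exp (-(4 * n * z / 2))) := by rw [hs]; ring
    _ ≤ 2 * n ^ 2 * (Real.exp z * Real.exp (-(4 * n * z / 2))) := by
        gcongr; exact (sqrt_mul_self_le_exp hz).2
    _ ≤ _ := by gcongr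

/-- The quadratic form of the limiting Gaussian. -/
noncomputable def gaussianForm (o : V) (k : ℕ) (p : ℝ) (y : V → ℝ) : ℝ :=
  p * (1 - p) * ((2 * Real.pi) ^ 2 * phaseEnergy o k y)

lemma phaseEnergy_nonneg (o : V) (k : ℕ) (y : V → ℝ) : 0 ≤ phaseEnergy o k y :=
  sum_nonneg fun _ _ ↦ sq_nonneg _

lemma gaussianForm_nonneg (o : V) (k : ℕ) {p : ℝ} (hp0 : 0 ≤ p) (hp1 : p ≤ 1) (y : V → ℝ) :
    0 ≤ gaussianForm o k p y := by
  have := phaseEnergy_nonneg o k y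
  have : 0 ≤ 1 - p := by linarith
  unfold gaussianForm
  positivity

lemma gaussianForm_eq_sum (o : V) (k : ℕ) (p : ℝ) (y : V → ℝ) :
    gaussianForm o k p y
      = ∑ b ∈ powersetCard k (univ : Finset V), p * (1 - p) * (2 * Real.pi * phase o b y) ^ 2 := by
  simp only [gaussianForm, phaseEnergy, mul_sum, mul_pow]

lemma mul_phase_sq_le_gaussianForm (o : V) {k : ℕ} (hk : 2 ≤ k) (hn : 2 ≤ Fintype.card V)
    {p : ℝ} (hp0 : 0 ≤ p) (hp1 : p ≤ 1) {b : Finset V}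
    (hb : b ∈ powersetCard k (univ : Finset V)) (y : V → ℝ) :
    p * (1 - p) * (Fintype.card V - 2).choose (k - 1) * (2 * Real.pi * phase o b y) ^ 2
      ≤ Fintype.card V * gaussianForm o k p y := by
  have h := phase_sq_le o hk hn hb y
  have hq : 0 ≤ p * (1 - p) * (2 * Real.pi) ^ 2 := by
    have : 0 ≤ 1 - p := by linarith
    positivity
  unfold gaussianForm
  linarith [mul_le_mul_of_nonneg_left h hq]

lemma norm_degreeChar_sub_le (o : V) {k : ℕ} (hk : 2 ≤ k) (hn : 2 ≤ Fintype.card V)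
    {p : ℝ} (hp0 : 0 < p) (hp1 : p < 1) (hα : 0 < (Fintype.card V - 2).choose (k - 1)) {y : V → ℝ}
    (hy : ∀ b ∈ powersetCard k (univ : Finset V),
      |2 * Real.pi * phase o b y| ≤ 1 / Fintype.card V) :
    ‖degreeChar o k p y - (Real.exp (-(gaussianForm o k p y / 2)) : ℝ)‖
      ≤ 32 * Fintype.card V ^ 2 / √(p * (1 - p) * (Fintype.card V - 2).choose (k - 1))
        * Real.exp (-(gaussianForm o k p y / 2) * (1 - 1 / Fintype.card V)) := by
  have hα0 : (0 : ℝ) < (Fintype.card V - 2).choose (k - 1) := by exact_mod_cast hα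
  have hq0 : 0 < p * (1 - p) := mul_pos hp0 (by linarith)
  have hq1 : p * (1 - p) ≤ 1 := by nlinarith
  have hn1 : (2 : ℝ) ≤ Fintype.card V := by exact_mod_cast hn
  set n : ℝ := (Fintype.card V : ℝ) with hnR
  set A := p * (1 - p) * (Fintype.card V - 2).choose (k - 1) with hA
  have hA0 : 0 < A := by positivity
  set w := gaussianForm o k p y with hw
  have hw0 : 0 ≤ w := gaussianForm_nonneg o k hp0.le hp1.le y
  set u : Finset V → ℝ := fun b ↦ 2 * Real.pi * phase o b y with hu
  have hwu : w = ∑ b ∈ powersetCard k (univ : Finset V), p * (1 - p) * u b ^ 2 :=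
    gaussianForm_eq_sum o k p y
  set c := 1 - 1 / (12 * n ^ 2) with hc
  have hc1 : c ≤ 1 := by
    have : 0 ≤ 1 / (12 * n ^ 2) := by positivity
    linarith
  have hc0 : 0 ≤ c := by
    have : 1 / (12 * n ^ 2) ≤ 1 := by rw [div_le_one (by positivity)]; nlinarith
    linarith
  set h : Finset V → ℝ := fun b ↦ Real.exp (-(p * (1 - p) * u b ^ 2 / 2) * c) with hh
  have hn1' : 1 / n ≤ 1 := by rw [div_le_one (by positivity)]; linarith
  have hprod : ∏ b ∈ powersetCard k (univ : Finset V), h b = Real.exp (-(w / 2) * c) := by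
    rw [hh, ← Real.exp_sum, ← sum_mul, sum_neg_distrib, ← sum_div, ← hwu]
  have hgprod : ((Real.exp (-(w / 2)) : ℝ) : ℂ) = ∏ b ∈ powersetCard k (univ : Finset V),
      ((Real.exp (-(p * (1 - p) * u b ^ 2 / 2)) : ℝ) : ℂ) := by
    rw [← Complex.ofReal_prod, ← Real.exp_sum, sum_neg_distrib, ← sum_div, ← hwu]
  have husq (b) (hb : b ∈ powersetCard k (univ : Finset V)) : u b ^ 2 ≤ (1 / n) ^ 2 := by
    rw [← sq_abs]; exact pow_le_pow_left₀ (abs_nonneg _) (hy b hb) 2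
  have hmain := norm_prod_sub_prod_le (powersetCard k (univ : Finset V))
    (f := fun b ↦ bernoulliChar p (u b))
    (g := fun b ↦ ((Real.exp (-(p * (1 - p) * u b ^ 2 / 2)) : ℝ) : ℂ)) (h := h)
    (e := fun b ↦ 4 * (p * (1 - p)) * |u b| ^ 3) ?_ ?_ ?_
  · rw [hprod, ← hgprod] at hmain
    refine hmain.trans ?_
    have hsum : ∑ b ∈ powersetCard k (univ : Finset V), 4 * (p * (1 - p)) * |u b| ^ 3
        ≤ 4 * (√(n * w) / √A) * w := by
      rw [hwu, mul_sum, ← hwu]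
      refine sum_le_sum fun b hb ↦ ?_
      have hub : |u b| ≤ √(n * w) / √A := by
        rw [← Real.sqrt_div (by positivity)]
        refine Real.abs_le_sqrt ?_
        rw [le_div_iff₀ hA0, mul_comm]
        exact mul_phase_sq_le_gaussianForm o hk hn hp0.le hp1.le hb y
      rw [← sq_abs (u b)]
      have : 0 ≤ p * (1 - p) * |u b| ^ 2 := by positivity
      nlinarith [mul_le_mul_of_nonneg_left hub this]
    have hfin := sqrt_mul_mul_exp_le (n := n) (by linarith) hw0
    calc _ ≤ 4 * (√(n * w) / √A) * w * Real.exp (-(w / 2) * c) := by gcongr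
      _ = 4 / √A * (√(n * w) * w * Real.exp (-(w / 2) * c)) := by ring
      _ ≤ 4 / √A * (8 * n ^ 2 * Real.exp (-(w / 2) * (1 - 1 / n))) := by gcongr
      _ = _ := by ring
  · intro b hb
    refine (norm_bernoulliChar_le p _).trans ?_
    rw [hh, Real.exp_le_exp]
    have hs := sq_mul_le_sin_sq (v := u b / 2) (by
      rw [abs_div, abs_two]
      have hb1 : |u b| ≤ 1 / n := hy b hb
      linarith [abs_nonneg (u b)])
    have h2 : (u b / 2) ^ 2 * c ≤ (u b / 2) ^ 2 * (1 - (u b / 2) ^ 2 / 3) := by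
      refine mul_le_mul_of_nonneg_left ?_ (sq_nonneg _)
      have := husq b hb
      have e : 1 / (12 * n ^ 2) = (1 / n) ^ 2 / 12 := by field_simp
      rw [hc, e]; linarith
    have := mul_le_mul_of_nonneg_left (h2.trans hs) hq0.le
    linarith
  · intro b hb
    rw [Complex.norm_real, Real.norm_eq_abs, abs_of_pos (Real.exp_pos _), hh, Real.exp_le_exp]
    have : 0 ≤ p * (1 - p) * u b ^ 2 / 2 := by positivity
    nlinarith
  · intro b hb
    have hb1 : |u b| ≤ 1 := (hy b hb).trans hn1'
    refine (norm_bernoulliChar_sub_le hp0.le hp1.le hb1).trans ?_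
    have hhb : 1 / 2 ≤ h b := by
      have h1 := Real.add_one_le_exp (-(p * (1 - p) * u b ^ 2 / 2) * c)
      have h2 : p * (1 - p) * u b ^ 2 ≤ 1 := by
        have : u b ^ 2 ≤ 1 := by rw [← sq_abs]; exact pow_le_one₀ (abs_nonneg _) hb1
        nlinarith [sq_nonneg (u b)]
      have h3 : 0 ≤ p * (1 - p) * u b ^ 2 := by positivity
      have : p * (1 - p) * u b ^ 2 / 2 * c ≤ 1 / 2 := by nlinarith
      simp only [hh]
      linarith
    have : 0 ≤ 4 * (p * (1 - p)) * |u b| ^ 3 := by positivity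
    nlinarith

lemma exp_neg_gaussianForm_le (o : V) {k : ℕ} (hk : 2 ≤ k) (hn : 2 ≤ Fintype.card V)
    {p : ℝ} (hp0 : 0 < p) (hp1 : p < 1) (hα : 0 < (Fintype.card V - 2).choose (k - 1)) {y : V → ℝ}
    (hy : ∃ b ∈ powersetCard k (univ : Finset V),
      1 / Fintype.card V < |2 * Real.pi * phase o b y|) :
    Real.exp (-(gaussianForm o k p y / 2))
      ≤ 32 * Fintype.card V ^ 2 / √(p * (1 - p) * (Fintype.card V - 2).choose (k - 1))
        * Real.exp (-(gaussianForm o k p y / 2) * (1 - 1 / Fintype.card V)) := by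
  obtain ⟨b, hb, hyb⟩ := hy
  have hα0 : (0 : ℝ) < (Fintype.card V - 2).choose (k - 1) := by exact_mod_cast hα
  have hq0 : 0 < p * (1 - p) := mul_pos hp0 (by linarith)
  have hn1 : (2 : ℝ) ≤ Fintype.card V := by exact_mod_cast hn
  have hform := mul_phase_sq_le_gaussianForm o hk hn hp0.le hp1.le hb y
  set n : ℝ := (Fintype.card V : ℝ) with hnR
  set A := p * (1 - p) * (Fintype.card V - 2).choose (k - 1) with hA
  have hA0 : 0 < A := by positivity
  set w := gaussianForm o k p y with hw
  have hw0 : 0 ≤ w := gaussianForm_nonneg o k hp0.le hp1.le y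
  have h1 : (1 / n) ^ 2 ≤ (2 * Real.pi * phase o b y) ^ 2 := by
    rw [← sq_abs (2 * Real.pi * _)]
    exact pow_le_pow_left₀ (by positivity) hyb.le 2
  have h2 : A ≤ n ^ 3 * w := by
    have h3 := (mul_le_mul_of_nonneg_left h1 hA0.le).trans hform
    have h4 := mul_le_mul_of_nonneg_left h3 (sq_nonneg n)
    have e : n ^ 2 * (A * (1 / n) ^ 2) = A := by field_simp
    linarith
  have h5 : √A ≤ √(n ^ 3 * w) := Real.sqrt_le_sqrt h2
  have hsA : 0 < √A := Real.sqrt_pos.mpr hA0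
  have h6 := sqrt_mul_exp_le (n := n) (by linarith) hw0
  have h7 : √A * Real.exp (-(w / 2)) ≤ 2 * n ^ 2 * Real.exp (-(w / 2) * (1 - 1 / n)) :=
    (mul_le_mul_of_nonneg_right h5 (Real.exp_pos _).le).trans h6
  rw [div_mul_eq_mul_div, le_div_iff₀ hsA, mul_comm]
  have : 0 ≤ n ^ 2 * Real.exp (-(w / 2) * (1 - 1 / n)) := by positivity
  linarith

lemma phase_insert (o : V) {S : Finset V} {i : V} (hio : i ≠ o) (hi : i ∉ S) (ho : o ∉ S)
    (y : V → ℝ) : phase o (insert i S) y = phase o (insert o S) y + y i := by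
  simp only [phase]
  rw [erase_insert ho, erase_eq_of_notMem (by simp [ho, hio.symm]), sum_insert hi]
  ring

lemma phase_insert_root (o : V) {S : Finset V} (ho : o ∉ S) (y : V → ℝ) :
    phase o (insert o S) y = y o + ∑ i ∈ S, y i := by
  simp only [phase, erase_insert ho]

lemma mem_powersetCard_compl_pair {k : ℕ} {i o : V} {S : Finset V}
    (hS : S ∈ powersetCard (k - 1) (univ \ {i, o})) : i ∉ S ∧ o ∉ S ∧ #S = k - 1 := by
  rw [mem_powersetCard] at hS
  refine ⟨fun h ↦ ?_, fun h ↦ ?_, hS.2⟩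
  · simpa using hS.1 h
  · simpa using hS.1 h

lemma insert_mem_powersetCard {k : ℕ} (hk : 1 ≤ k) {S : Finset V} (hS : #S = k - 1) {i : V}
    (hi : i ∉ S) : insert i S ∈ powersetCard k (univ : Finset V) := by
  rw [mem_powersetCard_univ, card_insert_of_notMem hi, hS]
  omega

lemma mem_centredCube_of_phase_le (o : V) {k : ℕ} (hk : 1 ≤ k) (hkn : k < Fintype.card V)
    (hn : 3 ≤ Fintype.card V) {y : V → ℝ}
    (hy : ∀ b ∈ powersetCard k (univ : Finset V),
      |2 * Real.pi * phase o b y| ≤ 1 / Fintype.card V) : y ∈ centredCube V := by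
  have hn1 : (3 : ℝ) ≤ Fintype.card V := by exact_mod_cast hn
  set n : ℝ := (Fintype.card V : ℝ) with hnR
  have hpi := Real.pi_gt_three
  have hy' (b) (hb : b ∈ powersetCard k (univ : Finset V)) : |phase o b y| ≤ 1 / (6 * n) := by
    have h := hy b hb
    rw [abs_mul, abs_of_pos (by positivity), le_div_iff₀ (by positivity)] at h
    rw [le_div_iff₀ (by positivity)]
    have : 0 ≤ |phase o b y| * n := by positivity
    nlinarith
  have hcoord (i : V) (hio : i ≠ o) : |y i| ≤ 1 / (3 * n) := by
    obtain ⟨S, hS⟩ : (powersetCard (k - 1) (univ \ {i, o})).Nonempty := by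
      rw [powersetCard_nonempty, card_sdiff_of_subset (subset_univ _), card_pair hio, card_univ]
      omega
    obtain ⟨hi, ho, hc⟩ := mem_powersetCard_compl_pair hS
    have h1 := hy' _ (insert_mem_powersetCard hk hc hi)
    have h2 := hy' _ (insert_mem_powersetCard hk hc ho)
    have h3 := phase_insert o hio hi ho y
    have e : 1 / (3 * n) = 1 / (6 * n) + 1 / (6 * n) := by field_simp; norm_num
    rw [show y i = phase o (insert i S) y - phase o (insert o S) y by linarith, e]
    exact (abs_sub _ _).trans (add_le_add h1 h2)
  have hroot : |y o| < 1 / 2 := by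
    obtain ⟨S, hS⟩ : (powersetCard (k - 1) (univ.erase o)).Nonempty := by
      rw [powersetCard_nonempty, card_erase_of_mem (mem_univ o), card_univ]
      omega
    rw [mem_powersetCard] at hS
    have ho : o ∉ S := fun h ↦ by simpa using hS.1 h
    have h1 := hy' _ (insert_mem_powersetCard hk hS.2 ho)
    have h2 := phase_insert_root o ho y
    have h3 : |∑ i ∈ S, y i| ≤ n * (1 / (3 * n)) := by
      refine (abs_sum_le_sum_abs _ _).trans ((sum_le_card_nsmul S _ (1 / (3 * n)) fun i hi ↦
        hcoord i (by rintro rfl; exact ho hi)).trans ?_)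
      rw [nsmul_eq_mul]
      exact mul_le_mul_of_nonneg_right (by rw [hnR]; exact_mod_cast card_le_univ S)
        (by positivity)
    have e : n * (1 / (3 * n)) = 1 / 3 := by field_simp
    have e2 : 1 / (6 * n) ≤ 1 / 18 := by
      apply one_div_le_one_div_of_le <;> linarith
    rw [show y o = phase o (insert o S) y - ∑ i ∈ S, y i by linarith]
    have := abs_sub (phase o (insert o S) y) (∑ i ∈ S, y i)
    linarith
  intro i _
  have hi : |y i| < 1 / 2 := by
    by_cases hio : i = o
    · rwa [hio]
    · refine (hcoord i hio).trans_lt ?_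
      rw [div_lt_div_iff₀ (by positivity) (by norm_num)]
      linarith
  rw [abs_lt] at hi
  exact ⟨hi.1, hi.2.le⟩

lemma abs_sin_sub_le (a b : ℝ) : |Real.sin (a - b)| ≤ |Real.sin a| + |Real.sin b| := by
  rw [Real.sin_sub]
  refine (abs_sub _ _).trans ?_
  rw [abs_mul, abs_mul]
  exact add_le_add (mul_le_of_le_one_right (abs_nonneg _) (Real.abs_cos_le_one _))
    (mul_le_of_le_one_left (abs_nonneg _) (Real.abs_cos_le_one _))

lemma two_mul_abs_le_abs_sin {x : ℝ} (hx : |x| ≤ 1 / 2) : 2 * |x| ≤ |Real.sin (Real.pi * x)| := by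
  have hpi := Real.pi_pos
  have h := Real.mul_abs_le_abs_sin (x := Real.pi * x) (by
    rw [abs_mul, abs_of_pos hpi]; nlinarith)
  rwa [abs_mul, abs_of_pos hpi, ← mul_assoc, div_mul_cancel₀ _ hpi.ne'] at h

lemma abs_le_of_mem_centredCube {y : V → ℝ} (hy : y ∈ centredCube V) (i : V) :
    |y i| ≤ 1 / 2 :=
  abs_le.mpr ⟨(hy i (Set.mem_univ i)).1.le, (hy i (Set.mem_univ i)).2⟩

/-- The sum of the squared sines of the phases, which governs the size of `degreeChar`. -/
noncomputable def sineEnergy (o : V) (k : ℕ) (y : V → ℝ) : ℝ :=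
  ∑ b ∈ powersetCard k (univ : Finset V), Real.sin (Real.pi * phase o b y) ^ 2

lemma choose_mul_sq_le_sineEnergy (o : V) {k : ℕ} (hk : 1 ≤ k) {y : V → ℝ}
    (hy : y ∈ centredCube V) {i : V} (hio : i ≠ o) :
    ((Fintype.card V - 2).choose (k - 1) : ℝ) * y i ^ 2 ≤ sineEnergy o k y := by
  set P := powersetCard (k - 1) (univ \ {i, o}) with hP
  have hPc : #P = (Fintype.card V - 2).choose (k - 1) := by
    rw [hP, card_powersetCard, card_sdiff_of_subset (subset_univ _), card_pair hio, card_univ]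
  have hle (j : V) (hj : j = i ∨ j = o) :
      ∑ S ∈ P, Real.sin (Real.pi * phase o (insert j S) y) ^ 2 ≤ sineEnergy o k y := by
    have hjS (S) (hS : S ∈ P) : j ∉ S := by
      obtain ⟨h1, h2, -⟩ := mem_powersetCard_compl_pair hS
      rcases hj with rfl | rfl <;> assumption
    rw [← sum_image (f := fun b ↦ Real.sin (Real.pi * phase o b y) ^ 2) (g := insert j)]
    · refine sum_le_sum_of_subset_of_nonneg ?_ fun _ _ _ ↦ sq_nonneg _
      intro b hb
      obtain ⟨S, hS, rfl⟩ := mem_image.mp hb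
      exact insert_mem_powersetCard hk (mem_powersetCard_compl_pair hS).2.2 (hjS S hS)
    · intro S hS T hT h
      rw [← erase_insert (hjS S hS), ← erase_insert (hjS T hT)]
      exact congrArg (·.erase j) h
  have hterm (S) (hS : S ∈ P) : 4 * y i ^ 2 ≤ 2 * Real.sin (Real.pi * phase o (insert i S) y) ^ 2
      + 2 * Real.sin (Real.pi * phase o (insert o S) y) ^ 2 := by
    obtain ⟨hi, ho, -⟩ := mem_powersetCard_compl_pair hS
    have h1 := two_mul_abs_le_abs_sin (abs_le_of_mem_centredCube hy i)
    have h2 := abs_sin_sub_le (Real.pi * phase o (insert i S) y) (Real.pi * phase o (insert o S) y)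
    rw [← mul_sub, phase_insert o hio hi ho, add_sub_cancel_left] at h2
    rw [phase_insert o hio hi ho]
    have h3 := pow_le_pow_left₀ (by positivity) (h1.trans h2) 2
    rw [mul_pow, sq_abs] at h3
    rw [← sq_abs (Real.sin (_ * (_ + _))), ← sq_abs (Real.sin (_ * phase o (insert o S) y))]
    nlinarith [sq_nonneg (|Real.sin (Real.pi * (phase o (insert o S) y + y i))|
      - |Real.sin (Real.pi * phase o (insert o S) y)|)]
  have hs := sum_le_sum hterm
  rw [sum_const, nsmul_eq_mul, hPc, sum_add_distrib, ← mul_sum, ← mul_sum] at hs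
  linarith [hle i (Or.inl rfl), hle o (Or.inr rfl)]

lemma choose_pred_pred_le_choose (n k : ℕ) (hk : 1 ≤ k) (hn : 2 ≤ n) :
    (n - 2).choose (k - 1) ≤ n.choose k := by
  obtain ⟨k, rfl⟩ := Nat.exists_eq_add_of_le' hk
  obtain ⟨n, rfl⟩ := Nat.exists_eq_add_of_le' hn
  calc n.choose k ≤ (n + 1).choose k := Nat.choose_le_choose k (Nat.le_succ n)
    _ ≤ (n + 2).choose (k + 1) := by rw [Nat.choose_succ_succ]; exact Nat.le_add_right _ _

lemma le_sineEnergy (o : V) {k : ℕ} (hk : 1 ≤ k) (hn : 2 ≤ Fintype.card V)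
    (hα : 0 < (Fintype.card V - 2).choose (k - 1)) {y : V → ℝ}
    (hy : y ∈ centredCube V) (hb : ∃ b ∈ powersetCard k (univ : Finset V),
      1 / Fintype.card V < |2 * Real.pi * phase o b y|) :
    ((Fintype.card V - 2).choose (k - 1) : ℝ) / (400 * Fintype.card V ^ 4)
      ≤ sineEnergy o k y := by
  by_contra! hlt
  obtain ⟨b, hb, hyb⟩ := hb
  have hα0 : (0 : ℝ) < (Fintype.card V - 2).choose (k - 1) := by exact_mod_cast hα
  have hn1 : (2 : ℝ) ≤ Fintype.card V := by exact_mod_cast hn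
  have hcoord' (i : V) (hio : i ≠ o) := choose_mul_sq_le_sineEnergy o hk hy hio
  have hmono : ((Fintype.card V - 2).choose (k - 1) : ℝ) ≤ (Fintype.card V).choose k := by
    exact_mod_cast choose_pred_pred_le_choose _ k hk hn
  set n : ℝ := (Fintype.card V : ℝ) with hnR
  set a := ((Fintype.card V - 2).choose (k - 1) : ℝ)
  set r := 1 / (20 * n ^ 2) with hr
  have hr0 : 0 < r := by positivity
  have har : a / (400 * n ^ 4) = a * r ^ 2 := by rw [hr]; field_simp; norm_num
  rw [har] at hlt
  have hcoord (i : V) (hio : i ≠ o) : |y i| ≤ r :=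
    abs_le_of_sq_le_sq (le_of_mul_le_mul_left ((hcoord' i hio).trans hlt.le) hα0) hr0.le
  have hsum (b : Finset V) : |∑ i ∈ b.erase o, y i| ≤ (n - 1) * r := by
    refine (abs_sum_le_sum_abs _ _).trans ((sum_le_card_nsmul _ _ r fun i hi ↦
      hcoord i (ne_of_mem_erase hi)).trans ?_)
    rw [nsmul_eq_mul]
    refine mul_le_mul_of_nonneg_right ?_ hr0.le
    have := card_le_card (erase_subset_erase o (subset_univ b))
    rw [card_erase_of_mem (mem_univ o), card_univ] at this
    rw [le_sub_iff_add_le, hnR]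
    exact_mod_cast (by omega : #(b.erase o) + 1 ≤ Fintype.card V)
  obtain ⟨b₀, -, hb₀⟩ : ∃ b₀ ∈ powersetCard k (univ : Finset V),
      Real.sin (Real.pi * phase o b₀ y) ^ 2 ≤ r ^ 2 := by
    refine exists_le_of_sum_le ⟨b, hb⟩ ?_
    rw [sum_const, card_powersetCard, card_univ, nsmul_eq_mul]
    exact hlt.le.trans (mul_le_mul_of_nonneg_right hmono (sq_nonneg r))
  have hs₀ : |Real.sin (Real.pi * phase o b₀ y)| ≤ r := abs_le_of_sq_le_sq hb₀ hr0.le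
  have hpi := Real.pi_gt_three
  have hpi' := Real.pi_lt_d2
  have hroot : 2 * |y o| ≤ r + Real.pi * ((n - 1) * r) := by
    refine (two_mul_abs_le_abs_sin (abs_le_of_mem_centredCube hy o)).trans ?_
    have e : Real.pi * y o = Real.pi * phase o b₀ y - Real.pi * ∑ i ∈ b₀.erase o, y i := by
      simp only [phase]; ring
    rw [e]
    refine (abs_sin_sub_le _ _).trans (add_le_add hs₀ (Real.abs_sin_le_abs.trans ?_))
    rw [abs_mul, abs_of_pos Real.pi_pos]
    exact mul_le_mul_of_nonneg_left (hsum b₀) Real.pi_pos.le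
  have hph : |phase o b y| ≤ |y o| + (n - 1) * r :=
    (abs_add_le _ _).trans (add_le_add le_rfl (hsum b))
  have hrn : r * n * 20 = 1 / n := by rw [hr]; field_simp
  rw [abs_mul, abs_of_pos (by positivity), ← hrn] at hyb
  have hphn : |phase o b y| ≤ 3 * (r * n) := by
    have : 0 ≤ r * (n - 1) := mul_nonneg hr0.le (by linarith)
    nlinarith
  have : 0 ≤ r * n := by positivity
  nlinarith [abs_nonneg (phase o b y)]

lemma norm_degreeChar_le (o : V) (k : ℕ) (p : ℝ) (y : V → ℝ) :
    ‖degreeChar o k p y‖ ≤ Real.exp (-2 * (p * (1 - p)) * sineEnergy o k y) := by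
  rw [degreeChar, norm_prod, sineEnergy, mul_sum, Real.exp_sum]
  refine prod_le_prod (fun _ _ ↦ norm_nonneg _) fun b _ ↦ ?_
  have h := norm_bernoulliChar_le p (2 * Real.pi * phase o b y)
  rwa [show 2 * Real.pi * phase o b y / 2 = Real.pi * phase o b y by ring] at h

lemma pred_choose_le_mul {n k : ℕ} (hk : 2 ≤ k) (hkn : k < n) :
    (n - 1).choose (k - 1) ≤ k * (n - 2).choose (k - 1) := by
  have h1 := choose_pred_eq_add hk (by omega : 2 ≤ n)
  have h2 := choose_pred_add_mul hk (by omega : 2 ≤ n)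
  obtain ⟨m, rfl⟩ := Nat.exists_eq_add_of_lt hkn
  rw [h1] at h2 ⊢
  nlinarith [Nat.zero_le (m * (k + m + 1 - 2).choose (k - 2))]

lemma mul_choose_eq {n k : ℕ} (hk : 1 ≤ k) (hn : 1 ≤ n) :
    k * n.choose k = n * (n - 1).choose (k - 1) := by
  obtain ⟨k, rfl⟩ := Nat.exists_eq_add_of_le' hk
  obtain ⟨n, rfl⟩ := Nat.exists_eq_add_of_le' hn
  simpa [mul_comm] using (Nat.add_one_mul_choose_eq n k).symm

lemma choose_le_mul {n k : ℕ} (hk : 2 ≤ k) (hkn : k < n) :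
    n.choose k ≤ n * (n - 2).choose (k - 1) := by
  have h1 := pred_choose_le_mul hk hkn
  have h2 := mul_choose_eq (by omega : 1 ≤ k) (by omega : 1 ≤ n)
  refine Nat.le_of_mul_le_mul_left (c := k) ?_ (by omega)
  rw [h2]
  nlinarith

lemma sqrt_inv_one_sub_pow_le {n : ℕ} (hn : 2 ≤ n) : √(1 / (1 - 1 / (n : ℝ))) ^ n ≤ 3 := by
  have hn1 : (2 : ℝ) ≤ n := by exact_mod_cast hn
  have h1 : √(1 / (1 - 1 / (n : ℝ))) ≤ Real.exp (1 / n) := by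
    rw [Real.sqrt_le_left (Real.exp_pos _).le, ← Real.exp_nat_mul]
    have h2 := Real.add_one_le_exp (1 / ((n : ℝ) - 1))
    have h3 : 1 / (1 - 1 / (n : ℝ)) = 1 / ((n : ℝ) - 1) + 1 := by
      have : (n : ℝ) - 1 ≠ 0 := by linarith
      field_simp
      ring
    have h4 : 1 / ((n : ℝ) - 1) ≤ (2 : ℕ) * (1 / n) := by
      rw [mul_one_div, div_le_div_iff₀ (by linarith) (by linarith)]
      push_cast
      linarith
    rw [h3]
    exact h2.trans (Real.exp_le_exp.mpr h4)
  have h5 := pow_le_pow_left₀ (Real.sqrt_nonneg _) h1 n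
  rw [← Real.exp_nat_mul, mul_one_div_cancel (by positivity)] at h5
  exact h5.trans Real.exp_one_lt_three.le

lemma integral_exp_neg_mul_gaussianForm (o : V) {k : ℕ} (hk : 2 ≤ k) (hn : 2 ≤ Fintype.card V)
    (hα : 0 < (Fintype.card V - 2).choose (k - 1)) {p : ℝ} (hp0 : 0 < p) (hp1 : p < 1)
    {s : ℝ} (hs : 0 < s) :
    Integrable (fun y : V → ℝ ↦ Real.exp (-(gaussianForm o k p y / 2) * s)) ∧
      ∫ y : V → ℝ, Real.exp (-(gaussianForm o k p y / 2) * s)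
        = √(1 / s) ^ Fintype.card V * (k / √(k * ((Fintype.card V - 1).choose (k - 1) : ℝ)
            / (Fintype.card V - 2).choose (k - 1))
          * √(1 / (2 * Real.pi * (p * (1 - p) * (Fintype.card V - 2).choose (k - 1))))
            ^ Fintype.card V) := by
  have hq0 : 0 < p * (1 - p) := mul_pos hp0 (by linarith)
  have hα0 : (0 : ℝ) < (Fintype.card V - 2).choose (k - 1) := by exact_mod_cast hα
  have h := integral_exp_neg_phaseEnergy o hk hn hα (l := p * (1 - p) * (2 * Real.pi) ^ 2 / 2 * s)
    (by positivity)
  have e : (fun y : V → ℝ ↦ Real.exp (-(gaussianForm o k p y / 2) * s))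
      = fun y ↦ Real.exp (-(p * (1 - p) * (2 * Real.pi) ^ 2 / 2 * s) * phaseEnergy o k y) := by
    ext y
    unfold gaussianForm
    ring_nf
  rw [e]
  refine ⟨h.1, h.2.trans ?_⟩
  rw [mul_left_comm, ← mul_pow, ← Real.sqrt_mul (by positivity)]
  congr 3
  have := Real.pi_ne_zero
  field_simp

/-- The local central limit theorem at the mean, with an explicit error. -/
lemma norm_integral_degreeChar_sub_le (o : V) {k : ℕ} (hk : 2 ≤ k) (hkn : k < Fintype.card V)
    (hn : 3 ≤ Fintype.card V) (hα : 0 < (Fintype.card V - 2).choose (k - 1))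
    {p : ℝ} (hp0 : 0 < p) (hp1 : p < 1) :
    ‖(∫ y in centredCube V, degreeChar o k p y)
        - ((∫ y : V → ℝ, Real.exp (-(gaussianForm o k p y / 2)) : ℝ) : ℂ)‖
      ≤ 32 * Fintype.card V ^ 2 / √(p * (1 - p) * (Fintype.card V - 2).choose (k - 1))
          * (∫ y : V → ℝ, Real.exp (-(gaussianForm o k p y / 2) * (1 - 1 / Fintype.card V)))
        + Real.exp (-(p * (1 - p) * (Fintype.card V - 2).choose (k - 1)
            / (200 * Fintype.card V ^ 4))) := by
  have hn2 : 2 ≤ Fintype.card V := by omega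
  have hn1 : (3 : ℝ) ≤ Fintype.card V := by exact_mod_cast hn
  have hq0 : 0 < p * (1 - p) := mul_pos hp0 (by linarith)
  set B := Real.exp (-(p * (1 - p) * (Fintype.card V - 2).choose (k - 1)
            / (200 * Fintype.card V ^ 4))) with hB
  have hs : (0 : ℝ) < 1 - 1 / Fintype.card V := by
    rw [sub_pos, div_lt_one (by linarith)]; linarith
  have hH := (integral_exp_neg_mul_gaussianForm o hk hn2 hα hp0 hp1 hs).1
  have hG := (integral_exp_neg_mul_gaussianForm o hk hn2 hα hp0 hp1 one_pos).1
  simp only [mul_one] at hG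
  have hGc : Integrable fun y : V → ℝ ↦ ((Real.exp (-(gaussianForm o k p y / 2)) : ℝ) : ℂ) :=
    hG.ofReal
  have hcube := measurableSet_centredCube (V := V)
  have hone : Integrable ((centredCube V).indicator fun _ : V → ℝ ↦ B) := by
    rw [integrable_indicator_iff hcube]
    exact integrableOn_const (by rw [volume_centredCube]; exact ENNReal.one_ne_top)
  have hF : Integrable ((centredCube V).indicator (degreeChar o k p)) := by
    rw [integrable_indicator_iff hcube]
    have : IsFiniteMeasure (volume.restrict (centredCube V)) :=
      ⟨by rw [Measure.restrict_apply_univ, volume_centredCube]; exact ENNReal.one_lt_top⟩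
    refine Integrable.of_bound (C := 1) (continuous_degreeChar o k p).aestronglyMeasurable
      (ae_of_all _ fun y ↦ (norm_degreeChar_le o k p y).trans ?_)
    rw [Real.exp_le_one_iff, sineEnergy]
    have : 0 ≤ ∑ b ∈ powersetCard k (univ : Finset V), Real.sin (Real.pi * phase o b y) ^ 2 :=
      sum_nonneg fun _ _ ↦ sq_nonneg _
    nlinarith
  rw [← integral_indicator hcube, ← integral_complex_ofReal, ← integral_sub hF hGc,
    ← integral_const_mul]
  have hBint : ∫ y, (centredCube V).indicator (fun _ : V → ℝ ↦ B) y = B := by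
    rw [integral_indicator hcube, setIntegral_const, measureReal_def, volume_centredCube]
    simp
  refine (norm_integral_le_of_norm_le ((hH.const_mul _).add hone) (ae_of_all _ fun y ↦ ?_)).trans_eq
    (by rw [integral_add' (hH.const_mul _) hone, hBint])
  simp only [Pi.add_apply]
  by_cases hy : ∀ b ∈ powersetCard k (univ : Finset V),
      |2 * Real.pi * phase o b y| ≤ 1 / Fintype.card V
  · have hmem := mem_centredCube_of_phase_le o (by omega) hkn hn hy
    rw [Set.indicator_of_mem hmem, Set.indicator_of_mem hmem]
    exact (norm_degreeChar_sub_le o hk hn2 hp0 hp1 hα hy).trans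
      (le_add_of_nonneg_right (Real.exp_pos _).le)
  · push Not at hy
    have hg := exp_neg_gaussianForm_le o hk hn2 hp0 hp1 hα hy
    have hgn : ‖((Real.exp (-(gaussianForm o k p y / 2)) : ℝ) : ℂ)‖
        = Real.exp (-(gaussianForm o k p y / 2)) := by
      rw [Complex.norm_real, Real.norm_eq_abs, abs_of_pos (Real.exp_pos _)]
    refine (norm_sub_le _ _).trans ?_
    rw [add_comm]
    refine add_le_add (hgn.trans_le hg) ?_
    by_cases hmem : y ∈ centredCube V
    · rw [Set.indicator_of_mem hmem, Set.indicator_of_mem hmem]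
      refine (norm_degreeChar_le o k p y).trans (Real.exp_le_exp.mpr ?_)
      have h := mul_le_mul_of_nonneg_left (le_sineEnergy o (by omega) hn2 hα hmem hy) hq0.le
      have e : p * (1 - p) * (Fintype.card V - 2).choose (k - 1) / (200 * (Fintype.card V : ℝ) ^ 4)
          = 2 * (p * (1 - p)
            * ((Fintype.card V - 2).choose (k - 1) / (400 * Fintype.card V ^ 4))) := by
        field_simp
        ring
      linarith
    · rw [Set.indicator_of_notMem hmem, Set.indicator_of_notMem hmem, norm_zero]

lemma exp_neg_le_gaussian_mass {n : ℕ} (hn : 3 ≤ n) {A : ℝ} (hA : (n : ℝ) ^ 23 ≤ A) :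
    Real.exp (-(A / (200 * (n : ℝ) ^ 4))) ≤ 1 / √A * √(1 / (2 * Real.pi * A)) ^ n := by
  have hn1 : (3 : ℝ) ≤ n := by exact_mod_cast hn
  have hA0 : 0 < A := lt_of_lt_of_le (by positivity) hA
  have hsA : 0 < √A := Real.sqrt_pos.mpr hA0
  set x := √(2 * Real.pi * A) with hx
  have hpi := Real.pi_gt_three
  have hpi' := Real.pi_lt_d2
  have hx0 : 0 < x := Real.sqrt_pos.mpr (by positivity)
  have hxA : √A ≤ x := Real.sqrt_le_sqrt (by nlinarith)
  have hx3 : x ≤ 3 * √A := by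
    rw [hx, Real.sqrt_le_left (by positivity), mul_pow, Real.sq_sqrt hA0.le]
    nlinarith
  have hbig : 800 * (n : ℝ) ^ 5 ≤ √A := by
    refine Real.le_sqrt_of_sq_le (le_trans ?_ hA)
    have h3 : (3 : ℝ) ^ 13 ≤ (n : ℝ) ^ 13 := pow_le_pow_left₀ (by norm_num) hn1 13
    have h10 : (0 : ℝ) ≤ (n : ℝ) ^ 10 := by positivity
    calc (800 * (n : ℝ) ^ 5) ^ 2 = 640000 * (n : ℝ) ^ 10 := by ring
      _ ≤ (n : ℝ) ^ 13 * (n : ℝ) ^ 10 := by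
        refine mul_le_mul_of_nonneg_right (le_trans (by norm_num) h3) h10
      _ = (n : ℝ) ^ 23 := by ring
  have hexp : x ^ (n + 1) ≤ Real.exp (A / (200 * (n : ℝ) ^ 4)) := by
    have h1 : x ≤ Real.exp x := by linarith [Real.add_one_le_exp x]
    refine (pow_le_pow_left₀ hx0.le h1 (n + 1)).trans ?_
    rw [← Real.exp_nat_mul, Real.exp_le_exp, le_div_iff₀ (by positivity)]
    have h2 : ((n + 1 : ℕ) : ℝ) * x * (200 * (n : ℝ) ^ 4)
        ≤ ((n + 1 : ℕ) : ℝ) * (3 * √A) * (200 * (n : ℝ) ^ 4) := by gcongr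
    refine h2.trans ?_
    have h3 : ((n + 1 : ℕ) : ℝ) * 3 * (200 * (n : ℝ) ^ 4) ≤ 800 * (n : ℝ) ^ 5 := by
      push_cast
      nlinarith [pow_pos (by linarith : (0 : ℝ) < n) 4]
    have h4 := mul_le_mul_of_nonneg_right (h3.trans hbig) hsA.le
    rw [Real.mul_self_sqrt hA0.le] at h4
    linarith
  rw [Real.exp_neg, Real.sqrt_div zero_le_one, Real.sqrt_one, ← hx, one_div_pow,
    one_div_mul_one_div,
    one_div]
  refine inv_anti₀ (by positivity) (le_trans ?_ hexp)
  rw [pow_succ, mul_comm]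
  gcongr

lemma abs_integral_degreeChar_div_le (o : V) {k : ℕ} (hk : 2 ≤ k) (hkn : k < Fintype.card V)
    (hn : 3 ≤ Fintype.card V) {p P : ℝ} (hp0 : 0 < p) (hp1 : p < 1)
    (hP : ∫ y in centredCube V, degreeChar o k p y = (P : ℂ))
    (hA : (Fintype.card V : ℝ) ^ 23 ≤ p * (1 - p) * (Fintype.card V - 2).choose (k - 1)) :
    ∃ δ : ℝ, |δ| ≤ 97 * Fintype.card V ^ 2
        / √(p * (1 - p) * (Fintype.card V - 2).choose (k - 1)) ∧
      P = k / √(k * ((Fintype.card V - 1).choose (k - 1) : ℝ)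
            / (Fintype.card V - 2).choose (k - 1))
          * √(1 / (2 * Real.pi * (p * (1 - p) * (Fintype.card V - 2).choose (k - 1))))
            ^ Fintype.card V * (1 + δ) := by
  have hn2 : 2 ≤ Fintype.card V := by omega
  have hα : 0 < (Fintype.card V - 2).choose (k - 1) := Nat.choose_pos (by omega)
  have hα0 : (0 : ℝ) < (Fintype.card V - 2).choose (k - 1) := by exact_mod_cast hα
  have hD : 0 < (Fintype.card V - 1).choose (k - 1) := Nat.choose_pos (by omega)
  have hD0 : (0 : ℝ) < (Fintype.card V - 1).choose (k - 1) := by exact_mod_cast hD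
  have hn1 : (3 : ℝ) ≤ Fintype.card V := by exact_mod_cast hn
  have hq0 : 0 < p * (1 - p) := mul_pos hp0 (by linarith)
  have hk0 : (0 : ℝ) < k := by positivity
  have hs : (0 : ℝ) < 1 - 1 / Fintype.card V := by
    rw [sub_pos, div_lt_one (by linarith)]; linarith
  have hmain := norm_integral_degreeChar_sub_le o hk hkn hn hα hp0 hp1
  have hG := (integral_exp_neg_mul_gaussianForm o hk hn2 hα hp0 hp1 one_pos).2
  simp only [mul_one, div_one, Real.sqrt_one, one_pow, one_mul] at hG
  rw [hP, hG, (integral_exp_neg_mul_gaussianForm o hk hn2 hα hp0 hp1 hs).2,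
    ← Complex.ofReal_sub, Complex.norm_real, Real.norm_eq_abs] at hmain
  have hκ : 1 ≤ k / √(k * ((Fintype.card V - 1).choose (k - 1) : ℝ)
            / (Fintype.card V - 2).choose (k - 1)) := by
    rw [one_le_div (by positivity), Real.sqrt_le_left hk0.le, div_le_iff₀ hα0]
    have : ((Fintype.card V - 1).choose (k - 1) : ℝ)
        ≤ k * (Fintype.card V - 2).choose (k - 1) := by
      exact_mod_cast pred_choose_le_mul hk hkn
    nlinarith
  have hexp := exp_neg_le_gaussian_mass hn hA
  have h3 := sqrt_inv_one_sub_pow_le hn2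
  set A := p * (1 - p) * (Fintype.card V - 2).choose (k - 1) with hAdef
  have hA0 : 0 < A := by positivity
  have hsA : 0 < √A := Real.sqrt_pos.mpr hA0
  set κ := k / √(k * ((Fintype.card V - 1).choose (k - 1) : ℝ)
            / (Fintype.card V - 2).choose (k - 1))
  set g := √(1 / (2 * Real.pi * A)) ^ Fintype.card V with hg
  have hg0 : 0 < g := by positivity
  have hI0 : 0 < κ * g := by positivity
  have hexp' : Real.exp (-(A / (200 * (Fintype.card V : ℝ) ^ 4))) ≤ 1 / √A * (κ * g) := by
    refine hexp.trans (mul_le_mul_of_nonneg_left ?_ (by positivity))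
    exact le_mul_of_one_le_left hg0.le hκ
  refine ⟨(P - κ * g) / (κ * g), ?_, by field_simp; ring⟩
  rw [abs_div, abs_of_pos hI0, div_le_iff₀ hI0]
  refine hmain.trans ?_
  have h4 : 32 * (Fintype.card V : ℝ) ^ 2 / √A
      * (√(1 / (1 - 1 / (Fintype.card V : ℝ))) ^ Fintype.card V * (κ * g))
      ≤ 32 * (Fintype.card V : ℝ) ^ 2 / √A * (3 * (κ * g)) := by gcongr
  have h5 : 1 / √A * (κ * g) ≤ (Fintype.card V : ℝ) ^ 2 / √A * (κ * g) := by
    gcongr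
    nlinarith
  calc _ ≤ 32 * (Fintype.card V : ℝ) ^ 2 / √A * (3 * (κ * g))
        + (Fintype.card V : ℝ) ^ 2 / √A * (κ * g) := add_le_add h4 (hexp'.trans h5)
    _ = _ := by ring

lemma regular_count_formula {n k N R : ℕ} (hk : 1 ≤ k) {p D α W δ : ℝ} (hp0 : 0 < p)
    (hp1 : p < 1) (hD : 0 < D) (hα : 0 < α)
    (h : W * (p ^ N * (1 - p) ^ R)
      = k / √(k * D / α) * √(1 / (2 * Real.pi * (p * (1 - p) * α))) ^ n * (1 + δ)) :
    W = 1 / ((2 * Real.pi * p * (1 - p)) ^ ((n : ℝ) / 2) * p ^ N * (1 - p) ^ R)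
      * ((k : ℝ) / D) ^ ((1 : ℝ) / 2) * (1 / α) ^ (((n : ℝ) - 1) / 2) * (1 + δ) := by
  have hp2 : 0 < 1 - p := by linarith
  have hk0 : (0 : ℝ) < k := by exact_mod_cast hk
  have hpi := Real.pi_pos
  have hQ : 0 < 2 * Real.pi * p * (1 - p) := by positivity
  have h1 : √(1 / (2 * Real.pi * (p * (1 - p) * α))) ^ n
      = ((2 * Real.pi * p * (1 - p)) ^ ((n : ℝ) / 2))⁻¹ * (1 / α) ^ ((n : ℝ) / 2) := by
    have e : 1 / (2 * Real.pi * (p * (1 - p) * α)) = (2 * Real.pi * p * (1 - p))⁻¹ * (1 / α) := by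
      field_simp
    rw [e, Real.sqrt_eq_rpow, ← Real.rpow_natCast, ← Real.rpow_mul (by positivity),
      one_div_mul_eq_div, Real.mul_rpow (by positivity) (by positivity), Real.inv_rpow hQ.le]
  have h2 : (k : ℝ) / √(k * D / α) = ((k : ℝ) / D) ^ ((1 : ℝ) / 2) * √α := by
    rw [← Real.sqrt_eq_rpow, ← Real.sqrt_mul (by positivity), div_eq_iff (by positivity),
      ← Real.sqrt_mul (by positivity)]
    rw [eq_comm, Real.sqrt_eq_iff_mul_self_eq (by positivity) hk0.le]
    field_simp
  have h3 : √α * (1 / α) ^ ((n : ℝ) / 2) = (1 / α) ^ (((n : ℝ) - 1) / 2) := by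
    rw [sub_div, Real.rpow_sub (by positivity), ← Real.sqrt_eq_rpow, Real.sqrt_div zero_le_one,
      Real.sqrt_one, div_div_eq_mul_div, div_one, mul_comm]
  rw [h1, h2] at h
  rw [← h3]
  have hpN : 0 < p ^ N * (1 - p) ^ R := by positivity
  rw [← eq_div_iff hpN.ne'] at h
  rw [h]
  have := Real.rpow_pos_of_pos hQ ((n : ℝ) / 2)
  field_simp

lemma card_isRegularHypergraph (n k d : ℕ) :
    Nat.card {T : Finset (Finset (Fin n)) // IsRegularHypergraph n k d T}
      = #{T ∈ (powersetCard k (univ : Finset (Fin n))).powerset | ∀ i, #{b ∈ T | i ∈ b} = d} := by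
  refine Nat.subtype_card _ fun T ↦ ?_
  simp only [mem_filter, mem_powerset, IsRegularHypergraph]
  refine and_congr_left fun _ ↦ ⟨fun h b hb ↦ ?_, fun h b hb ↦ ?_⟩
  · exact (mem_powersetCard.mp (h hb)).2
  · exact mem_powersetCard.mpr ⟨subset_univ _, h b hb⟩

lemma two_le_and_lt_of_divisible {n k d : ℕ} (hk : 1 ≤ k) (hkn : k ≤ n) (hd : 1 ≤ d)
    (hdD : d ≤ (n - 1).choose (k - 1))
    (hlt : n * d < k * n.choose k) : 2 ≤ k ∧ k < n := by
  constructor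
  · by_contra h
    obtain rfl : k = 1 := by omega
    simp at hdD hlt
    nlinarith
  · by_contra h
    obtain rfl : k = n := by omega
    simp at hdD hlt
    nlinarith

lemma min_le_mul_choose {n k N : ℕ} (hk : 2 ≤ k) (hkn : k < n) (hN : N ≤ n.choose k)
    (hM : 0 < n.choose k) {p : ℝ} (hp : p * n.choose k = N) :
    ((min N (n.choose k - N) : ℕ) : ℝ) ≤ 2 * n * (p * (1 - p) * (n - 2).choose (k - 1)) := by
  have hM0 : (0 : ℝ) < n.choose k := by exact_mod_cast hM
  have hp' : p = N / n.choose k := by rw [eq_div_iff hM0.ne', hp]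
  have hN' : (N : ℝ) ≤ n.choose k := by exact_mod_cast hN
  have hp0 : 0 ≤ p := by rw [hp']; positivity
  have hp1 : p ≤ 1 := by rw [hp']; exact div_le_one_of_le₀ hN' hM0.le
  have hc : (n.choose k : ℝ) ≤ n * (n - 2).choose (k - 1) := by
    exact_mod_cast choose_le_mul hk hkn
  have hq := mul_nonneg hp0 (sub_nonneg.mpr hp1)
  have h1 := mul_le_mul_of_nonneg_left hc hq
  suffices h : ((min N (n.choose k - N) : ℕ) : ℝ) ≤ 2 * (p * (1 - p) * n.choose k) by linarith
  rw [Nat.cast_min, Nat.cast_sub hN, ← hp]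
  rcases le_total p (1 / 2) with h | h
  · refine (min_le_left _ _).trans ?_
    nlinarith [mul_nonneg hp0 hM0.le]
  · refine (min_le_right _ _).trans ?_
    nlinarith [mul_nonneg (sub_nonneg.mpr hp1) hM0.le]

end

/-- The number of `d`-regular `k`-uniform hypergraphs on `n` vertices (when `k ∣ n·d` and
`min(nd/k, C(n,k) − nd/k) ≥ n^c`) equals
`1/((2πp(1−p))^(n/2) p^(nd/k) (1−p)^(C(n,k)−nd/k)) · (k/C(n−1,k−1))^(1/2)
· (1/C(n−2,k−1))^((n−1)/2)` up to a factor `1+δ`, where `p = nd/(k·C(n,k))` and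
`|δ| ≤ n^c/√(min(nd/k, C(n,k)−nd/k))`. -/
theorem count_regular_hypergraphs :
    ∃ c : ℝ, 0 < c ∧
      ∀ n k d : ℕ, 2 ≤ n → 1 ≤ k → k ≤ n → 1 ≤ d → d ≤ (n - 1).choose (k - 1) →
        k ∣ n * d →
        (n : ℝ) ^ (c : ℝ) ≤ ((min (n * d / k) (n.choose k - n * d / k) : ℕ) : ℝ) →
        ∃ δ : ℝ,
          |δ| ≤ (n : ℝ) ^ (c : ℝ)
              / Real.sqrt ((min (n * d / k) (n.choose k - n * d / k) : ℕ) : ℝ) ∧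
          (Nat.card {T : Finset (Finset (Fin n)) // IsRegularHypergraph n k d T} : ℝ)
            = 1 / ((2 * Real.pi * ((n * d : ℝ) / (k * n.choose k : ℝ))
                      * (1 - (n * d : ℝ) / (k * n.choose k : ℝ))) ^ ((n : ℝ) / 2)
                    * ((n * d : ℝ) / (k * n.choose k : ℝ)) ^ (n * d / k)
                    * (1 - (n * d : ℝ) / (k * n.choose k : ℝ)) ^ (n.choose k - n * d / k))
                * ((k : ℝ) / ((n - 1).choose (k - 1) : ℝ)) ^ ((1 : ℝ) / 2)
                * ((1 : ℝ) / ((n - 2).choose (k - 1) : ℝ)) ^ (((n : ℝ) - 1) / 2)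
                * (1 + δ) := by
  refine ⟨30, by norm_num, fun n k d hn hk hkn hd hdD hdvd hmin ↦ ?_⟩
  have hn30 : (n : ℝ) ^ (30 : ℝ) = (n : ℝ) ^ 30 := by exact_mod_cast Real.rpow_natCast (n : ℝ) 30
  rw [hn30] at hmin ⊢
  set N := n * d / k with hNdef
  have hN : k * N = n * d := Nat.mul_div_cancel' hdvd
  have hn0 : (0 : ℝ) < n := by positivity
  have hμ : 0 < min N (n.choose k - N) := by
    have := (pow_pos hn0 30).trans_le hmin
    exact_mod_cast this
  obtain ⟨hN0, hNM⟩ := lt_min_iff.mp hμ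
  have hNM' : N < n.choose k := by omega
  obtain ⟨hk2, hkn'⟩ := two_le_and_lt_of_divisible hk hkn hd hdD (by rw [← hN]; gcongr)
  have hM0 : 0 < n.choose k := by omega
  have hM0' : (0 : ℝ) < n.choose k := by exact_mod_cast hM0
  have hk0 : (0 : ℝ) < k := by positivity
  have hNr : (k : ℝ) * N = n * d := by exact_mod_cast hN
  set p : ℝ := (n * d : ℝ) / (k * n.choose k : ℝ) with hp
  have hpM : p * n.choose k = N := by
    rw [hp, ← hNr]
    field_simp
  have hD := mul_choose_eq hk (by omega : 1 ≤ n)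
  have hDr : (k : ℝ) * n.choose k = n * (n - 1).choose (k - 1) := by exact_mod_cast hD
  have hD0 : (0 : ℝ) < (n - 1).choose (k - 1) := by
    exact_mod_cast Nat.choose_pos (by omega : k - 1 ≤ n - 1)
  have hα0 : (0 : ℝ) < (n - 2).choose (k - 1) := by
    exact_mod_cast Nat.choose_pos (by omega : k - 1 ≤ n - 2)
  have hpD : p * (n - 1).choose (k - 1) = d := by
    rw [hp, hDr]
    field_simp
  have hp' : p = N / n.choose k := by rw [eq_div_iff hM0'.ne', hpM]
  have hp0 : 0 < p := by
    rw [hp']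
    exact div_pos (by exact_mod_cast hN0) hM0'
  have hp1 : p < 1 := by
    rw [hp', div_lt_one hM0']
    exact_mod_cast hNM'
  have hμA := min_le_mul_choose hk2 hkn' hNM'.le hM0 hpM
  set A := p * (1 - p) * (n - 2).choose (k - 1) with hA
  have hn1 : (3 : ℝ) ≤ n := by exact_mod_cast (by omega : 3 ≤ n)
  have hA23 : (n : ℝ) ^ 23 ≤ A := by
    have h1 := hmin.trans hμA
    have h6 : (3 : ℝ) ^ 6 ≤ (n : ℝ) ^ 6 := pow_le_pow_left₀ (by norm_num) hn1 6
    have h7 : 2 * (n : ℝ) * (n : ℝ) ^ 23 ≤ 2 * n * A := by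
      refine le_trans ?_ h1
      have : (n : ℝ) ^ 30 = n ^ 6 * (n * n ^ 23) := by ring
      rw [this]
      have h8 : (0 : ℝ) ≤ n * n ^ 23 := by positivity
      nlinarith
    exact le_of_mul_le_mul_left h7 (by positivity)
  have hfourier := integral_degreeChar (V := Fin n) ⟨0, by omega⟩ hk (by simpa using hN)
    (by simpa using hpM) (by simpa using hpD)
  obtain ⟨δ, hδ, hP⟩ := abs_integral_degreeChar_div_le (V := Fin n) ⟨0, by omega⟩ hk2
    (by simpa using hkn') (by simp; omega) hp0 hp1 hfourier (by simpa using hA23)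
  simp only [Fintype.card_fin] at hδ hP
  refine ⟨δ, hδ.trans ?_, ?_⟩
  · have hμ0 : (0 : ℝ) < ((min N (n.choose k - N) : ℕ) : ℝ) := by exact_mod_cast hμ
    have hA0 : 0 < A := lt_of_lt_of_le (by positivity) hA23
    have h2 : √((min N (n.choose k - N) : ℕ) : ℝ) ≤ 2 * n * √A := by
      rw [Real.sqrt_le_left (by positivity), mul_pow, Real.sq_sqrt hA0.le]
      nlinarith
    rw [div_le_div_iff₀ (Real.sqrt_pos.mpr hA0) (Real.sqrt_pos.mpr hμ0)]
    have h3 : (3 : ℝ) ^ 27 ≤ (n : ℝ) ^ 27 := pow_le_pow_left₀ (by norm_num) hn1 27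
    calc 97 * (n : ℝ) ^ 2 * √((min N (n.choose k - N) : ℕ) : ℝ)
        ≤ 97 * (n : ℝ) ^ 2 * (2 * n * √A) := by gcongr
      _ = 194 * ((n : ℝ) ^ 3 * √A) := by ring
      _ ≤ (n : ℝ) ^ 27 * ((n : ℝ) ^ 3 * √A) := by
        gcongr
        exact le_trans (by norm_num) h3
      _ = _ := by ring
  · rw [card_isRegularHypergraph]
    exact regular_count_formula hk hp0 hp1 hD0 hα0 (by convert hP)
end

section
/- There exists a universal constant c > 0 such that for all integers n ≥ 1 and 1 ≤ t ≤ n there exists a t-wise permutation T ⊆ S_n satisfying |T| ≤ (c·n)^(c·t). -/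
/-- A family of permutations `T ⊆ S_n` is a `t`-wise permutation if for any distinct
`i_1,...,i_t ∈ [n]` and distinct `j_1,...,j_t ∈ [n]`, the number of `π ∈ T` with
`π(i_1)=j_1,...,π(i_t)=j_t` equals `|T|/(n(n−1)⋯(n−t+1))`. -/
def IsTwisePermutation (n t : ℕ) (T : Finset (Equiv.Perm (Fin n))) : Prop :=
  ∀ I J : Fin t → Fin n, Function.Injective I → Function.Injective J →
    (T.filter fun π => ∀ j, π (I j) = J j).card * n.descFactorial t = T.card

/-- `V` is a left-invariant space of functions on a finite group containing the constants. It is cut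
out by a set `R` of integer relations of `ℓ¹`-norm at most `q`, and evaluation at each `x` is
an integer combination, with `ℓ¹`-norm at most `q`, of evaluations on a set `G` of size at most
`q`. -/
structure IsShortlyPresented {Γ : Type*} [Group Γ] [Fintype Γ] [DecidableEq Γ]
    (V : Submodule ℝ (Γ → ℝ)) (G : Finset Γ) (red : Γ → Γ → ℤ) (R : Set (Γ → ℤ)) (q : ℕ) :
    Prop where
  two_le : 2 ≤ q
  one_mem : (fun _ => 1) ∈ V
  left_inv : ∀ f ∈ V, ∀ x, (fun y => f (x * y)) ∈ V
  mem_of_rel : ∀ f : Γ → ℝ, (∀ ρ ∈ R, ∑ x, (ρ x : ℝ) * f x = 0) → f ∈ V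
  rel : ∀ ρ ∈ R, ∀ f ∈ V, ∑ x, (ρ x : ℝ) * f x = 0
  rel_norm_le : ∀ ρ ∈ R, ∑ x, |ρ x| ≤ q
  card_le : G.card ≤ q
  red_norm_le : ∀ x, ∑ g ∈ G, |red x g| ≤ q
  red_self : ∀ g ∈ G, ∀ g' ∈ G, red g g' = if g = g' then 1 else 0
  eval_eq : ∀ f ∈ V, ∀ x, f x = ∑ g ∈ G, (red x g : ℝ) * f g

namespace IsShortlyPresented

variable {Γ : Type*} [Group Γ] [Fintype Γ] [DecidableEq Γ] {V : Submodule ℝ (Γ → ℝ)}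
  {G : Finset Γ} {red : Γ → Γ → ℤ} {R : Set (Γ → ℤ)} {q : ℕ}

lemma abs_red_le (h : IsShortlyPresented V G red R q) (x : Γ) {g : Γ} (hg : g ∈ G) :
    |red x g| ≤ q :=
  (Finset.single_le_sum (f := fun g => |red x g|) (fun _ _ => abs_nonneg _) hg).trans
    (h.red_norm_le x)

lemma abs_red_le_real (h : IsShortlyPresented V G red R q) (x : Γ) {g : Γ} (hg : g ∈ G) :
    |(red x g : ℝ)| ≤ q := by
  exact_mod_cast h.abs_red_le x hg

lemma sum_mul_eq (h : IsShortlyPresented V G red R q) (w : Γ → ℝ) {f : Γ → ℝ} (hf : f ∈ V) :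
    ∑ x, w x * f x = ∑ g ∈ G, (∑ x, w x * red x g) * f g := by
  simp_rw [Finset.sum_mul]
  rw [Finset.sum_comm]
  refine Finset.sum_congr rfl fun x _ => ?_
  rw [h.eval_eq f hf x, Finset.mul_sum]
  exact Finset.sum_congr rfl fun g _ => by ring

lemma abs_mul_card_le (h : IsShortlyPresented V G red R q) {f : Γ → ℝ} (hf : f ∈ V) (y : Γ) :
    |f y| * Fintype.card Γ ≤ (q : ℝ) ^ 2 * ∑ x, |f x| := by
  have key (x : Γ) : |f y| ≤ ∑ g ∈ G, (q : ℝ) * |f (x * g)| := by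
    have := h.eval_eq _ (h.left_inv f hf x) (x⁻¹ * y)
    simp only [mul_inv_cancel_left] at this
    rw [this]
    refine (Finset.abs_sum_le_sum_abs _ _).trans (Finset.sum_le_sum fun g hg => ?_)
    rw [abs_mul]
    exact mul_le_mul_of_nonneg_right (h.abs_red_le_real _ hg) (abs_nonneg _)
  calc |f y| * Fintype.card Γ = ∑ _x : Γ, |f y| := by simp [mul_comm]
    _ ≤ ∑ x, ∑ g ∈ G, (q : ℝ) * |f (x * g)| := Finset.sum_le_sum fun x _ => key x
    _ = ∑ g ∈ G, (q : ℝ) * ∑ x, |f x| := by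
      rw [Finset.sum_comm]
      refine Finset.sum_congr rfl fun g _ => ?_
      rw [← Finset.mul_sum]
      congr 1
      exact Fintype.sum_equiv (Equiv.mulRight g) _ _ fun x => rfl
    _ = (G.card : ℝ) * (q * ∑ x, |f x|) := by simp
    _ ≤ (q : ℝ) * (q * ∑ x, |f x|) := by
      have := h.card_le
      have : 0 ≤ ∑ x, |f x| := Finset.sum_nonneg fun _ _ => abs_nonneg _
      gcongr
    _ = _ := by ring

/-- Greedy choice of many elements whose pairwise quotients avoid a small set. -/
lemma exists_quotients_avoiding (g : Γ) (U : Finset Γ) (m : ℕ)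
    (hm : m * (2 * U.card + 1) ≤ Fintype.card Γ) :
    ∃ Y : Finset Γ, Y.card = m ∧ ∀ y ∈ Y, ∀ y' ∈ Y, y ≠ y' → g * y⁻¹ * y' ∉ U := by
  induction m with
  | zero => exact ⟨∅, by simp⟩
  | succ m ih =>
    obtain ⟨Y, hY, hYU⟩ := ih (le_trans (Nat.mul_le_mul_right _ (Nat.le_succ m)) hm)
    let B : Finset Γ := Y ∪ ((Y ×ˢ U).image (fun p => p.1 * g⁻¹ * p.2) ∪
      (Y ×ˢ U).image (fun p => p.1 * p.2⁻¹ * g))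
    have hB : B.card < Fintype.card Γ := by
      calc B.card ≤ Y.card + (Y.card * U.card + Y.card * U.card) := by
            refine (Finset.card_union_le _ _).trans (Nat.add_le_add_left ?_ _)
            refine (Finset.card_union_le _ _).trans (Nat.add_le_add ?_ ?_) <;>
            exact Finset.card_image_le.trans (Finset.card_product _ _).le
        _ = m * (2 * U.card + 1) := by rw [hY]; ring
        _ < (m + 1) * (2 * U.card + 1) := by nlinarith
        _ ≤ _ := hm
    obtain ⟨z, hz⟩ : ∃ z, z ∉ B := by
      by_contra! hc
      exact hB.not_ge (by rw [Finset.eq_univ_of_forall hc, Finset.card_univ])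
    simp only [B, Finset.mem_union, Finset.mem_image, Finset.mem_product, Prod.exists,
      not_or, not_exists, not_and, and_imp] at hz
    refine ⟨insert z Y, by rw [Finset.card_insert_of_notMem hz.1, hY], ?_⟩
    intro y hy y' hy' hne hU
    rw [Finset.mem_insert] at hy hy'
    rcases hy with rfl | hy <;> rcases hy' with rfl | hy'
    · exact hne rfl
    · exact hz.2.2 y' _ hy' hU (by group)
    · exact hz.2.1 y _ hy hU (by group)
    · exact hYU y hy y' hy' hne hU

lemma two_mul_pow_lt (hq : 2 ≤ q) : (2 * (q ^ 4 * q) + 1) ^ q < 2 ^ q ^ 4 := by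
  have h1 : q < 2 ^ q := Nat.lt_two_pow_self
  have h2 : 2 * (q ^ 4 * q) + 1 < 2 ^ (q ^ 3) := by
    rcases Nat.lt_or_ge q 3 with h | h
    · interval_cases q; norm_num
    · calc 2 * (q ^ 4 * q) + 1 ≤ q ^ 6 := by
            have : 1 ≤ q ^ 5 := Nat.one_le_pow _ _ (by omega)
            nlinarith
        _ < (2 ^ q) ^ 6 := Nat.pow_lt_pow_left h1 (by norm_num)
        _ = 2 ^ (q * 6) := by rw [pow_mul]
        _ ≤ 2 ^ (q ^ 3) := Nat.pow_le_pow_right (by norm_num) (by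
          have := Nat.mul_le_mul h h
          nlinarith [Nat.mul_le_mul_left q this])
  calc (2 * (q ^ 4 * q) + 1) ^ q < (2 ^ q ^ 3) ^ q := Nat.pow_lt_pow_left h2 (by omega)
    _ = _ := by rw [← pow_mul]; ring_nf

/-- Evaluation at `g` is a difference of two sums over disjoint sets avoiding a small set. -/
lemma exists_gadget (h : IsShortlyPresented V G red R q) (g : Γ) (U : Finset Γ)
    (hU : q ^ 4 * (2 * U.card + 1) ≤ Fintype.card Γ) :
    ∃ P Q : Finset Γ, Disjoint P Q ∧ Disjoint (P ∪ Q) U ∧ (P ∪ Q).card ≤ q ^ 4 ∧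
      ∀ f ∈ V, f g = ∑ x ∈ P, f x - ∑ x ∈ Q, f x := by
  obtain ⟨Y, hY, hYU⟩ := exists_quotients_avoiding g U _ hU
  let Φ : Finset Γ → G → ℤ := fun A g => ∑ y ∈ A, red y g
  obtain ⟨A, hA, A', hA', hne, hΦ⟩ : ∃ A ∈ Y.powerset, ∃ A' ∈ Y.powerset, A ≠ A' ∧ Φ A = Φ A' := by
    refine Finset.exists_ne_map_eq_of_card_lt_of_maps_to
      (t := Fintype.piFinset fun _ : G => Finset.Icc (-(q ^ 4 * q : ℤ)) (q ^ 4 * q)) ?_ ?_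
    · rw [Fintype.card_piFinset, Finset.card_powerset, hY]
      simp only [Int.card_Icc, Finset.prod_const, Finset.card_univ, Fintype.card_coe]
      have : ((q : ℤ) ^ 4 * q + 1 - -(q ^ 4 * q)).toNat = 2 * (q ^ 4 * q) + 1 := by
        rw [show ((q : ℤ) ^ 4 * q + 1 - -(q ^ 4 * q)) = ((2 * (q ^ 4 * q) + 1 : ℕ) : ℤ) by
          push_cast; ring, Int.toNat_natCast]
      rw [this]
      exact (Nat.pow_le_pow_right (by omega) h.card_le).trans_lt (two_mul_pow_lt h.two_le)
    · intro A hA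
      simp only [Finset.coe_powerset, Set.mem_preimage, Set.mem_powerset_iff,
        Finset.coe_subset] at hA
      simp only [Finset.mem_coe, Fintype.mem_piFinset, Finset.mem_Icc, ← abs_le]
      intro g
      calc |Φ A g| ≤ ∑ y ∈ A, |red y g| := Finset.abs_sum_le_sum_abs _ _
        _ ≤ ∑ _y ∈ A, (q : ℤ) := Finset.sum_le_sum fun y _ => h.abs_red_le y g.2
        _ = A.card * q := by simp
        _ ≤ q ^ 4 * q := by
          have : (A.card : ℤ) ≤ (q : ℤ) ^ 4 := by
            exact_mod_cast (Finset.card_le_card hA).trans hY.le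
          gcongr
  have hsum : ∀ f ∈ V, ∑ y ∈ A, f y = ∑ y ∈ A', f y := by
    intro f hf
    have (B : Finset Γ) : ∑ y ∈ B, f y = ∑ g : G, (Φ B g : ℝ) * f g := by
      rw [Finset.sum_coe_sort G (fun g => ((∑ y ∈ B, red y g : ℤ) : ℝ) * f g)]
      push_cast
      simp_rw [Finset.sum_mul]
      rw [Finset.sum_comm]
      exact Finset.sum_congr rfl fun x _ => h.eval_eq f hf x
    rw [this, this, hΦ]
  rw [Finset.mem_powerset] at hA hA'
  clear hΦ
  wlog hy : ∃ y ∈ A, y ∉ A' generalizing A A'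
  · refine this A' hA' A hA hne.symm (fun f hf => (hsum f hf).symm) ?_
    by_contra! hc
    push Not at hy
    exact hne (Finset.Subset.antisymm hy hc)
  obtain ⟨y, hyA, hyA'⟩ := hy
  have hinj : Function.Injective fun z => g * y⁻¹ * z := mul_right_injective _
  refine ⟨(A' \ A).image (fun z => g * y⁻¹ * z), ((A \ A').erase y).image fun z => g * y⁻¹ * z,
    ?_, ?_, ?_, ?_⟩
  · rw [Finset.disjoint_image hinj]
    exact Finset.disjoint_of_subset_right (Finset.erase_subset _ _) disjoint_sdiff_sdiff
  · rw [← Finset.image_union, Finset.disjoint_left]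
    simp only [Finset.mem_image, Finset.mem_union, Finset.mem_sdiff, Finset.mem_erase]
    rintro _ ⟨z, hz, rfl⟩
    refine hYU y (hA hyA) z ?_ ?_
    · rcases hz with hz | hz
      · exact hA' hz.1
      · exact hA hz.2.1
    · rintro rfl
      rcases hz with hz | hz
      · exact hz.2 hyA
      · exact hz.1 rfl
  · rw [← Finset.image_union, ← hY]
    refine Finset.card_image_le.trans (Finset.card_le_card ?_)
    refine Finset.union_subset (Finset.sdiff_subset.trans hA') ?_
    exact (Finset.erase_subset _ _).trans (Finset.sdiff_subset.trans hA)
  · intro f hf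
    rw [Finset.sum_image hinj.injOn, Finset.sum_image hinj.injOn]
    have h1 := hsum _ (h.left_inv f hf (g * y⁻¹))
    rw [← Finset.sum_inter_add_sum_sdiff A A', ← Finset.sum_inter_add_sum_sdiff A' A,
      Finset.inter_comm A' A, add_right_inj,
      ← Finset.add_sum_erase _ _ (Finset.mem_sdiff.2 ⟨hyA, hyA'⟩)] at h1
    simp only [inv_mul_cancel_right] at h1
    linarith

/-- Pairwise disjoint gadgets for a finite family of group elements. -/
lemma exists_absorber (h : IsShortlyPresented V G red R q) {ι : Type*} [DecidableEq ι]
    (a : ι → Γ) (s : Finset ι) (hs : q ^ 4 * (2 * (q ^ 4 * s.card) + 1) ≤ Fintype.card Γ) :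
    ∃ P Q : ι → Finset Γ,
      (∀ i ∈ s, Disjoint (P i) (Q i) ∧ (P i ∪ Q i).card ≤ q ^ 4 ∧
        ∀ f ∈ V, f (a i) = ∑ x ∈ P i, f x - ∑ x ∈ Q i, f x) ∧
      ∀ i ∈ s, ∀ j ∈ s, i ≠ j → Disjoint (P i ∪ Q i) (P j ∪ Q j) := by
  induction s using Finset.induction_on with
  | empty => exact ⟨fun _ => ∅, fun _ => ∅, by simp, by simp⟩
  | insert i s hi ih =>
    rw [Finset.card_insert_of_notMem hi] at hs
    obtain ⟨P, Q, h1, h2⟩ := ih (le_trans (by gcongr; omega) hs)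
    have hcard : (s.biUnion fun i => P i ∪ Q i).card ≤ q ^ 4 * s.card := by
      refine Finset.card_biUnion_le.trans ((Finset.sum_le_sum fun i hi => (h1 i hi).2.1).trans ?_)
      simp [mul_comm]
    obtain ⟨P', Q', hd, hU, hc, hf⟩ := h.exists_gadget (a i) (s.biUnion fun i => P i ∪ Q i)
      (le_trans (by gcongr; exact hcard.trans (by gcongr; omega)) hs)
    have hne : ∀ j ∈ s, j ≠ i := fun j hj hji => hi (hji ▸ hj)
    rw [Finset.disjoint_biUnion_right] at hU
    refine ⟨Function.update P i P', Function.update Q i Q', ?_, ?_⟩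
    · intro j hj
      rcases Finset.mem_insert.1 hj with rfl | hj
      · simpa using ⟨hd, hc, hf⟩
      · simpa [hne j hj] using h1 j hj
    · intro j hj k hk hjk
      rcases Finset.mem_insert.1 hj with rfl | hj' <;> rcases Finset.mem_insert.1 hk with rfl | hk'
      · exact (hjk rfl).elim
      · simpa [hne k hk'] using hU k hk'
      · simpa [hne j hj'] using (hU j hj').symm
      · simpa [hne j hj', hne k hk'] using h2 j hj' k hk' hjk

/-- A function in `V` cannot concentrate on a small set `U`. -/
lemma sq_mul_card_le (h : IsShortlyPresented V G red R q) {U : Finset Γ}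
    (hU : 2 * (q : ℝ) ^ 4 * U.card ≤ Fintype.card Γ) {f : Γ → ℝ} (hf : f ∈ V) (y : Γ) :
    f y ^ 2 * Fintype.card Γ ≤ 2 * (q : ℝ) ^ 4 * ∑ x ∈ Uᶜ, f x ^ 2 := by
  have hpos : (0 : ℝ) < Fintype.card Γ := by exact_mod_cast Fintype.card_pos
  obtain ⟨z, -, hz⟩ := Finset.exists_max_image Finset.univ (fun x => f x ^ 2) ⟨y, Finset.mem_univ y⟩
  have hz (x : Γ) : f x ^ 2 ≤ f z ^ 2 := hz x (Finset.mem_univ x)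
  have h1 := h.abs_mul_card_le hf z
  have h2 : (∑ x, |f x|) ^ 2 ≤ Fintype.card Γ * ∑ x, f x ^ 2 := by
    simpa using sq_sum_le_card_mul_sum_sq (s := Finset.univ) (f := fun x => |f x|)
  have h3 : f z ^ 2 * Fintype.card Γ ≤ (q : ℝ) ^ 4 * ∑ x, f x ^ 2 := by
    refine le_of_mul_le_mul_right ?_ hpos
    calc f z ^ 2 * Fintype.card Γ * Fintype.card Γ = (|f z| * Fintype.card Γ) ^ 2 := by
          rw [mul_pow, sq_abs]; ring
      _ ≤ ((q : ℝ) ^ 2 * ∑ x, |f x|) ^ 2 := by gcongr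
      _ = (q : ℝ) ^ 4 * (∑ x, |f x|) ^ 2 := by ring
      _ ≤ (q : ℝ) ^ 4 * (Fintype.card Γ * ∑ x, f x ^ 2) := by gcongr
      _ = _ := by ring
  have h4 : ∑ x ∈ U, f x ^ 2 ≤ U.card * f z ^ 2 := by
    simpa using Finset.sum_le_sum (s := U) fun x _ => hz x
  have h5 := Finset.sum_add_sum_compl U fun x => f x ^ 2
  have h6 : 2 * ((q : ℝ) ^ 4 * (U.card * f z ^ 2)) ≤ Fintype.card Γ * f z ^ 2 := by
    calc 2 * ((q : ℝ) ^ 4 * (U.card * f z ^ 2)) = 2 * (q : ℝ) ^ 4 * U.card * f z ^ 2 := by ring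
      _ ≤ _ := by gcongr
  have h7 : (q : ℝ) ^ 4 * ∑ x ∈ U, f x ^ 2 ≤ (q : ℝ) ^ 4 * (U.card * f z ^ 2) := by gcongr
  have h8 : f y ^ 2 * Fintype.card Γ ≤ f z ^ 2 * Fintype.card Γ :=
    mul_le_mul_of_nonneg_right (hz y) hpos.le
  rw [← h5] at h3
  nlinarith

/-- Fractional solution: a prescribed small set `B` extends to a weighting of total mass `N` which
is uniform from the viewpoint of `V`. -/
lemma exists_weights (h : IsShortlyPresented V G red R q) {U B : Finset Γ} (hB : B ⊆ U) {N : ℝ}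
    (hN : 4 * (q : ℝ) ^ 4 * U.card ≤ N) (hN' : 2 * N ≤ Fintype.card Γ) :
    ∃ w : Γ → ℝ, (∀ x, 0 ≤ w x ∧ w x ≤ 1) ∧ (∀ x ∈ U, w x = 0) ∧
      ∀ f ∈ V, ∑ x, w x * f x + ∑ x ∈ B, f x = N / Fintype.card Γ * ∑ x, f x := by
  have hpos : (0 : ℝ) < Fintype.card Γ := by exact_mod_cast Fintype.card_pos
  have hN0 : 0 ≤ N := le_trans (by positivity) hN
  have hU : 2 * (q : ℝ) ^ 4 * U.card ≤ Fintype.card Γ := by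
    have : 0 ≤ (q : ℝ) ^ 4 * U.card := by positivity
    linarith
  let restr : V →ₗ[ℝ] Module.Dual ℝ V := LinearMap.mk₂ ℝ
    (fun a b => ∑ x ∈ Uᶜ, a.1 x * b.1 x)
    (fun a a' b => by simp [add_mul, Finset.sum_add_distrib])
    (fun c a b => by simp [mul_assoc, Finset.mul_sum])
    (fun a b b' => by simp [mul_add, Finset.sum_add_distrib])
    (fun c a b => by simp [mul_left_comm, Finset.mul_sum])
  have hinj : Function.Injective restr := by
    rw [injective_iff_map_eq_zero]
    intro a ha
    have h0 : ∑ x ∈ Uᶜ, a.1 x ^ 2 = 0 := by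
      simpa [restr, sq] using LinearMap.congr_fun ha a
    ext y
    have := h.sq_mul_card_le hU a.2 y
    rw [h0, mul_zero] at this
    have h2 : a.1 y ^ 2 ≤ 0 := nonpos_of_mul_nonpos_left this hpos
    simpa using le_antisymm h2 (sq_nonneg _)
  have hsurj : Function.Surjective restr :=
    (LinearMap.injective_iff_surjective_of_finrank_eq_finrank
      (Subspace.dual_finrank_eq).symm).1 hinj
  let target : Module.Dual ℝ V :=
    { toFun := fun a => N / Fintype.card Γ * ∑ x ∈ U, a.1 x - ∑ x ∈ B, a.1 x
      map_add' := fun a b => by simp [Finset.sum_add_distrib]; ring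
      map_smul' := fun c a => by simp [← Finset.mul_sum]; ring }
  obtain ⟨a, ha⟩ := hsurj target
  have ha (f : Γ → ℝ) (hf : f ∈ V) : ∑ x ∈ Uᶜ, a.1 x * f x =
      N / Fintype.card Γ * ∑ x ∈ U, f x - ∑ x ∈ B, f x := LinearMap.congr_fun ha ⟨f, hf⟩
  obtain ⟨z, -, hz⟩ := Finset.exists_max_image Finset.univ (fun x => |a.1 x|) ⟨1, Finset.mem_univ 1⟩
  have hz (x : Γ) : |a.1 x| ≤ |a.1 z| := hz x (Finset.mem_univ x)
  have hsup : |a.1 z| ≤ N / Fintype.card Γ := by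
    have habs (S : Finset Γ) : |∑ x ∈ S, a.1 x| ≤ S.card * |a.1 z| := by
      refine (Finset.abs_sum_le_sum_abs _ _).trans ?_
      simpa using Finset.sum_le_sum (s := S) fun x _ => hz x
    have h1 : ∑ x ∈ Uᶜ, a.1 x ^ 2 ≤ 2 * U.card * |a.1 z| := by
      have e := ha a.1 a.2
      simp only [← sq] at e
      rw [e]
      have hfrac : N / Fintype.card Γ ≤ 1 := by rw [div_le_one hpos]; linarith
      have h2 : N / Fintype.card Γ * ∑ x ∈ U, a.1 x ≤ 1 * (U.card * |a.1 z|) := by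
        calc N / Fintype.card Γ * ∑ x ∈ U, a.1 x ≤ N / Fintype.card Γ * (U.card * |a.1 z|) := by
              have := (le_abs_self _).trans (habs U)
              gcongr
          _ ≤ _ := by gcongr
      have h3 : -∑ x ∈ B, a.1 x ≤ U.card * |a.1 z| := by
        refine (neg_le_abs _).trans ((habs B).trans ?_)
        have := Finset.card_le_card hB
        gcongr
      linarith
    have h2 := h.sq_mul_card_le hU a.2 z
    rw [← sq_abs] at h2
    have h3 : |a.1 z| ^ 2 * Fintype.card Γ ≤ N * |a.1 z| := by
      calc _ ≤ _ := h2
        _ ≤ 2 * (q : ℝ) ^ 4 * (2 * U.card * |a.1 z|) := by gcongr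
        _ = 4 * (q : ℝ) ^ 4 * U.card * |a.1 z| := by ring
        _ ≤ _ := by gcongr
    rcases (abs_nonneg (a.1 z)).eq_or_lt with h0 | h0
    · rw [← h0]; positivity
    · rw [le_div_iff₀ hpos]
      refine le_of_mul_le_mul_right ?_ h0
      linarith [h3]
  refine ⟨fun x => if x ∈ U then 0 else N / Fintype.card Γ + a.1 x, fun x => ?_,
    fun x hx => if_pos hx, fun f hf => ?_⟩
  · have h1 := abs_le.1 ((hz x).trans hsup)
    have h2 : N / Fintype.card Γ ≤ 1 / 2 := by rw [div_le_iff₀ hpos]; linarith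
    dsimp only
    split_ifs
    · simp
    · constructor <;> linarith
  · rw [← Finset.sum_add_sum_compl U fun x => (if x ∈ U then 0 else N / Fintype.card Γ + a.1 x) * f x,
      ← Finset.sum_add_sum_compl U fun x => f x,
      Finset.sum_eq_zero (s := U) fun x hx => by simp [hx]]
    have h1 : ∑ x ∈ Uᶜ, (if x ∈ U then 0 else N / Fintype.card Γ + a.1 x) * f x =
        N / Fintype.card Γ * ∑ x ∈ Uᶜ, f x + ∑ x ∈ Uᶜ, a.1 x * f x := by
      rw [Finset.mul_sum, ← Finset.sum_add_distrib]
      refine Finset.sum_congr rfl fun x hx => ?_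
      rw [if_neg (Finset.mem_compl.1 hx), add_mul]
    rw [h1, ha f hf]
    ring

/-- A fractional weighting can be rounded to an integral one outside at most `|G|` points. -/
lemma exists_rounding (h : IsShortlyPresented V G red R q) {U : Finset Γ} {w : Γ → ℝ}
    (hw : ∀ x, 0 ≤ w x ∧ w x ≤ 1) (hU : ∀ x ∈ U, w x = 0) :
    ∃ w' : Γ → ℝ, (∀ x, 0 ≤ w' x ∧ w' x ≤ 1) ∧ (∀ x ∈ U, w' x = 0) ∧
      (Finset.univ.filter fun x => w' x ≠ 0 ∧ w' x ≠ 1).card ≤ G.card ∧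
      ∀ f ∈ V, ∑ x, w' x * f x = ∑ x, w x * f x := by
  let S : Set (Γ → ℝ) := {v | v ∈ Set.Icc (0 : Γ → ℝ) 1 ∧ (∀ x ∈ U, v x = 0) ∧
    ∀ f ∈ V, ∑ x, v x * f x = ∑ x, w x * f x}
  have hmem (v : Γ → ℝ) : v ∈ Set.Icc (0 : Γ → ℝ) 1 ↔ ∀ x, 0 ≤ v x ∧ v x ≤ 1 := by
    simp [Set.mem_Icc, Pi.le_def, forall_and]
  have hS : IsCompact S := by
    have : S = Set.Icc (0 : Γ → ℝ) 1 ∩ ((⋂ x ∈ U, {v | v x = 0}) ∩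
        ⋂ f ∈ V, {v : Γ → ℝ | ∑ x, v x * f x = ∑ x, w x * f x}) := by
      ext v; simp [S]; tauto
    rw [this]
    exact isCompact_Icc.inter_right <| IsClosed.inter
      (isClosed_biInter fun x _ => isClosed_eq (continuous_apply x) continuous_const)
      (isClosed_biInter fun f _ => isClosed_eq (by fun_prop) continuous_const)
  obtain ⟨v, hv⟩ := hS.extremePoints_nonempty ⟨w, (hmem w).2 hw, hU, fun _ _ => rfl⟩
  have hvS := hv.1
  have hv01 := (hmem v).1 hvS.1
  refine ⟨v, hv01, hvS.2.1, ?_, hvS.2.2⟩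
  by_contra! hcard
  set F := Finset.univ.filter fun x => v x ≠ 0 ∧ v x ≠ 1
  have hF {x : Γ} (hx : x ∈ F) : v x ≠ 0 ∧ v x ≠ 1 := (Finset.mem_filter.1 hx).2
  obtain ⟨c, hc, x₀, hx₀⟩ : ∃ c : F → ℝ, ∑ x, c x • (fun g : G => (red x g : ℝ)) = 0 ∧
      ∃ x, c x ≠ 0 := by
    have : ¬ LinearIndependent ℝ fun (x : F) (g : G) => (red x g : ℝ) := fun hli => by
      have := hli.fintype_card_le_finrank
      simp at this
      omega
    exact Fintype.not_linearIndependent_iff.1 this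
  let z : Γ → ℝ := fun x => if hx : x ∈ F then c ⟨x, hx⟩ else 0
  have hz (f : Γ → ℝ) (hf : f ∈ V) : ∑ x, z x * f x = 0 := by
    rw [h.sum_mul_eq z hf]
    refine Finset.sum_eq_zero fun g hg => ?_
    have h1 := congrFun hc ⟨g, hg⟩
    simp only [Finset.sum_apply, Pi.smul_apply, smul_eq_mul, Pi.zero_apply] at h1
    have h2 : ∑ x, z x * (red x g : ℝ) = ∑ x ∈ F, z x * (red x g : ℝ) :=
      (Finset.sum_subset (Finset.subset_univ _) fun x _ hx => by simp [z, hx]).symm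
    rw [h2, ← Finset.sum_coe_sort]
    simp only [z, Finset.coe_mem, dite_true, Subtype.coe_eta]
    rw [h1, zero_mul]
  obtain ⟨ε, hε, hεz⟩ : ∃ ε > 0, ∀ x, ε * |z x| ≤ v x ∧ ε * |z x| ≤ 1 - v x := by
    have hloc (x : Γ) : ∀ᶠ ε in nhdsWithin (0 : ℝ) (Set.Ioi 0),
        ε * |z x| ≤ v x ∧ ε * |z x| ≤ 1 - v x := by
      by_cases hx : x ∈ F
      · have h1 : 0 < v x := lt_of_le_of_ne (hv01 x).1 (hF hx).1.symm
        have h2 : 0 < 1 - v x := sub_pos.2 (lt_of_le_of_ne (hv01 x).2 (hF hx).2)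
        have ht : Filter.Tendsto (fun ε : ℝ => ε * |z x|) (nhdsWithin 0 (Set.Ioi 0)) (nhds 0) := by
          have : Filter.Tendsto (fun ε : ℝ => ε * |z x|) (nhds 0) (nhds (0 * |z x|)) :=
            (continuous_id.mul continuous_const).tendsto 0
          rw [zero_mul] at this
          exact this.mono_left nhdsWithin_le_nhds
        filter_upwards [ht.eventually_lt_const h1, ht.eventually_lt_const h2] with ε e1 e2
        exact ⟨e1.le, e2.le⟩
      · have : z x = 0 := by simp [z, hx]
        simp [this, hv01 x]
    obtain ⟨ε, h1, h2⟩ :=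
      ((Filter.eventually_all.2 hloc).and self_mem_nhdsWithin).exists
    exact ⟨ε, h2, h1⟩
  have hpert (s : ℝ) (hs : |s| = ε) : v + s • z ∈ S := by
    refine ⟨(hmem _).2 fun x => ?_, fun x hx => ?_, fun f hf => ?_⟩
    · have h1 : |s * z x| = ε * |z x| := by rw [abs_mul, hs]
      have h2 := abs_le.1 h1.le
      have h3 := hεz x
      simp only [Pi.add_apply, Pi.smul_apply, smul_eq_mul]
      constructor <;> linarith
    · have h0 := hvS.2.1 x hx
      have : z x = 0 := dif_neg fun hxF => (hF hxF).1 h0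
      simp [h0, this]
    · simp only [Pi.add_apply, Pi.smul_apply, smul_eq_mul, add_mul, Finset.sum_add_distrib,
        mul_assoc, ← Finset.mul_sum, hz f hf, mul_zero, add_zero]
      exact hvS.2.2 f hf
  have hmid : v ∈ openSegment ℝ (v + ε • z) (v + (-ε) • z) :=
    ⟨1 / 2, 1 / 2, by norm_num, by norm_num, by norm_num, by module⟩
  have h1 := ((mem_extremePoints.1 hv).2 _ (hpert ε (abs_of_pos hε)) _
    (hpert (-ε) (by rw [abs_neg, abs_of_pos hε])) hmid).1
  have h2 := congrFun h1 x₀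
  simp only [Pi.add_apply, Pi.smul_apply, smul_eq_mul, add_eq_left, mul_eq_zero, hε.ne',
    false_or, z, Finset.coe_mem, dite_true, Subtype.coe_eta] at h2
  exact hx₀ h2

/-- A real relation on `G` is close to an integer relation on `G`. -/
lemma exists_integer_relation (h : IsShortlyPresented V G red R q) (z : Γ → ℝ)
    (hz : ∀ f ∈ V, ∑ g ∈ G, z g * f g = 0) :
    ∃ m : Γ → ℤ, (∀ f ∈ V, ∑ g ∈ G, (m g : ℝ) * f g = 0) ∧
      ∀ g ∈ G, |z g - m g| ≤ (q : ℝ) ^ 3 := by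
  let s : Set (G → ℝ) := {v | ∃ ρ ∈ R, v = fun g : G => ((∑ x, ρ x * red x g : ℤ) : ℝ)}
  have hzs : (fun g : G => z g) ∈ Submodule.span ℝ s := by
    by_contra hc
    obtain ⟨φ, hφ, hker⟩ := Submodule.exists_le_ker_of_notMem hc
    let f₀ : G → ℝ := fun g => φ fun j => if g = j then 1 else 0
    have hφ' (v : G → ℝ) : φ v = ∑ g, v g * f₀ g := LinearMap.pi_apply_eq_sum_univ φ v
    let f : Γ → ℝ := fun x => ∑ g : G, (red x g : ℝ) * f₀ g
    have hfV : f ∈ V := by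
      refine h.mem_of_rel f fun ρ hρ => ?_
      have h1 : φ (fun g : G => ((∑ x, ρ x * red x g : ℤ) : ℝ)) = 0 :=
        hker (Submodule.subset_span ⟨ρ, hρ, rfl⟩)
      rw [hφ'] at h1
      rw [← h1]
      simp only [f, Int.cast_sum, Int.cast_mul, Finset.mul_sum, Finset.sum_mul]
      rw [Finset.sum_comm]
      exact Finset.sum_congr rfl fun g _ => Finset.sum_congr rfl fun x _ => by ring
    have hfG (g : G) : f g = f₀ g := by
      simp only [f]
      rw [Finset.sum_eq_single g]
      · simp [h.red_self g g.2 g g.2]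
      · intro g' _ hne
        rw [h.red_self g g.2 g' g'.2, if_neg fun e => hne (Subtype.ext e.symm)]
        simp
      · simp
    apply hφ
    rw [hφ', ← hz f hfV, ← Finset.sum_coe_sort G]
    exact Finset.sum_congr rfl fun g _ => by rw [hfG]
  obtain ⟨b, hb, hspan, -⟩ := Submodule.exists_fun_fin_finrank_span_eq ℝ s
  rw [← hspan, Submodule.mem_span_range_iff_exists_fun] at hzs
  obtain ⟨c, hc⟩ := hzs
  choose ρ hρ hbρ using hb
  have hr : Module.finrank ℝ (Submodule.span ℝ s) ≤ q := by
    refine (Submodule.finrank_le _).trans ?_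
    simpa using h.card_le
  refine ⟨fun g => ∑ i, round (c i) * ∑ x, ρ i x * red x g, fun f hf => ?_, fun g hg => ?_⟩
  · have h1 (i) : ∑ g ∈ G, (∑ x, (ρ i x : ℝ) * red x g) * f g = 0 := by
      rw [← h.sum_mul_eq _ hf]; exact h.rel _ (hρ i) f hf
    push_cast
    simp_rw [Finset.sum_mul]
    rw [Finset.sum_comm]
    refine Finset.sum_eq_zero fun i _ => ?_
    simp_rw [mul_assoc]
    rw [← Finset.mul_sum, h1, mul_zero]
  · have h1 : z g = ∑ i, c i * ((∑ x, ρ i x * red x g : ℤ) : ℝ) := by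
      have := congrFun hc ⟨g, hg⟩
      rw [← this]
      simp [hbρ]
    have h2 (i) : |((∑ x, ρ i x * red x g : ℤ) : ℝ)| ≤ (q : ℝ) ^ 2 := by
      have : |∑ x, ρ i x * red x g| ≤ (q : ℤ) ^ 2 := by
        calc |∑ x, ρ i x * red x g| ≤ ∑ x, |ρ i x| * q := by
              refine (Finset.abs_sum_le_sum_abs _ _).trans (Finset.sum_le_sum fun x _ => ?_)
              rw [abs_mul]
              exact mul_le_mul_of_nonneg_left (h.abs_red_le x hg) (abs_nonneg _)
          _ ≤ q * q := by
              rw [← Finset.sum_mul]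
              exact mul_le_mul_of_nonneg_right (h.rel_norm_le _ (hρ i)) (by positivity)
          _ = _ := by ring
      exact_mod_cast this
    have h3 : z g - ((∑ i, round (c i) * ∑ x, ρ i x * red x g : ℤ) : ℝ) =
        ∑ i, (c i - round (c i)) * ((∑ x, ρ i x * red x g : ℤ) : ℝ) := by
      rw [h1, Int.cast_sum, ← Finset.sum_sub_distrib]
      refine Finset.sum_congr rfl fun i _ => ?_
      rw [Int.cast_mul]; ring
    rw [h3]
    calc _ ≤ ∑ i : Fin (Module.finrank ℝ (Submodule.span ℝ s)), (q : ℝ) ^ 2 := by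
          refine (Finset.abs_sum_le_sum_abs _ _).trans (Finset.sum_le_sum fun i _ => ?_)
          rw [abs_mul]
          have := abs_sub_round (c i)
          calc _ ≤ 1 * (q : ℝ) ^ 2 := by
                refine mul_le_mul (by linarith) (h2 i) (abs_nonneg _) zero_le_one
            _ = _ := one_mul _
      _ ≤ (q : ℝ) * (q : ℝ) ^ 2 := by
          rw [Finset.sum_const, nsmul_eq_mul, Finset.card_univ, Fintype.card_fin]
          gcongr
      _ = _ := by ring

lemma sum_finset_mul_eq (h : IsShortlyPresented V G red R q) (S : Finset Γ) (w : Γ → ℝ)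
    {f : Γ → ℝ} (hf : f ∈ V) :
    ∑ x ∈ S, w x * f x = ∑ g ∈ G, (∑ x ∈ S, w x * red x g) * f g := by
  simpa [ite_mul, Finset.sum_ite_mem] using h.sum_mul_eq (fun x => if x ∈ S then w x else 0) hf

/-- Absorption: there is a small set `U` with subsets realizing any small integer combination
of evaluations on `G`, relative to a base subset. -/
lemma exists_switchable (h : IsShortlyPresented V G red R q) (hΓ : q ^ 20 ≤ Fintype.card Γ) :
    ∃ U B : Finset Γ, B ⊆ U ∧ U.card ≤ 4 * q ^ 8 ∧ ∀ κ : Γ → ℤ, (∀ g ∈ G, |κ g| ≤ 2 * q ^ 3) →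
      ∃ T ⊆ U, ∀ f ∈ V, ∑ x ∈ T, f x = ∑ x ∈ B, f x + ∑ g ∈ G, (κ g : ℝ) * f g := by
  have hq := h.two_le
  obtain ⟨K, hKq⟩ : ∃ K, K = 2 * q ^ 3 := ⟨_, rfl⟩
  set s : Finset (Γ × ℕ) := G ×ˢ Finset.range (2 * K)
  have hs : s.card ≤ 4 * q ^ 4 := by
    simp only [s, hKq, Finset.card_product, Finset.card_range]
    calc G.card * (2 * (2 * q ^ 3)) ≤ q * (2 * (2 * q ^ 3)) := Nat.mul_le_mul_right _ h.card_le
      _ = _ := by ring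
  obtain ⟨P, Q, hPQ, hdisj⟩ := h.exists_absorber Prod.fst s <| by
    calc q ^ 4 * (2 * (q ^ 4 * s.card) + 1) ≤ q ^ 4 * (2 * (q ^ 4 * (4 * q ^ 4)) + 1) := by gcongr
      _ = 8 * q ^ 12 + q ^ 4 := by ring
      _ ≤ 8 * q ^ 12 + q ^ 12 := by gcongr <;> omega
      _ = 9 * q ^ 12 := by ring
      _ ≤ 2 ^ 8 * q ^ 12 := by gcongr; norm_num
      _ ≤ q ^ 8 * q ^ 12 := by gcongr
      _ = q ^ 20 := by ring
      _ ≤ _ := hΓ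
  obtain ⟨sel, sel_eq⟩ : ∃ sel : (Γ → ℕ) → Γ × ℕ → Finset Γ,
      ∀ τ i, sel τ i = if i.2 < τ i.1 then P i else Q i := ⟨fun τ i => _, fun _ _ => rfl⟩
  have hsel (τ : Γ → ℕ) (i : Γ × ℕ) : sel τ i ⊆ P i ∪ Q i := by
    rw [sel_eq]
    split_ifs
    · exact Finset.subset_union_left
    · exact Finset.subset_union_right
  have hsub (τ : Γ → ℕ) : s.biUnion (sel τ) ⊆ s.biUnion fun i => P i ∪ Q i :=
    Finset.biUnion_mono fun i _ => hsel τ i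
  have hsum (τ : Γ → ℕ) (hτ : ∀ g ∈ G, τ g ≤ 2 * K) (f : Γ → ℝ) (hf : f ∈ V) :
      ∑ x ∈ s.biUnion (sel τ), f x = ∑ i ∈ s, ∑ x ∈ Q i, f x + ∑ g ∈ G, (τ g : ℝ) * f g := by
    rw [Finset.sum_biUnion fun i hi j hj hij =>
      (hdisj i hi j hj hij).mono (hsel τ i) (hsel τ j)]
    have h1 (i) (hi : i ∈ s) : ∑ x ∈ sel τ i, f x =
        ∑ x ∈ Q i, f x + if i.2 < τ i.1 then f i.1 else 0 := by
      have := (hPQ i hi).2.2 f hf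
      rw [sel_eq]
      split_ifs
      · linarith
      · simp
    rw [Finset.sum_congr rfl h1, Finset.sum_add_distrib, add_right_inj, Finset.sum_product]
    refine Finset.sum_congr rfl fun g hg => ?_
    have : (Finset.range (2 * K)).filter (· < τ g) = Finset.range (τ g) := by
      ext j
      have := hτ g hg
      simp only [Finset.mem_filter, Finset.mem_range]
      omega
    rw [← Finset.sum_filter]
    simp only
    rw [this, Finset.sum_const, nsmul_eq_mul, Finset.card_range]
  refine ⟨s.biUnion fun i => P i ∪ Q i, s.biUnion (sel fun _ => K), hsub _, ?_, fun κ hκ =>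
    ⟨s.biUnion (sel fun g => (K + κ g).toNat), hsub _, fun f hf => ?_⟩⟩
  · calc _ ≤ s.card * q ^ 4 := Finset.card_biUnion_le_card_mul _ _ _ fun i hi => (hPQ i hi).2.1
      _ ≤ 4 * q ^ 4 * q ^ 4 := Nat.mul_le_mul_right _ hs
      _ = _ := by ring
  · have hK (g) (hg : g ∈ G) : |κ g| ≤ K := by simpa [hKq] using hκ g hg
    rw [hsum _ (fun g hg => by have := abs_le.1 (hK g hg); omega) f hf,
      hsum _ (fun g _ => by omega) f hf, add_assoc, ← Finset.sum_add_distrib]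
    congr 1
    refine Finset.sum_congr rfl fun g hg => ?_
    have h1 : (((K + κ g).toNat : ℤ) : ℝ) = ((K + κ g : ℤ) : ℝ) := by
      rw [Int.toNat_of_nonneg]
      have := abs_le.1 (hK g hg)
      omega
    rw [Int.cast_natCast] at h1
    rw [h1]
    push_cast
    ring

/-- If an integral signed measure of mass `N₀ ≤ q` is uniform from the viewpoint of `V`, then so
is a nonempty set of size polynomial in `q`. -/
theorem exists_design (h : IsShortlyPresented V G red R q) {N₀ : ℕ} (hN₀ : 1 ≤ N₀) (hN₀q : N₀ ≤ q)
    (k : Γ → ℤ)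
    (hk : ∀ f ∈ V, ∑ x, (k x : ℝ) * f x = (N₀ : ℝ) / Fintype.card Γ * ∑ x, f x)
    (hΓ : q ^ 20 ≤ Fintype.card Γ) :
    ∃ T : Finset Γ, T.Nonempty ∧ T.card ≤ q ^ 17 ∧
      ∀ f ∈ V, ∑ x ∈ T, f x = (T.card : ℝ) / Fintype.card Γ * ∑ x, f x := by
  have hq := h.two_le
  have hpos : (0 : ℝ) < Fintype.card Γ := by exact_mod_cast Fintype.card_pos
  obtain ⟨U, B, hB, hU, habs⟩ := h.exists_switchable hΓ
  set N : ℕ := 16 * q ^ 12 * N₀ with hN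
  have hNq : N ≤ 16 * q ^ 13 := by
    calc N ≤ 16 * q ^ 12 * q := Nat.mul_le_mul_left _ hN₀q
      _ = _ := by ring
  obtain ⟨w, hw01, hwU, hw⟩ := h.exists_weights (N := N) hB
    (by
      have : 4 * q ^ 4 * U.card ≤ N := by
        calc 4 * q ^ 4 * U.card ≤ 4 * q ^ 4 * (4 * q ^ 8) := Nat.mul_le_mul_left _ hU
          _ = 16 * q ^ 12 * 1 := by ring
          _ ≤ _ := Nat.mul_le_mul_left _ hN₀
      exact_mod_cast this)
    (by
      have : 2 * N ≤ Fintype.card Γ := by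
        calc 2 * N ≤ 2 * (16 * q ^ 13) := Nat.mul_le_mul_left _ hNq
          _ = 2 ^ 5 * q ^ 13 := by ring
          _ ≤ q ^ 7 * q ^ 13 := by
            refine Nat.mul_le_mul_right _ ?_
            calc 2 ^ 5 ≤ 2 ^ 7 := by norm_num
              _ ≤ q ^ 7 := Nat.pow_le_pow_left hq _
          _ = q ^ 20 := by ring
          _ ≤ _ := hΓ
      exact_mod_cast this)
  obtain ⟨v, hv01, hvU, hvF, hv⟩ := h.exists_rounding hw01 hwU
  set F := Finset.univ.filter fun x => v x ≠ 0 ∧ v x ≠ 1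
  set T₁ := Finset.univ.filter fun x => v x = 1
  have hsplit (f : Γ → ℝ) : ∑ x, v x * f x = ∑ x ∈ T₁, f x + ∑ x ∈ F, v x * f x := by
    simp only [T₁, F, Finset.sum_filter, ← Finset.sum_add_distrib]
    refine Finset.sum_congr rfl fun x _ => ?_
    by_cases h0 : v x = 0
    · simp [h0]
    · by_cases h1 : v x = 1 <;> simp [h0, h1]
  let κ₀ : Γ → ℤ := fun g => 16 * q ^ 12 * ∑ x, k x * red x g - ∑ x ∈ T₁, red x g - ∑ x ∈ B, red x g
  have hsumS (S : Finset Γ) (f : Γ → ℝ) (hf : f ∈ V) :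
      ∑ x ∈ S, f x = ∑ g ∈ G, (∑ x ∈ S, (red x g : ℝ)) * f g := by
    simpa using h.sum_finset_mul_eq S (fun _ => 1) hf
  have hκ₀ (f : Γ → ℝ) (hf : f ∈ V) : ∑ g ∈ G, (κ₀ g : ℝ) * f g =
      (N : ℝ) / Fintype.card Γ * ∑ x, f x - ∑ x ∈ T₁, f x - ∑ x ∈ B, f x := by
    have h1 : (N : ℝ) / Fintype.card Γ * ∑ x, f x = 16 * q ^ 12 * ∑ x, (k x : ℝ) * f x := by
      rw [hk f hf, hN]; push_cast; ring
    rw [h1, h.sum_mul_eq _ hf, hsumS T₁ f hf, hsumS B f hf, Finset.mul_sum,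
      ← Finset.sum_sub_distrib, ← Finset.sum_sub_distrib]
    refine Finset.sum_congr rfl fun g _ => ?_
    simp only [κ₀]
    push_cast
    ring
  obtain ⟨m, hm, hmz⟩ := h.exists_integer_relation (fun g => κ₀ g - ∑ x ∈ F, v x * red x g)
    fun f hf => by
      simp only [sub_mul, Finset.sum_sub_distrib]
      rw [hκ₀ f hf, ← h.sum_finset_mul_eq F v hf]
      have h1 := hw f hf
      have h2 := hv f hf
      rw [hsplit] at h2
      linarith
  have hρ (g) (hg : g ∈ G) : |∑ x ∈ F, v x * (red x g : ℝ)| ≤ (q : ℝ) ^ 2 := by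
    calc _ ≤ ∑ x ∈ F, (q : ℝ) := by
          refine (Finset.abs_sum_le_sum_abs _ _).trans (Finset.sum_le_sum fun x _ => ?_)
          rw [abs_mul, abs_of_nonneg (hv01 x).1]
          calc _ ≤ 1 * (q : ℝ) := mul_le_mul (hv01 x).2 (h.abs_red_le_real x hg) (abs_nonneg _)
                zero_le_one
            _ = _ := one_mul _
      _ = F.card * (q : ℝ) := by simp
      _ ≤ q * (q : ℝ) := by
          have : F.card ≤ q := hvF.trans h.card_le
          gcongr
      _ = _ := by ring
  obtain ⟨T₂, hT₂, hT₂sum⟩ := habs (fun g => κ₀ g - m g) fun g hg => by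
    have h1 : |((κ₀ g - m g : ℤ) : ℝ)| ≤ 2 * (q : ℝ) ^ 3 := by
      have e : ((κ₀ g - m g : ℤ) : ℝ) =
          (κ₀ g - ∑ x ∈ F, v x * red x g - m g) + ∑ x ∈ F, v x * red x g := by push_cast; ring
      rw [e]
      have h2 : (q : ℝ) ^ 2 ≤ (q : ℝ) ^ 3 :=
        pow_le_pow_right₀ (by exact_mod_cast (by omega : 1 ≤ q)) (by norm_num)
      linarith [abs_add_le (κ₀ g - ∑ x ∈ F, v x * (red x g : ℝ) - m g)
        (∑ x ∈ F, v x * (red x g : ℝ)), hmz g hg, hρ g hg]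
    exact_mod_cast h1
  have hdisj : Disjoint T₁ T₂ := Finset.disjoint_left.2 fun x h1 h2 => by
    have h3 := hvU x (hT₂ h2)
    rw [(Finset.mem_filter.1 h1).2] at h3
    exact one_ne_zero h3
  have hT (f : Γ → ℝ) (hf : f ∈ V) :
      ∑ x ∈ T₁ ∪ T₂, f x = (N : ℝ) / Fintype.card Γ * ∑ x, f x := by
    rw [Finset.sum_union hdisj, hT₂sum f hf]
    have h1 := hκ₀ f hf
    have h2 := hm f hf
    simp only [Int.cast_sub, sub_mul, Finset.sum_sub_distrib]
    linarith
  have hcard : (T₁ ∪ T₂).card = N := by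
    have := hT _ h.one_mem
    simp only [Finset.sum_const, nsmul_eq_mul, mul_one, Finset.card_univ] at this
    rw [div_mul_cancel₀ _ hpos.ne'] at this
    exact_mod_cast this
  refine ⟨T₁ ∪ T₂, ?_, ?_, fun f hf => by rw [hcard]; exact hT f hf⟩
  · rw [← Finset.card_pos, hcard]
    positivity
  · rw [hcard]
    calc N ≤ 2 ^ 4 * q ^ 13 := hNq
      _ ≤ q ^ 4 * q ^ 13 := Nat.mul_le_mul_right _ (Nat.pow_le_pow_left hq _)
      _ = q ^ 17 := by ring

end IsShortlyPresented

section Moebius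

open Finset

variable {ι : Type*} [DecidableEq ι]

/-- The Möbius transform of a set function. -/
def moebiusTransform (g : Finset ι → ℝ) (A : Finset ι) : ℝ :=
  ∑ S ∈ A.powerset, (-1) ^ (#A + #S) * g S

lemma moebiusTransform_insert (g : Finset ι → ℝ) {i : ι} {A : Finset ι} (hi : i ∉ A) :
    moebiusTransform g (insert i A) =
      moebiusTransform (fun S => g (insert i S)) A - moebiusTransform g A := by
  rw [moebiusTransform, sum_powerset_insert hi, moebiusTransform, moebiusTransform, card_insert_of_notMem hi,
    sub_eq_add_neg, add_comm, ← sum_neg_distrib]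
  congr 1
  · refine sum_congr rfl fun S hS => ?_
    rw [card_insert_of_notMem fun h => hi (mem_powerset.1 hS h)]
    ring
  · exact sum_congr rfl fun S _ => by ring

lemma sum_moebiusTransform (g : Finset ι → ℝ) (U : Finset ι) :
    ∑ A ∈ U.powerset, moebiusTransform g A = g U := by
  induction U using Finset.induction_on generalizing g with
  | empty => simp [moebiusTransform]
  | insert i U hi ih =>
    rw [sum_powerset_insert hi, ← sum_add_distrib, ← ih fun S => g (insert i S)]
    refine sum_congr rfl fun A hA => ?_
    rw [moebiusTransform_insert g fun h => hi (mem_powerset.1 hA h)]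
    ring

lemma moebiusTransform_eq_zero {g : Finset ι → ℝ} {B A : Finset ι}
    (hg : ∀ S, g S = g (S ∩ B)) (hA : ¬ A ⊆ B) : moebiusTransform g A = 0 := by
  obtain ⟨i, hi, hiB⟩ := not_subset.1 hA
  rw [← insert_erase hi, moebiusTransform_insert g (notMem_erase i A), sub_eq_zero]
  congr 1
  ext S
  rw [hg, insert_inter_of_notMem hiB, ← hg]

lemma card_filter_card_le [Fintype ι] (D : ℕ) :
    #(univ.filter fun A : Finset ι => #A ≤ D) ≤ (Fintype.card ι + 1) ^ D := by
  have : (univ.filter fun A : Finset ι => #A ≤ D) =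
      (range (D + 1)).biUnion fun j => powersetCard j univ := by
    ext A; simp
  rw [this, add_pow]
  refine card_biUnion_le.trans (sum_le_sum fun j hj => ?_)
  rw [card_powersetCard, card_univ, one_pow, mul_one]
  calc (Fintype.card ι).choose j ≤ Fintype.card ι ^ j := Nat.choose_le_pow _ _
    _ ≤ _ := Nat.le_mul_of_pos_right _ (Nat.choose_pos (Nat.lt_succ_iff.1 (mem_range.1 hj)))

/-- The value at the full set of a set function depending on at most `D` elements is a fixed
integer combination of its values at sets of size at most `D`. -/
lemma exists_moebius_coefficients [Fintype ι] (D : ℕ) :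
    ∃ c : Finset ι → ℤ, (∀ S, D < #S → c S = 0) ∧
      ∑ S, |c S| ≤ (Fintype.card ι + 1) ^ D * 2 ^ D ∧
      ∀ (g : Finset ι → ℝ) (B : Finset ι), #B ≤ D → (∀ S, g S = g (S ∩ B)) →
        g univ = ∑ S, (c S : ℝ) * g S := by
  refine ⟨fun S => ∑ A with #A ≤ D, if S ⊆ A then (-1) ^ (#A + #S) else 0, fun S hS => ?_, ?_,
    fun g B hB hg => ?_⟩
  · refine sum_eq_zero fun A hA => if_neg fun h => ?_
    have := card_le_card h
    have := (mem_filter.1 hA).2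
    omega
  · calc _ ≤ ∑ S : Finset ι, ∑ A : Finset ι with #A ≤ D, (if S ⊆ A then (1 : ℤ) else 0) := by
          refine sum_le_sum fun S _ => (abs_sum_le_sum_abs _ _).trans (sum_le_sum fun A _ => ?_)
          split_ifs <;> simp
      _ = ∑ A : Finset ι with #A ≤ D, (2 : ℤ) ^ #A := by
          rw [sum_comm]
          refine sum_congr rfl fun A _ => ?_
          have : (univ.filter fun S => S ⊆ A) = A.powerset := by ext; simp
          rw [sum_boole, this, card_powerset]
          norm_cast
      _ ≤ ∑ A : Finset ι with #A ≤ D, (2 : ℤ) ^ D :=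
          sum_le_sum fun A hA => pow_le_pow_right₀ (by norm_num) (mem_filter.1 hA).2
      _ ≤ _ := by
          rw [sum_const, nsmul_eq_mul]
          gcongr
          exact_mod_cast card_filter_card_le D
  · have h1 : g univ = ∑ A with #A ≤ D, moebiusTransform g A := by
      rw [hg, univ_inter, ← sum_moebiusTransform g B]
      refine sum_subset (fun A hA => ?_) fun A _ hA =>
        moebiusTransform_eq_zero hg fun h => hA (mem_powerset.2 h)
      exact mem_filter.2 ⟨mem_univ _, (card_le_card (mem_powerset.1 hA)).trans hB⟩
    rw [h1]
    push_cast
    simp_rw [sum_mul]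
    rw [sum_comm]
    refine sum_congr rfl fun A _ => ?_
    rw [moebiusTransform]
    simp only [ite_mul, zero_mul, ← sum_filter]
    refine sum_congr ?_ fun _ _ => rfl
    ext S; simp

end Moebius

section Reduction

open Finset Equiv

variable {α : Type*}

lemma exists_involutive_mul_eq (π : Perm α) :
    ∃ a b : Perm α, Function.Involutive a ∧ Function.Involutive b ∧ a * b = π := by
  let r : α → α := fun i => (Quotient.mk (Perm.SameCycle.setoid π) i).out
  have hr (i : α) : π.SameCycle (r i) i :=
    Quotient.mk_out (s := Perm.SameCycle.setoid π) i
  have hrpow (i : α) (m : ℤ) : r ((π ^ m) (r i)) = r i := by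
    have h : (Quotient.mk (Perm.SameCycle.setoid π) ((π ^ m) (r i))) = Quotient.mk _ i :=
      Quotient.sound (Perm.SameCycle.trans (Perm.SameCycle.zpow_left (Perm.SameCycle.refl π (r i))) (hr i))
    simp only [r] at h ⊢
    rw [h]
  choose k hk using hr
  let β : α → α := fun i => (π ^ (-k i)) (r i)
  have hβ (i : α) (m : ℤ) : β ((π ^ m) (r i)) = (π ^ (-m)) (r i) := by
    have h1 := hk ((π ^ m) (r i))
    simp only [β]
    rw [hrpow] at h1 ⊢
    rw [← (π ^ (k ((π ^ m) (r i)) + m)).injective.eq_iff, ← Perm.mul_apply, ← zpow_add,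
      ← Perm.mul_apply, ← zpow_add]
    rw [show k ((π ^ m) (r i)) + m + -k ((π ^ m) (r i)) = m by ring,
      show k ((π ^ m) (r i)) + m + -m = k ((π ^ m) (r i)) by ring, h1]
  have hββ : Function.Involutive β := fun i => by
    change β ((π ^ (-k i)) (r i)) = i
    rw [hβ, neg_neg, hk]
  refine ⟨π * hββ.toPerm, hββ.toPerm, fun i => ?_, hββ, ?_⟩
  · change π (β (π (β i))) = i
    have h1 : π (β i) = (π ^ (1 - k i)) (r i) := by
      rw [sub_eq_add_neg, zpow_add, zpow_one]; rfl
    rw [h1, hβ, ← Perm.mul_apply, ← zpow_one_add, show 1 + -(1 - k i) = k i by ring, hk]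
  · ext i
    simp [hββ i]

/-- A representative of the orbit of `i` under the involution `a`. -/
noncomputable def orbitRep (a : α → α) (i : α) : α := (s(i, a i)).out.1

lemma orbitRep_mem (a : α → α) (i : α) : orbitRep a i = i ∨ orbitRep a i = a i :=
  Sym2.mem_iff.1 (Sym2.out_fst_mem s(i, a i))

lemma orbitRep_apply {a : α → α} (ha : Function.Involutive a) (i : α) :
    orbitRep a (a i) = orbitRep a i := by
  rw [orbitRep, ha i, Sym2.eq_swap, orbitRep]

variable [DecidableEq α]

/-- The involution `a` restricted to the orbits with representative in `X`. -/
noncomputable def partialInvolution {a : α → α} (ha : Function.Involutive a) (X : Finset α) :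
    Perm α :=
  Function.Involutive.toPerm (fun i => if orbitRep a i ∈ X then a i else i) fun i => by
    by_cases h : orbitRep a i ∈ X <;> simp [h, orbitRep_apply ha, ha i]

lemma partialInvolution_apply {a : α → α} (ha : Function.Involutive a) (X : Finset α) (i : α) :
    partialInvolution ha X i = if orbitRep a i ∈ X then a i else i := rfl

variable [Fintype α]

lemma card_support_partialInvolution_le {a : α → α} (ha : Function.Involutive a) (X : Finset α) :
    #(partialInvolution ha X).support ≤ 2 * #X := by
  have : (partialInvolution ha X).support ⊆ X ∪ X.image a := fun i hi => by
    rw [Perm.mem_support, partialInvolution_apply] at hi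
    have hX : orbitRep a i ∈ X := by by_contra h; simp [h] at hi
    rcases orbitRep_mem a i with h | h
    · exact mem_union_left _ (h ▸ hX)
    · exact mem_union_right _ (mem_image.2 ⟨_, hX, by rw [h, ha i]⟩)
  calc _ ≤ _ := card_le_card this
    _ ≤ #X + #(X.image a) := card_union_le _ _
    _ ≤ 2 * #X := by have := card_image_le (s := X) (f := a); omega

/-- On functions of the values at `t` points, evaluation at any permutation is an integer
combination of evaluations at permutations of small support. -/
lemma exists_reduction (t : ℕ) (x : Perm α) :
    ∃ c : Perm α → ℤ, (∀ g, c g ≠ 0 → #g.support ≤ 6 * t) ∧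
      ∑ g, |c g| ≤ (2 * Fintype.card α + 1) ^ (3 * t) * 2 ^ (3 * t) ∧
      ∀ (h : (α → α) → ℝ) (Q : Finset α), #Q ≤ t → DependsOn h Q →
        h x = ∑ g, (c g : ℝ) * h g := by
  obtain ⟨a, b, ha, hb, hab⟩ := exists_involutive_mul_eq x
  obtain ⟨c, hc0, hc1, hc⟩ := exists_moebius_coefficients (ι := α ⊕ α) (3 * t)
  let w (S : Finset (α ⊕ α)) : Perm α :=
    partialInvolution ha S.toLeft * partialInvolution hb S.toRight
  refine ⟨fun g => ∑ S with w S = g, c S, fun g hg => ?_, ?_, fun h Q hQ hh => ?_⟩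
  · obtain ⟨S, hS, hcS⟩ := exists_ne_zero_of_sum_ne_zero hg
    have h1 : #S ≤ 3 * t := not_lt.1 fun h => hcS (hc0 S h)
    rw [← (mem_filter.1 hS).2]
    have h2 := card_le_card (Perm.support_mul_le (partialInvolution ha S.toLeft)
      (partialInvolution hb S.toRight))
    have h3 := card_union_le (partialInvolution ha S.toLeft).support
      (partialInvolution hb S.toRight).support
    have h4 := card_support_partialInvolution_le ha S.toLeft
    have h5 := card_support_partialInvolution_le hb S.toRight
    have h6 := card_toLeft_add_card_toRight (u := S)
    simp only [sup_eq_union] at h2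
    simp only [w]
    omega
  · calc _ ≤ ∑ g, ∑ S with w S = g, |c S| := sum_le_sum fun g _ => abs_sum_le_sum_abs _ _
      _ = ∑ S, |c S| := sum_fiberwise _ _ _
      _ ≤ _ := by simpa [two_mul] using hc1
  · have hx : x = w univ := by
      ext i
      simp [w, partialInvolution_apply, ← hab]
    let B : Finset (α ⊕ α) :=
      (Q.image (orbitRep a) ∪ Q.image fun i => orbitRep a (b i)).disjSum (Q.image (orbitRep b))
    have hB : #B ≤ 3 * t := by
      have h1 := card_image_le (s := Q) (f := orbitRep a)
      have h2 := card_image_le (s := Q) (f := fun i => orbitRep a (b i))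
      have h3 := card_image_le (s := Q) (f := orbitRep b)
      have h4 := card_union_le (Q.image (orbitRep a)) (Q.image fun i => orbitRep a (b i))
      rw [card_disjSum]
      omega
    have key := hc (fun S => h (w S)) B hB fun S => hh fun i hi => by
      have h1 : orbitRep a i ∈ Q.image (orbitRep a) := mem_image_of_mem _ hi
      have h2 : orbitRep a (b i) ∈ Q.image fun i => orbitRep a (b i) :=
        mem_image_of_mem (fun i => orbitRep a (b i)) hi
      have h3 : orbitRep b i ∈ Q.image (orbitRep b) := mem_image_of_mem _ hi
      simp only [w, Perm.mul_apply, partialInvolution_apply, mem_toLeft, mem_toRight, mem_inter, B,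
        inl_mem_disjSum, inr_mem_disjSum, mem_union, h3, and_true]
      by_cases hbi : Sum.inr (orbitRep b i) ∈ S <;> simp [hbi, h1, h2]
    rw [hx, key, ← sum_fiberwise _ w]
    refine sum_congr rfl fun g _ => ?_
    push_cast
    rw [sum_mul]
    exact sum_congr rfl fun S hS => by rw [(mem_filter.1 hS).2]

lemma card_filter_card_support_le [Nonempty α] (k : ℕ) :
    #(univ.filter fun g : Perm α => #g.support ≤ k) ≤
      (Fintype.card α + 1) ^ k * Fintype.card α ^ k := by
  have hsub : (univ.filter fun g : Perm α => #g.support ≤ k) ⊆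
      (univ.filter fun A : Finset α => #A ≤ k).biUnion fun A =>
        univ.filter fun g => g.support = A := fun g hg => by
    simpa using hg
  refine (card_le_card hsub).trans ((card_biUnion_le_card_mul _ _ (Fintype.card α ^ k)
    fun A hA => ?_).trans (Nat.mul_le_mul_right _ (card_filter_card_le k)))
  have hA : #A ≤ k := (mem_filter.1 hA).2
  calc #(univ.filter fun g : Perm α => g.support = A) ≤ #(univ : Finset (A → α)) := by
        refine card_le_card_of_injOn (fun g i => g i) (fun _ _ => mem_univ _) fun g hg g' hg' e => ?_
        ext i
        by_cases hi : i ∈ A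
        · exact congrFun e ⟨i, hi⟩
        · have h1 : g.support = A := by simpa using hg
          have h2 : g'.support = A := by simpa using hg'
          rw [Perm.notMem_support.1 (h1 ▸ hi), Perm.notMem_support.1 (h2 ▸ hi)]
    _ = Fintype.card α ^ #A := by simp
    _ ≤ Fintype.card α ^ k :=
      Nat.pow_le_pow_right Fintype.card_pos hA

end Reduction

section Juntas

open Finset Equiv

variable {α : Type*} [DecidableEq α]

/-- The span of the functions of a permutation depending on its values on `P` and on at most `d`
further points. -/
def juntaSpace (P : Finset α) (d : ℕ) : Submodule ℝ (Perm α → ℝ) :=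
  Submodule.span ℝ {f | ∃ (h : (α → α) → ℝ) (Q : Finset α),
    #Q ≤ d ∧ DependsOn h ↑(P ∪ Q) ∧ f = fun π : Perm α => h π}

lemma mem_juntaSpace {P Q : Finset α} {d : ℕ} (hQ : #Q ≤ d) {h : (α → α) → ℝ}
    (hh : DependsOn h ↑(P ∪ Q)) : (fun π : Perm α => h π) ∈ juntaSpace P d :=
  Submodule.subset_span ⟨h, Q, hQ, hh, rfl⟩

lemma juntaSpace_insert_insert_le (P : Finset α) (d : ℕ) (i j : α) :
    juntaSpace (insert i (insert j P)) d ≤ juntaSpace P (d + 2) := by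
  refine Submodule.span_le.2 ?_
  rintro _ ⟨h, Q, hQ, hh, rfl⟩
  refine mem_juntaSpace (Q := insert i (insert j Q)) ?_ ?_
  · have h1 := card_insert_le i (insert j Q)
    have h2 := card_insert_le j Q
    omega
  · convert hh using 2
    ext x
    simp only [mem_union, mem_insert]
    tauto

lemma mul_right_mem_juntaSpace {P : Finset α} {d : ℕ} {f : Perm α → ℝ} (hf : f ∈ juntaSpace P d)
    {σ : Perm α} (hσ : ∀ i ∈ P, σ i = i) : (fun π => f (π * σ)) ∈ juntaSpace P d := by
  suffices juntaSpace P d ≤ (juntaSpace P d).comap (LinearMap.funLeft ℝ ℝ fun π => π * σ) from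
    this hf
  refine Submodule.span_le.2 ?_
  rintro _ ⟨h, Q, hQ, hh, rfl⟩
  refine mem_juntaSpace (Q := Q.image σ) (h := fun u => h (u ∘ σ)) (card_image_le.trans hQ)
    fun u v huv => hh fun i hi => huv (σ i) ?_
  rcases mem_union.1 hi with hi | hi
  · exact mem_union_left _ ((hσ i hi).symm ▸ hi)
  · exact mem_union_right _ (mem_image_of_mem _ hi)

lemma mul_left_mem_juntaSpace {P : Finset α} {d : ℕ} {f : Perm α → ℝ} (hf : f ∈ juntaSpace P d)
    (σ : Perm α) : (fun π => f (σ * π)) ∈ juntaSpace P d := by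
  suffices juntaSpace P d ≤ (juntaSpace P d).comap (LinearMap.funLeft ℝ ℝ fun π => σ * π) from
    this hf
  refine Submodule.span_le.2 ?_
  rintro _ ⟨h, Q, hQ, hh, rfl⟩
  exact mem_juntaSpace (Q := Q) (h := fun u => h (σ ∘ u)) hQ
    fun u v huv => hh fun i hi => congrArg σ (huv i hi)

variable [Fintype α]

/-- A function that is almost invariant under permutations fixing `P` depends almost only on
the values on `P`. -/
lemma mem_juntaSpace_of_sub_swap_mem {P : Finset α} {d : ℕ} {f : Perm α → ℝ}
    (hf : ∀ i ∉ P, ∀ j ∉ P, i ≠ j → (fun π => f π - f (π * swap i j)) ∈ juntaSpace P d) :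
    f ∈ juntaSpace P d := by
  have hfix (τ : Perm {i // i ∉ P}) : ∀ i ∈ P, Perm.ofSubtype τ i = i := fun i hi =>
    Perm.ofSubtype_apply_of_not_mem τ (not_not.2 hi)
  have h1 (τ : Perm {i // i ∉ P}) :
      (fun π => f π - f (π * Perm.ofSubtype τ)) ∈ juntaSpace P d := by
    induction τ using Perm.swap_induction_on with
    | one =>
      convert (juntaSpace P d).zero_mem using 1
      ext π
      simp
    | swap_mul τ x y hxy ih =>
      have h2 := hf x x.2 y y.2 fun h => hxy (Subtype.ext h)
      have h3 : ∀ i ∈ P, swap x.1 y.1 i = i := fun i hi =>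
        swap_apply_of_ne_of_ne (fun h => x.2 (h ▸ hi)) fun h => y.2 (h ▸ hi)
      convert add_mem h2 (mul_right_mem_juntaSpace ih h3) using 1
      ext π
      simp [mul_assoc, Perm.ofSubtype_swap_eq]
  let avg : Perm α → ℝ := fun π => ∑ τ : Perm {i // i ∉ P}, f (π * Perm.ofSubtype τ)
  have havg {π π' : Perm α} (h : ∀ i ∈ P, π i = π' i) : avg π = avg π' := by
    have h2 : ∀ i, (π⁻¹ * π') i ≠ i → i ∉ P := fun i hi hP => hi (by simp [← h i hP])
    have h3 : ∀ i, (π⁻¹ * π') i ∉ P ↔ i ∉ P := fun i => by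
      refine not_congr ⟨fun hi => ?_, fun hi => ?_⟩
      · have h3 : π' ((π⁻¹ * π') i) = π' i := by rw [← h _ hi]; simp
        rwa [π'.injective h3] at hi
      · have : (π⁻¹ * π') i = i := by by_contra hc; exact h2 i hc hi
        rwa [this]
    have h4 := Perm.ofSubtype_subtypePerm h3 h2
    simp only [avg]
    refine Fintype.sum_equiv (Equiv.mulLeft (Perm.subtypePerm (π⁻¹ * π') h3)⁻¹) _ _ fun τ => ?_
    rw [Equiv.coe_mulLeft, map_mul, map_inv, h4]
    congr 1
    group
  have h5 : avg ∈ juntaSpace P d := by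
    classical
    let F : (Perm α → Prop) → ℝ := fun p => if hp : ∃ π, p π then avg hp.choose else 0
    have e : avg = fun π : Perm α => F fun π' => ∀ i ∈ P, π' i = π i := by
      ext π
      have hp : ∃ π' : Perm α, ∀ i ∈ P, π' i = π i := ⟨π, fun _ _ => rfl⟩
      simp only [F]
      rw [dif_pos hp]
      exact (havg hp.choose_spec).symm
    rw [e]
    refine mem_juntaSpace (Q := ∅) (h := fun u => F fun π' => ∀ i ∈ P, π' i = u i) (by simp)
      fun u v huv => congrArg F ?_
    ext π
    refine forall₂_congr fun i hi => ?_
    rw [huv i (by simpa using hi)]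
  have h6 : f = (Fintype.card (Perm {i // i ∉ P}) : ℝ)⁻¹ •
      (∑ τ : Perm {i // i ∉ P}, (fun π => f π - f (π * Perm.ofSubtype τ)) + avg) := by
    ext π
    have : (Fintype.card (Perm {i // i ∉ P}) : ℝ) ≠ 0 := by exact_mod_cast Fintype.card_ne_zero
    simp only [Pi.smul_apply, Pi.add_apply, Finset.sum_apply, sum_sub_distrib, sum_const, card_univ,
      nsmul_eq_mul, avg, sub_add_cancel, smul_eq_mul]
    field_simp
  rw [h6]
  exact Submodule.smul_mem _ _ (add_mem (sum_mem fun τ _ => h1 τ) h5)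

/-- `f` is annihilated by any `s` successive differences along disjoint transpositions of points
outside `P`. -/
def IsAnnihilated : ℕ → Finset α → (Perm α → ℝ) → Prop
  | 0, _, f => f = 0
  | s + 1, P, f => ∀ i ∉ P, ∀ j ∉ P, i ≠ j →
      IsAnnihilated s (insert i (insert j P)) fun π => f π - f (π * swap i j)

lemma IsAnnihilated.mem_juntaSpace {s : ℕ} {P : Finset α} {f : Perm α → ℝ}
    (hf : IsAnnihilated (s + 1) P f) : f ∈ juntaSpace P (2 * s) := by
  induction s generalizing P f with
  | zero =>
    refine mem_juntaSpace_of_sub_swap_mem fun i hi j hj hij => ?_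
    rw [show (fun π => f π - f (π * swap i j)) = 0 from hf i hi j hj hij]
    exact zero_mem _
  | succ s ih =>
    exact mem_juntaSpace_of_sub_swap_mem fun i hi j hj hij =>
      juntaSpace_insert_insert_le P _ i j (ih (hf i hi j hj hij))

/-- The functions satisfying all integer relations of `ℓ¹`-norm at most `L` which hold for functions
of the values at `t` points. -/
def juntaClosure (α : Type*) [DecidableEq α] [Fintype α] (t L : ℕ) :
    Submodule ℝ (Perm α → ℝ) where
  carrier := {f | ∀ ρ : Perm α → ℤ, ∑ x, |ρ x| ≤ L →
    (∀ f ∈ juntaSpace (∅ : Finset α) t, ∑ x, (ρ x : ℝ) * f x = 0) → ∑ x, (ρ x : ℝ) * f x = 0}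
  add_mem' hf hg ρ hL hρ := by simp [mul_add, sum_add_distrib, hf ρ hL hρ, hg ρ hL hρ]
  zero_mem' ρ _ _ := by simp
  smul_mem' c f hf ρ hL hρ := by
    simp [mul_left_comm _ c, ← mul_sum, hf ρ hL hρ]

/-- A signed measure on the permutations of `P` which is short and annihilates functions of the
values on a set having fewer than `k` points in `P`. -/
structure IsAlternating (k : ℕ) (P : Finset α) (ρ : Perm α → ℤ) : Prop where
  norm_le : ∑ x, |ρ x| ≤ 2 ^ k
  apply_eq : ∀ x, ρ x ≠ 0 → ∀ i ∉ P, x i = i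
  sum_eq_zero : ∀ (h : (α → α) → ℝ) (Q : Finset α), DependsOn h Q → #(Q ∩ P) < k →
    ∀ π : Perm α, ∑ x, (ρ x : ℝ) * h ⇑(π * x) = 0

lemma IsAlternating.insert_insert {k : ℕ} {P : Finset α} {ρ : Perm α → ℤ}
    (hρ : IsAlternating k P ρ) {i j : α} (hi : i ∉ P) (hj : j ∉ P) :
    IsAlternating (k + 1) (insert i (insert j P)) fun x => ρ x - ρ (swap i j * x) where
  norm_le := by
    calc _ ≤ ∑ x, (|ρ x| + |ρ (swap i j * x)|) := sum_le_sum fun x _ => abs_sub _ _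
      _ = ∑ x, |ρ x| + ∑ x, |ρ x| := by
        rw [sum_add_distrib, add_right_inj]
        exact Fintype.sum_equiv (Equiv.mulLeft (swap i j)) _ _ fun _ => rfl
      _ ≤ 2 ^ k + 2 ^ k := add_le_add hρ.norm_le hρ.norm_le
      _ = _ := by ring
  apply_eq x hx l hl := by
    simp only [mem_insert, not_or] at hl
    by_cases h : ρ x = 0
    · have h1 := hρ.apply_eq (swap i j * x) (fun h2 => hx (by simp [h, h2])) l hl.2.2
      rw [Perm.mul_apply, swap_apply_eq_iff, swap_apply_of_ne_of_ne hl.1 hl.2.1] at h1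
      exact h1
    · exact hρ.apply_eq x h l hl.2.2
  sum_eq_zero h Q hQ hcard π := by
    have h1 : ∑ x, (ρ (swap i j * x) : ℝ) * h ⇑(π * x) =
        ∑ x, (ρ x : ℝ) * h ⇑(π * swap i j * x) := by
      refine Fintype.sum_equiv (Equiv.mulLeft (swap i j)) _ _ fun x => ?_
      simp [mul_assoc]
    simp only [Int.cast_sub, sub_mul, sum_sub_distrib]
    rw [h1, sub_eq_zero]
    by_cases hij : i ∈ Q ∨ j ∈ Q
    · have hlt : #(Q ∩ P) < #(Q ∩ insert i (insert j P)) := by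
        refine card_lt_card ⟨inter_subset_inter_left ?_, fun hsub => ?_⟩
        · exact (subset_insert j P).trans (subset_insert i _)
        · rcases hij with hiQ | hjQ
          · exact hi (mem_inter.1 (hsub (mem_inter.2 ⟨hiQ, mem_insert_self _ _⟩))).2
          · exact hj (mem_inter.1 (hsub (mem_inter.2
              ⟨hjQ, mem_insert_of_mem (mem_insert_self _ _)⟩))).2
      rw [hρ.sum_eq_zero h Q hQ (by omega), hρ.sum_eq_zero h Q hQ (by omega)]
    · rw [not_or] at hij
      refine sum_congr rfl fun x _ => ?_
      by_cases hx : ρ x = 0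
      · simp [hx]
      congr 1
      refine hQ fun l hl => ?_
      have hli : l ≠ i := fun e => hij.1 (e ▸ hl)
      have hlj : l ≠ j := fun e => hij.2 (e ▸ hl)
      have h2 : x l ≠ i := fun e => hli (x.injective (by rw [e, hρ.apply_eq x hx i hi]))
      have h3 : x l ≠ j := fun e => hlj (x.injective (by rw [e, hρ.apply_eq x hx j hj]))
      simp [swap_apply_of_ne_of_ne h2 h3]

lemma isAnnihilated_of_mem_juntaClosure {t L : ℕ} (hL : 2 ^ (t + 1) ≤ L) {f : Perm α → ℝ}
    (hf : f ∈ juntaClosure α t L) (s k : ℕ) (hsk : k + s = t + 1) {P : Finset α}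
    {ρ : Perm α → ℤ} (hρ : IsAlternating k P ρ) :
    IsAnnihilated s P fun π => ∑ x, (ρ x : ℝ) * f (π * x) := by
  induction s generalizing k P ρ with
  | zero =>
    obtain rfl : k = t + 1 := hsk
    ext π
    have htrans (g : Perm α → ℝ) :
        ∑ x, (ρ (π⁻¹ * x) : ℝ) * g x = ∑ x, (ρ x : ℝ) * g (π * x) :=
      Fintype.sum_equiv (Equiv.mulLeft π⁻¹) _ _ fun x => by simp
    have h1 := hf (fun x => ρ (π⁻¹ * x)) ?_ fun g hg => ?_
    · rw [htrans] at h1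
      exact h1
    · calc _ = ∑ x, |ρ x| := Fintype.sum_equiv (Equiv.mulLeft π⁻¹) _ _ fun x => rfl
        _ ≤ 2 ^ (t + 1) := hρ.norm_le
        _ ≤ L := by exact_mod_cast hL
    · rw [htrans]
      induction hg using Submodule.span_induction with
      | mem g hg =>
        obtain ⟨h, Q, hQ, hh, rfl⟩ := hg
        rw [empty_union] at hh
        exact hρ.sum_eq_zero h Q hh
          (Nat.lt_succ_of_le ((card_le_card inter_subset_left).trans hQ)) π
      | zero => simp
      | add g g' _ _ h1 h2 => simp [mul_add, sum_add_distrib, h1, h2]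
      | smul c g _ h1 => simp [mul_left_comm _ c, ← mul_sum, h1]
  | succ s ih =>
    intro i hi j hj hij
    convert ih (k + 1) (by omega) (hρ.insert_insert hi hj) using 1
    ext π
    push_cast
    simp only [sub_mul, sum_sub_distrib]
    congr 1
    refine Fintype.sum_equiv (Equiv.mulLeft (swap i j)) _ _ fun x => ?_
    simp [mul_assoc]

lemma juntaClosure_le_juntaSpace {t L : ℕ} (hL : 2 ^ (t + 1) ≤ L) :
    juntaClosure α t L ≤ juntaSpace ∅ (2 * t) := fun f hf => by
  have h0 : IsAlternating 0 (∅ : Finset α) fun x => if x = 1 then 1 else 0 :=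
    { norm_le := by simp [apply_ite abs]
      apply_eq := fun x hx i _ => by
        have : x = 1 := by by_contra h; simp [h] at hx
        simp [this]
      sum_eq_zero := fun _ _ _ h => absurd h (Nat.not_lt_zero _) }
  have := isAnnihilated_of_mem_juntaClosure hL hf (t + 1) 0 (by omega) h0
  simpa using this.mem_juntaSpace

end Juntas

section Divisibility

open Finset Equiv

lemma exists_perm_trans_eq {β γ : Type*} [Finite γ] (E K : β ↪ γ) :
    ∃ τ : Perm γ, E.trans τ.toEmbedding = K := by
  classical
  have := Fintype.ofFinite γ
  let e : {x // x ∈ Set.range E} ≃ {x // x ∈ Set.range K} :=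
    (Equiv.ofInjective E E.injective).symm.trans (Equiv.ofInjective K K.injective)
  refine ⟨e.extendSubtype, Function.Embedding.ext fun i => ?_⟩
  have h := e.extendSubtype_apply_of_mem (E i) ⟨i, rfl⟩
  have h2 : (⟨E i, i, rfl⟩ : {x // x ∈ Set.range E}) = Equiv.ofInjective E E.injective i := rfl
  rw [h2] at h
  simpa [e] using h

/-- Composing a uniform permutation with an embedding gives a uniform embedding. -/
lemma descFactorial_mul_sum_perm {β γ : Type*} [Fintype β] [Fintype γ] [DecidableEq γ]
    [Fintype (β ↪ γ)] (E : β ↪ γ) (F : (β ↪ γ) → ℝ) :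
    ((Fintype.card γ).descFactorial (Fintype.card β) : ℝ) *
        ∑ σ : Perm γ, F (E.trans σ.toEmbedding) =
      ((Fintype.card γ).factorial : ℝ) * ∑ K, F K := by
  have h1 (K : β ↪ γ) : ∑ σ : Perm γ, F (K.trans σ.toEmbedding) =
      ∑ σ : Perm γ, F (E.trans σ.toEmbedding) := by
    obtain ⟨τ, rfl⟩ := exists_perm_trans_eq E K
    exact Fintype.sum_equiv (Equiv.mulRight τ) _ _ fun σ => rfl
  have h2 (σ : Perm γ) : ∑ K : β ↪ γ, F (K.trans σ.toEmbedding) = ∑ K, F K :=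
    Fintype.sum_equiv (Equiv.embeddingCongr (Equiv.refl β) σ) _ _ fun K => rfl
  have h3 := sum_comm (s := univ) (t := univ)
    (f := fun (K : β ↪ γ) (σ : Perm γ) => F (K.trans σ.toEmbedding))
  rw [sum_congr rfl fun K _ => h1 K, sum_congr rfl fun σ _ => h2 σ] at h3
  simpa [Fintype.card_perm, Fintype.card_embedding_eq] using h3

variable {α : Type*} [DecidableEq α]

/-- The function of `S` whose sum over `K` is the average over embeddings `Q ↪ S`. -/
noncomputable def embeddingTerm (h : (α → α) → ℝ) (Q : Finset α) (K : Q ↪ α) (S : Finset α) : ℝ :=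
  if ∀ i, K i ∈ S then h fun i => if hi : i ∈ Q then if i ∈ S then K ⟨i, hi⟩ else i else i else 0

lemma embeddingTerm_inter (h : (α → α) → ℝ) (Q : Finset α) (K : Q ↪ α) (S : Finset α) :
    embeddingTerm h Q K S = embeddingTerm h Q K (S ∩ (Q ∪ univ.map K)) := by
  have h1 (i : Q) : K i ∈ S ∩ (Q ∪ univ.map K) ↔ K i ∈ S := by simp
  simp only [embeddingTerm, h1]
  congr 2
  ext i
  by_cases hi : i ∈ Q <;> simp [hi]

lemma exists_embedding_fixing {Q S : Finset α} (h : #Q ≤ #S) :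
    ∃ E : Q ↪ S, ∀ i (hi : i ∈ Q), i ∈ S → (E ⟨i, hi⟩ : α) = i := by
  have h1 : #(Q \ S) ≤ #(S \ Q) := by
    rw [← card_sdiff_add_card_inter Q S, ← card_sdiff_add_card_inter S Q, inter_comm] at h
    omega
  obtain ⟨e⟩ := Function.Embedding.nonempty_of_card_le
    (α := ↥(Q \ S)) (β := ↥(S \ Q)) (by simpa using h1)
  refine ⟨⟨fun i => if hi : i.1 ∈ S then ⟨i, hi⟩ else
    ⟨e ⟨i, mem_sdiff.2 ⟨i.2, hi⟩⟩, (mem_sdiff.1 (e _).2).1⟩, fun i j hij => ?_⟩, fun i hi hS => ?_⟩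
  · have he (x) : (e x).1 ∉ Q := (mem_sdiff.1 (e x).2).2
    by_cases hi : i.1 ∈ S <;> by_cases hj : j.1 ∈ S <;> simp only [hi, hj, dite_true, dite_false,
      Subtype.mk.injEq] at hij
    · exact Subtype.ext hij
    · exact absurd i.2 (hij ▸ he _)
    · exact absurd j.2 (hij ▸ he _)
    · exact Subtype.ext (congrArg (fun x => x.1) (e.injective (Subtype.ext hij)))
  · exact congrArg Subtype.val (dif_pos hS)

variable [Fintype α]

lemma descFactorial_mul_sum_ofSubtype {h : (α → α) → ℝ} {Q : Finset α} (hh : DependsOn h Q)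
    (S : Finset α) :
    ((#S).descFactorial #Q : ℝ) * ∑ σ : Perm S, h (Perm.ofSubtype σ) =
      ((#S).factorial : ℝ) * ∑ K : Q ↪ α, embeddingTerm h Q K S := by
  have hsum : ∑ K : Q ↪ α, embeddingTerm h Q K S =
      ∑ K : Q ↪ S, embeddingTerm h Q (K.trans (Function.Embedding.subtype _)) S := by
    symm
    refine sum_of_injOn (fun K => K.trans (Function.Embedding.subtype _)) ?_ ?_ ?_ ?_
    · intro K _ K' _ e
      ext i
      exact DFunLike.congr_fun e i
    · simp
    · intro K _ hK
      refine if_neg fun hS => hK ⟨K.codRestrict S hS, by simp, ?_⟩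
      ext i
      rfl
    · simp
  rw [hsum]
  rcases lt_or_ge #S #Q with hlt | hge
  · rw [Nat.descFactorial_of_lt hlt]
    have : IsEmpty (Q ↪ S) := ⟨fun K => by
      have := Fintype.card_le_of_embedding K
      simp at this
      omega⟩
    simp
  · obtain ⟨E, hE⟩ := exists_embedding_fixing hge
    have key := descFactorial_mul_sum_perm E
      fun K => embeddingTerm h Q (K.trans (Function.Embedding.subtype _)) S
    simp only [Fintype.card_coe] at key
    rw [← key]
    congr 1
    refine sum_congr rfl fun σ _ => ?_
    rw [embeddingTerm, if_pos fun i => by simp]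
    refine hh fun i hi => ?_
    have hi : i ∈ Q := hi
    by_cases hS : i ∈ S
    · have h1 : E ⟨i, hi⟩ = ⟨i, hS⟩ := Subtype.ext (hE i hi hS)
      simp [hi, hS, h1, Perm.ofSubtype_apply_of_mem]
    · simp [hi, hS, Perm.ofSubtype_apply_of_not_mem]

/-- An integral signed measure of mass `(2d)! n(n-1)⋯(n-d+1)` which is uniform from the viewpoint of
functions of the values at `d` points. -/
lemma exists_uniform_measure {d : ℕ} (hd : d ≤ Fintype.card α) :
    ∃ k : Perm α → ℤ, ∀ f ∈ juntaSpace (∅ : Finset α) d, ∑ x, (k x : ℝ) * f x =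
      (((2 * d).factorial * (Fintype.card α).descFactorial d : ℕ) : ℝ) /
        Fintype.card (Perm α) * ∑ x, f x := by
  obtain ⟨c, hc0, -, hc⟩ := exists_moebius_coefficients (ι := α) (2 * d)
  refine ⟨fun x => ∑ S, c S * ((2 * d).factorial / (#S).factorial * (#S).descFactorial d : ℕ) *
    #{σ : Perm S | Perm.ofSubtype σ = x}, fun f hf => ?_⟩
  induction hf using Submodule.span_induction with
  | zero => simp
  | add g g' _ _ h1 h2 => simp only [Pi.add_apply, mul_add, sum_add_distrib, h1, h2]
  | smul a g _ h1 => simp only [Pi.smul_apply, smul_eq_mul, mul_left_comm _ a, ← mul_sum, h1]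
  | mem f hf =>
    obtain ⟨h, Q', hQ', hh', rfl⟩ := hf
    rw [empty_union] at hh'
    obtain ⟨Q, hQQ, hQ⟩ := exists_superset_card_eq hQ' (by simpa using hd)
    have hh : DependsOn h Q := fun u v huv => hh' fun i hi => huv i (hQQ hi)
    have h1 (S : Finset α) : ∑ x : Perm α, (#{σ : Perm S | Perm.ofSubtype σ = x} : ℝ) * h x =
        ∑ σ : Perm S, h (Perm.ofSubtype σ) := by
      rw [← sum_fiberwise univ (fun σ : Perm S => Perm.ofSubtype σ)]
      refine sum_congr rfl fun x _ => ?_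
      rw [← nsmul_eq_mul, ← sum_const]
      exact sum_congr rfl fun σ hσ => by rw [(mem_filter.1 hσ).2]
    have h2 (S : Finset α) :
        (c S : ℝ) * ((2 * d).factorial / (#S).factorial * (#S).descFactorial d : ℕ) *
          ∑ σ : Perm S, h (Perm.ofSubtype σ) =
        (2 * d).factorial * (c S * ∑ K : Q ↪ α, embeddingTerm h Q K S) := by
      rcases lt_or_ge (2 * d) #S with hlt | hge
      · simp [hc0 S hlt]
      · have h3 := descFactorial_mul_sum_ofSubtype hh S
        have h4 : ((#S).factorial : ℝ) ≠ 0 := by exact_mod_cast Nat.factorial_ne_zero _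
        rw [hQ] at h3
        push_cast
        rw [Nat.cast_div (Nat.factorial_dvd_factorial hge) h4]
        field_simp
        linear_combination (c S : ℝ) * h3
    have h3 : ∑ σ : Perm (univ : Finset α), h (Perm.ofSubtype σ) = ∑ x : Perm α, h x := by
      refine Function.Bijective.sum_comp (e := Perm.ofSubtype)
        ((Fintype.bijective_iff_injective_and_card _).2 ⟨Perm.ofSubtype_injective, ?_⟩)
        (fun x => h x)
      simp [Fintype.card_perm]
    have h4 : ∑ K : Q ↪ α, embeddingTerm h Q K univ =
        ∑ S, (c S : ℝ) * ∑ K : Q ↪ α, embeddingTerm h Q K S := by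
      simp_rw [mul_sum]
      rw [sum_comm]
      refine sum_congr rfl fun K _ => hc _ (Q ∪ univ.map K) ?_ (embeddingTerm_inter h Q K)
      refine (card_union_le _ _).trans ?_
      simp [hQ, two_mul]
    have h5 := descFactorial_mul_sum_ofSubtype hh univ
    rw [h3, hQ, card_univ] at h5
    have h6 : ((Fintype.card α).factorial : ℝ) ≠ 0 := by exact_mod_cast Nat.factorial_ne_zero _
    calc _ = ∑ S, ∑ x : Perm α, (c S : ℝ) *
          ((2 * d).factorial / (#S).factorial * (#S).descFactorial d : ℕ) *
            ((#{σ : Perm S | Perm.ofSubtype σ = x} : ℝ) * h x) := by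
          rw [sum_comm]
          refine sum_congr rfl fun x _ => ?_
          rw [Int.cast_sum, sum_mul]
          refine sum_congr rfl fun S _ => ?_
          rw [Int.cast_mul, Int.cast_mul, Int.cast_natCast, Int.cast_natCast, mul_assoc]
      _ = (2 * d).factorial * ∑ K : Q ↪ α, embeddingTerm h Q K univ := by
          rw [h4, mul_sum]
          refine sum_congr rfl fun S _ => ?_
          rw [← mul_sum, h1, h2]
      _ = _ := by
          rw [Fintype.card_perm]
          push_cast
          field_simp
          linear_combination -h5

end Divisibility

section Presentation

open Finset Equiv

lemma juntaSpace_le_juntaClosure {α : Type*} [DecidableEq α] [Fintype α] (t L : ℕ) :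
    juntaSpace ∅ t ≤ juntaClosure α t L := fun f hf _ _ hρ => hρ f hf

/-- Sparse-support permutations present the functions of the values at `t` points. -/
lemma exists_isShortlyPresented {n t : ℕ} (hn : 4 ≤ n) (ht : 1 ≤ t) :
    ∃ (G : Finset (Perm (Fin n))) (red : Perm (Fin n) → Perm (Fin n) → ℤ)
      (R : Set (Perm (Fin n) → ℤ)),
      IsShortlyPresented (juntaClosure (Fin n) t (n ^ (18 * t))) G red R (n ^ (18 * t)) := by
  have : Nonempty (Fin n) := ⟨⟨0, by omega⟩⟩
  choose c hc0 hc1 hc using exists_reduction (α := Fin n) t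
  simp only [Fintype.card_fin] at hc1
  let G : Finset (Perm (Fin n)) := {g | #g.support ≤ 6 * t}
  let red : Perm (Fin n) → Perm (Fin n) → ℤ :=
    fun x g => if x ∈ G then if x = g then 1 else 0 else c x g
  have hpow {k : ℕ} (hk : k ≤ 18) : n ^ (k * t) ≤ n ^ (18 * t) :=
    Nat.pow_le_pow_right (by omega) (Nat.mul_le_mul_right t hk)
  have hc2 (x) : ∑ g, |c x g| ≤ (n ^ (9 * t) : ℕ) := by
    refine (hc1 x).trans ?_
    norm_cast
    calc (2 * n + 1) ^ (3 * t) * 2 ^ (3 * t) ≤ (n ^ 2) ^ (3 * t) * n ^ (3 * t) :=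
          Nat.mul_le_mul (Nat.pow_le_pow_left (by nlinarith) _)
            (Nat.pow_le_pow_left (by omega) _)
      _ = n ^ (9 * t) := by rw [← pow_mul, ← pow_add]; congr 1; ring
  have hcG (x : Perm (Fin n)) (F : ℤ → Perm (Fin n) → ℝ) (hF : ∀ g, F 0 g = 0) :
      ∑ g ∈ G, F (c x g) g = ∑ g, F (c x g) g := by
    refine sum_subset (subset_univ _) fun g _ hg => ?_
    have : c x g = 0 := by
      by_contra h
      exact hg (mem_filter.2 ⟨mem_univ _, hc0 x g h⟩)
    rw [this, hF]
  have h9 : 1 + n ^ (9 * t) ≤ n ^ (18 * t) := by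
    have h1 : n ^ (18 * t) = n ^ (9 * t) * n ^ (9 * t) := by rw [← pow_add]; congr 1; ring
    have h2 : n ≤ n ^ (9 * t) := Nat.le_self_pow (by omega) n
    nlinarith
  refine ⟨G, red, {ρ | ∑ x, |ρ x| ≤ (n ^ (18 * t) : ℕ) ∧
    ∀ f ∈ juntaSpace (∅ : Finset (Fin n)) t, ∑ x, (ρ x : ℝ) * f x = 0}, ?_⟩
  refine
    { two_le := ?_, one_mem := ?_, left_inv := ?_, mem_of_rel := ?_, rel := ?_, rel_norm_le := ?_,
      card_le := ?_, red_norm_le := ?_, red_self := ?_, eval_eq := ?_ }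
  · exact (show 2 ≤ n by omega).trans (Nat.le_self_pow (by omega) n)
  · exact juntaSpace_le_juntaClosure _ _
      (mem_juntaSpace (Q := ∅) (h := fun _ => 1) (by simp) fun _ _ _ => rfl)
  · intro f hf x ρ hL hρ
    have htrans (g : Perm (Fin n) → ℝ) :
        ∑ y, (ρ (x⁻¹ * y) : ℝ) * g y = ∑ y, (ρ y : ℝ) * g (x * y) :=
      Fintype.sum_equiv (Equiv.mulLeft x⁻¹) _ _ fun y => by simp
    rw [← htrans]
    refine hf _ ?_ fun g hg => ?_
    · exact (Fintype.sum_equiv (Equiv.mulLeft x⁻¹) _ _ fun y => rfl).trans_le hL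
    · rw [htrans]
      exact hρ _ (mul_left_mem_juntaSpace hg x)
  · exact fun f hf ρ hL hρ => hf ρ ⟨hL, hρ⟩
  · exact fun ρ hρ f hf => hf ρ hρ.1 hρ.2
  · exact fun ρ hρ => hρ.1
  · refine (card_filter_card_support_le (6 * t)).trans ?_
    rw [Fintype.card_fin]
    calc (n + 1) ^ (6 * t) * n ^ (6 * t) ≤ (n ^ 2) ^ (6 * t) * n ^ (6 * t) :=
          Nat.mul_le_mul_right _ (Nat.pow_le_pow_left (by nlinarith) _)
      _ = n ^ (18 * t) := by rw [← pow_mul, ← pow_add]; congr 1; ring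
  · intro x
    by_cases hx : x ∈ G
    · simp only [red, hx, if_true, apply_ite abs, abs_one, abs_zero, sum_ite_eq]
      exact_mod_cast Nat.one_le_pow _ _ (by omega)
    · simp only [red, hx, if_false]
      refine (sum_le_sum_of_subset_of_nonneg (subset_univ _) fun _ _ _ => abs_nonneg _).trans
        ((hc2 x).trans ?_)
      exact_mod_cast hpow (by norm_num)
  · intro g hg g' _
    simp only [red, hg, if_true]
  · intro f hf x
    by_cases hx : x ∈ G
    · simp [red, hx]
    · simp only [red, hx, if_false]
      rw [hcG x (fun a g => a * f g) (by simp), ← sub_eq_zero]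
      have hδ (g : Perm (Fin n) → ℝ) :
          ∑ y, (((if y = x then 1 else 0) - c x y : ℤ) : ℝ) * g y = g x - ∑ y, (c x y : ℝ) * g y := by
        simp [sub_mul]
      rw [← hδ]
      refine hf _ ?_ fun g hg => ?_
      · calc _ ≤ ∑ y, (|if y = x then (1 : ℤ) else 0| + |c x y|) :=
              sum_le_sum fun y _ => abs_sub _ _
          _ = 1 + ∑ y, |c x y| := by simp [sum_add_distrib, apply_ite abs]
          _ ≤ 1 + (n ^ (9 * t) : ℕ) := by linarith [hc2 x]
          _ ≤ _ := by exact_mod_cast h9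
      · rw [hδ]
        induction hg using Submodule.span_induction with
        | mem g hg =>
          obtain ⟨h, Q, hQ, hh, rfl⟩ := hg
          rw [empty_union] at hh
          exact sub_eq_zero.2 (hc x h Q hQ hh)
        | zero => simp
        | add g g' _ _ h1 h2 =>
          simp only [Pi.add_apply, mul_add, sum_add_distrib]
          linear_combination h1 + h2
        | smul a g _ h1 =>
          simp only [Pi.smul_apply, smul_eq_mul, mul_left_comm _ a, ← mul_sum]
          linear_combination a * h1

lemma isTwisePermutation_of_sum_eq {n t : ℕ} {T : Finset (Perm (Fin n))}
    (hT : ∀ f ∈ juntaSpace (∅ : Finset (Fin n)) t,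
      ∑ x ∈ T, f x = (#T : ℝ) / Fintype.card (Perm (Fin n)) * ∑ x, f x) :
    IsTwisePermutation n t T := by
  intro I J hI hJ
  have h1 := hT _ (mem_juntaSpace (P := ∅) (Q := univ.image I)
    (h := fun u => if ∀ j, u (I j) = J j then 1 else 0)
    (card_image_le.trans (by simp)) fun u v huv => by
      have this (j : Fin t) : u (I j) = v (I j) := huv _ (by simp)
      simp [this])
  have h2 := descFactorial_mul_sum_perm (⟨I, hI⟩ : Fin t ↪ Fin n)
    fun K => if K = ⟨J, hJ⟩ then 1 else 0
  have h3 (σ : Perm (Fin n)) : (⟨I, hI⟩ : Fin t ↪ Fin n).trans σ.toEmbedding = ⟨J, hJ⟩ ↔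
      ∀ j, σ (I j) = J j := by
    simp [Function.Embedding.ext_iff]
  simp only [h3, Fintype.card_fin, sum_ite_eq', mem_univ, if_true, mul_one] at h2
  rw [Fintype.card_perm, Fintype.card_fin] at h1
  have h4 : (n.factorial : ℝ) ≠ 0 := by exact_mod_cast n.factorial_ne_zero
  rw [← sum_filter, sum_const, nsmul_eq_mul, mul_one] at h1
  field_simp at h1
  have h5 : (#{π ∈ T | ∀ j, π (I j) = J j} * n.descFactorial t : ℝ) = #T := by
    refine mul_right_cancel₀ h4 ?_
    linear_combination (n.descFactorial t : ℝ) * h1 + (#T : ℝ) * h2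
  exact_mod_cast h5

lemma exists_isTwisePermutation_card_le {n t : ℕ} (h0 : 1 ≤ n) (ht : 1 ≤ t)
    (hn : n ^ (360 * t) < n.factorial) :
    ∃ T : Finset (Perm (Fin n)), T.Nonempty ∧ IsTwisePermutation n t T ∧
      #T ≤ n ^ (360 * t) := by
  have hlt : 360 * t < n := by
    by_contra! h
    exact absurd (n.factorial_le_pow.trans (Nat.pow_le_pow_right (by omega) h)) (by omega)
  obtain ⟨G, red, R, h⟩ := exists_isShortlyPresented (n := n) (by omega) ht
  have hq2 : 2 ^ (t + 1) ≤ n ^ (18 * t) :=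
    (Nat.pow_le_pow_left (by omega) _).trans (Nat.pow_le_pow_right (by omega) (by omega))
  obtain ⟨k, hk⟩ := exists_uniform_measure (α := Fin n) (d := 2 * t) (by simp; omega)
  have hN : (2 * (2 * t)).factorial * (Fintype.card (Fin n)).descFactorial (2 * t) ≤
      n ^ (18 * t) := by
    rw [Fintype.card_fin]
    calc _ ≤ n ^ (2 * (2 * t)) * n ^ (2 * t) :=
          Nat.mul_le_mul ((Nat.factorial_le_pow _).trans (Nat.pow_le_pow_left (by omega) _))
            (Nat.descFactorial_le_pow _ _)
      _ = n ^ (6 * t) := by rw [← pow_add]; congr 1; ring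
      _ ≤ _ := Nat.pow_le_pow_right (by omega) (by omega)
  obtain ⟨T, hT, hcard, hsum⟩ := h.exists_design
    (Nat.mul_pos (Nat.factorial_pos _) (Nat.descFactorial_pos.2 (by simp; omega))) hN k
    (fun f hf => hk f (juntaClosure_le_juntaSpace hq2 hf)) (by
      rw [Fintype.card_perm, Fintype.card_fin, ← pow_mul]
      exact (Nat.pow_le_pow_right (by omega) (by omega)).trans hn.le)
  refine ⟨T, hT, isTwisePermutation_of_sum_eq fun f hf =>
    hsum f (juntaSpace_le_juntaClosure _ _ hf), hcard.trans ?_⟩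
  rw [← pow_mul]
  exact Nat.pow_le_pow_right (by omega) (by omega)

end Presentation

/-- There exists a universal constant `c > 0` such that for all integers `n ≥ 1` and
`1 ≤ t ≤ n` there exists a (nonempty) `t`-wise permutation `T ⊆ S_n` satisfying
`|T| ≤ (c·n)^(c·t)`. -/
theorem exists_twise_permutation :
    ∃ c : ℝ, 0 < c ∧
      ∀ n t : ℕ, 1 ≤ n → 1 ≤ t → t ≤ n →
        ∃ T : Finset (Equiv.Perm (Fin n)), T.Nonempty ∧ IsTwisePermutation n t T ∧
          (T.card : ℝ) ≤ (c * n) ^ (c * t) := by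
  refine ⟨360, by norm_num, fun n t hn ht _ => ?_⟩
  obtain ⟨T, hT, htwise, hcard⟩ : ∃ T : Finset (Equiv.Perm (Fin n)), T.Nonempty ∧
      IsTwisePermutation n t T ∧ T.card ≤ n ^ (360 * t) := by
    rcases lt_or_ge (n ^ (360 * t)) n.factorial with hlt | hge
    · exact exists_isTwisePermutation_card_le hn ht hlt
    · refine ⟨Finset.univ, Finset.univ_nonempty, isTwisePermutation_of_sum_eq fun f _ => ?_, ?_⟩
      · rw [Finset.card_univ, div_self (by exact_mod_cast Fintype.card_ne_zero), one_mul]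
      · simpa [Fintype.card_perm] using hge
  refine ⟨T, hT, htwise, ?_⟩
  calc (T.card : ℝ) ≤ (n : ℝ) ^ (360 * t) := by exact_mod_cast hcard
    _ ≤ (360 * n : ℝ) ^ (360 * t) := by
      gcongr
      linarith [(n.cast_nonneg : (0 : ℝ) ≤ n)]
    _ = _ := by
      rw [← Real.rpow_natCast]
      push_cast
      rfl
end
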